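/- Up to an automorphism of ℙ²(ℂ), there are exactly four convex degree-three foliations of the complex projective plane, namely the foliations H₁, H₃, F₁, F₃ given in the affine chart z = 1 by ω₁ = y³dx − x³dy, ω₃ = y²(3x+y)dx − x²(x+3y)dy, ω̄₁ = y³dx + x³(x dy − y dx), and ω̄₃ = (x³−x)dy − (y³−y)dx (the Fermat foliation). That is: each of these four foliations is convex, they are pairwise not linearly conjugate, and every convex degree-3 foliation of ℙ²(ℂ) is linearly conjugate to one of them. -/

import Mathlib

open MvPolynomial

noncomputable section

/-- The derivation associated to the homogeneous vector field
`Z = A ∂x + B ∂y + C ∂z`. -/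
def Zop (A B Cz f : MvPolynomial (Fin 3) ℂ) : MvPolynomial (Fin 3) ℂ :=
  A * pderiv 0 f + B * pderiv 1 f + Cz * pderiv 2 f

/-- The extactic polynomial of the vector field `Z = A ∂x + B ∂y + C ∂z`, cutting out
the inflection divisor of the associated foliation. -/
def extactic (A B Cz : MvPolynomial (Fin 3) ℂ) : MvPolynomial (Fin 3) ℂ :=
  Matrix.det
    !![X 0, Zop A B Cz (X 0), Zop A B Cz (Zop A B Cz (X 0));
       X 1, Zop A B Cz (X 1), Zop A B Cz (Zop A B Cz (X 1));
       X 2, Zop A B Cz (X 2), Zop A B Cz (Zop A B Cz (X 2))]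

/-- The line `ker L` is invariant by the foliation defined by `Z`: `L ∣ Z(L)`. -/
def LineInvZ (A B Cz L : MvPolynomial (Fin 3) ℂ) : Prop :=
  L ∣ Zop A B Cz L

/-- The foliation defined by `Z = A ∂x + B ∂y + C ∂z` is convex: its extactic
polynomial is a product of linear forms, each defining an invariant line. -/
def ConvexFol (A B Cz : MvPolynomial (Fin 3) ℂ) : Prop :=
  ∃ (n : ℕ) (c : ℂ) (L : Fin n → MvPolynomial (Fin 3) ℂ), c ≠ 0 ∧
    (∀ i, (L i).IsHomogeneous 1 ∧ L i ≠ 0 ∧ LineInvZ A B Cz (L i)) ∧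
    extactic A B Cz = C c * ∏ i, L i

/-- The projective 1-form `i_R i_Z (dx ∧ dy ∧ dz)` of the foliation defined by the
vector field `Z = A ∂x + B ∂y + C ∂z`. -/
def OmZ (A B Cz : MvPolynomial (Fin 3) ℂ) : Fin 3 → MvPolynomial (Fin 3) ℂ :=
  ![X 2 * B - X 1 * Cz, X 0 * Cz - X 2 * A, X 1 * A - X 0 * B]

/-- Substitution of the linear change of variables on `ℂ³` given by the matrix `M`. -/
def subst3 (M : Matrix (Fin 3) (Fin 3) ℂ) (P : MvPolynomial (Fin 3) ℂ) :
    MvPolynomial (Fin 3) ℂ :=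
  aeval (fun i => ∑ j, C (M i j) * X j) P

/-- Pullback of the 1-form with coefficient vector `Ω` by the linear map of matrix `M`. -/
def pb3 (M : Matrix (Fin 3) (Fin 3) ℂ) (Ω : Fin 3 → MvPolynomial (Fin 3) ℂ) :
    Fin 3 → MvPolynomial (Fin 3) ℂ :=
  fun i => ∑ j, C (M j i) * subst3 M (Ω j)

/-- Two foliations (given by their projective 1-forms) are linearly conjugate:
`T*Ω = c·Ω'` for some `T ∈ GL₃(ℂ)` and `c ∈ ℂ*`. -/
def LinConj3 (Ω Ω' : Fin 3 → MvPolynomial (Fin 3) ℂ) : Prop :=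
  ∃ (M : Matrix (Fin 3) (Fin 3) ℂ) (c : ℂ), IsUnit M.det ∧ c ≠ 0 ∧
    pb3 M Ω = fun i => C c * Ω' i

/-- `Ω` defines a degree-`d` foliation of `ℙ²(ℂ)`. -/
def IsFolDeg (d : ℕ) (Ω : Fin 3 → MvPolynomial (Fin 3) ℂ) : Prop :=
  Ω ≠ 0 ∧ (∀ i, (Ω i).IsHomogeneous (d + 1)) ∧
    X 0 * Ω 0 + X 1 * Ω 1 + X 2 * Ω 2 = 0 ∧
    ∀ h : MvPolynomial (Fin 3) ℂ, (∀ i, h ∣ Ω i) → IsUnit h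

/-- The four convex models: the vector fields of `H₁`, `H₃`, `F₁`, `F₃`. -/
def models10 : Fin 4 →
    MvPolynomial (Fin 3) ℂ × MvPolynomial (Fin 3) ℂ × MvPolynomial (Fin 3) ℂ :=
  ![(X 0 ^ 3, X 1 ^ 3, 0),
    (X 0 ^ 2 * (X 0 + 3 * X 1), X 1 ^ 2 * (3 * X 0 + X 1), 0),
    (0, X 1 ^ 3, X 0 ^ 3),
    (X 0 ^ 3, X 1 ^ 3, X 2 ^ 3)]

set_option linter.all false
lemma Zop_add (A B Cz f g : MvPolynomial (Fin 3) ℂ) :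
    Zop A B Cz (f+g) = Zop A B Cz f+Zop A B Cz g := by
  simp only [Zop, map_add]; ring
lemma Zop_mul (A B Cz f g : MvPolynomial (Fin 3) ℂ) :
    Zop A B Cz (f*g) = f*Zop A B Cz g+g*Zop A B Cz f := by
  simp only [Zop, Derivation.leibniz, smul_eq_mul]; ring
lemma Zop_C (A B Cz : MvPolynomial (Fin 3) ℂ) (k : ℂ) : Zop A B Cz (C k) =0 := by
  simp [Zop]
lemma Zop_X0 (A B Cz : MvPolynomial (Fin 3) ℂ) : Zop A B Cz (X 0) = A := by
  simp [Zop, pderiv_X]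
lemma Zop_X1 (A B Cz : MvPolynomial (Fin 3) ℂ) : Zop A B Cz (X 1) = B := by
  simp [Zop, pderiv_X]
lemma Zop_X2 (A B Cz : MvPolynomial (Fin 3) ℂ) : Zop A B Cz (X 2) = Cz := by
  simp [Zop, pderiv_X]
def rowL (M : Matrix (Fin 3) (Fin 3) ℂ) (i : Fin 3) : MvPolynomial (Fin 3) ℂ :=
  C (M i 0)*X 0+C (M i 1)*X 1+C (M i 2)*X 2
lemma subst3_X (M : Matrix (Fin 3) (Fin 3) ℂ) (i : Fin 3) : subst3 M (X i) = rowL M i := by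
  simp [subst3, rowL, Fin.sum_univ_three]
lemma subst3_add (M : Matrix (Fin 3) (Fin 3) ℂ) (f g : MvPolynomial (Fin 3) ℂ) :
    subst3 M (f+g) = subst3 M f+subst3 M g := by simp [subst3]
lemma subst3_sub (M : Matrix (Fin 3) (Fin 3) ℂ) (f g : MvPolynomial (Fin 3) ℂ) :
    subst3 M (f-g) = subst3 M f-subst3 M g := by simp [subst3]
lemma subst3_mul (M : Matrix (Fin 3) (Fin 3) ℂ) (f g : MvPolynomial (Fin 3) ℂ) :
    subst3 M (f*g) = subst3 M f*subst3 M g := by simp [subst3]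
lemma subst3_C (M : Matrix (Fin 3) (Fin 3) ℂ) (k : ℂ) : subst3 M (C k) = C k := by
  simp [subst3, algebraMap_eq]
lemma Zop_rowL (A B Cz : MvPolynomial (Fin 3) ℂ) (M : Matrix (Fin 3) (Fin 3) ℂ) (i : Fin 3) :
    Zop A B Cz (rowL M i) = C (M i 0)*A+C (M i 1)*B+C (M i 2)*Cz := by
  simp only [rowL, Zop_add, Zop_mul, Zop_C, Zop_X0, Zop_X1, Zop_X2]; ring
def RelP (M : Matrix (Fin 3) (Fin 3) ℂ) (s : ℂ) (q A B Cz A' B' C' : MvPolynomial (Fin 3) ℂ) :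
    Prop :=
  Zop A' B' C' (rowL M 0) = C s*subst3 M A+q*rowL M 0 ∧
  Zop A' B' C' (rowL M 1) = C s*subst3 M B+q*rowL M 1 ∧
  Zop A' B' C' (rowL M 2) = C s*subst3 M Cz+q*rowL M 2
lemma Euler_rowL (M : Matrix (Fin 3) (Fin 3) ℂ) (i : Fin 3) :
    Zop (X 0) (X 1) (X 2) (rowL M i) = rowL M i := by
  rw [Zop_rowL]; rfl
lemma RelP.chain {M : Matrix (Fin 3) (Fin 3) ℂ} {s : ℂ}
    {q A B Cz A' B' C' : MvPolynomial (Fin 3) ℂ} (h : RelP M s q A B Cz A' B' C')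
    (f : MvPolynomial (Fin 3) ℂ) :
    Zop A' B' C' (subst3 M f) = C s*subst3 M (Zop A B Cz f)
      + q*Zop (X 0) (X 1) (X 2) (subst3 M f) := by
  induction f using MvPolynomial.induction_on with
  | C a => simp [Zop_C, subst3]
  | add p r hp hr => simp only [subst3_add, Zop_add, hp, hr]; ring
  | mul_X p i hp =>
    simp only [subst3_mul, Zop_mul, subst3_X, Euler_rowL, subst3_add, hp]
    have : Zop A' B' C' (rowL M i) = C s*subst3 M (Zop A B Cz (X i))+q*rowL M i := by
      obtain ⟨h0, h1, h2⟩ := h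
      fin_cases i
      · simpa [Zop_X0] using h0
      · simpa [Zop_X1] using h1
      · simpa [Zop_X2] using h2
    rw [this]; ring
lemma Euler3 {f : MvPolynomial (Fin 3) ℂ} {n : ℕ} (hf : f.IsHomogeneous n) :
    Zop (X 0) (X 1) (X 2) f = (n : MvPolynomial (Fin 3) ℂ)*f := by
  have := hf.sum_X_mul_pderiv
  simpa [Zop, Fin.sum_univ_three] using this
lemma rowL_homog (M : Matrix (Fin 3) (Fin 3) ℂ) (i : Fin 3) : (rowL M i).IsHomogeneous 1 := by
  unfold rowL
  refine ((IsHomogeneous.C_mul (isHomogeneous_X _ _) _).add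
    (IsHomogeneous.C_mul (isHomogeneous_X _ _) _)).add
    (IsHomogeneous.C_mul (isHomogeneous_X _ _) _)
lemma subst3_homog {M : Matrix (Fin 3) (Fin 3) ℂ} {f : MvPolynomial (Fin 3) ℂ} {n : ℕ}
    (hf : f.IsHomogeneous n) : (subst3 M f).IsHomogeneous n := by
  have := hf.aeval (fun i => ∑ j, C (M i j)*X j) (n := 1) (fun i => by
    refine IsHomogeneous.sum _ _ _ fun j _ => IsHomogeneous.C_mul (isHomogeneous_X _ _) _)
  simpa [subst3] using this
lemma extactic_eq (A B Cz : MvPolynomial (Fin 3) ℂ) : extactic A B Cz =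
    Matrix.det !![X 0, A, Zop A B Cz A; X 1, B, Zop A B Cz B; X 2, Cz, Zop A B Cz Cz] := by
  simp only [extactic, Zop_X0, Zop_X1, Zop_X2]
lemma RelP.ext {M : Matrix (Fin 3) (Fin 3) ℂ} {s : ℂ}
    {q A B Cz A' B' C' : MvPolynomial (Fin 3) ℂ} (h : RelP M s q A B Cz A' B' C')
    (hA : A.IsHomogeneous 3) (hB : B.IsHomogeneous 3) (hC : Cz.IsHomogeneous 3) :
    C M.det*extactic A' B' C' = C (s^3)*subst3 M (extactic A B Cz) := by
  have hZ : ∀ (i : Fin 3) (F : MvPolynomial (Fin 3) ℂ), F.IsHomogeneous 3 →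
      Zop A' B' C' (rowL M i) = C s*subst3 M F+q*rowL M i →
      Zop A' B' C' (Zop A' B' C' (rowL M i)) =
        C s*(C s*subst3 M (Zop A B Cz F)+q*(3*subst3 M F)) +
        (q*(C s*subst3 M F+q*rowL M i)+rowL M i*Zop A' B' C' q) := by
    intro i F hF hi
    have e : Zop (X 0) (X 1) (X 2) (subst3 M F) =3*subst3 M F := by
      simpa using Euler3 (subst3_homog (M := M) hF)
    conv_lhs => rw [hi]
    rw [Zop_add, Zop_mul, Zop_mul, Zop_C, h.chain, e, hi]; ring
  have hZ2 : ∀ i : Fin 3, Zop A' B' C' (Zop A' B' C' (rowL M i)) =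
      C (M i 0)*Zop A' B' C' A'+C (M i 1)*Zop A' B' C' B'+C (M i 2)*Zop A' B' C' C' := by
    intro i
    rw [Zop_rowL]; simp only [Zop_add, Zop_mul, Zop_C]; ring
  obtain ⟨h0, h1, h2⟩ := h
  have k0 := hZ 0 A hA h0
  have k1 := hZ 1 B hB h1
  have k2 := hZ 2 Cz hC h2
  rw [hZ2] at k0 k1 k2
  have e1 : C M.det*extactic A' B' C' = Matrix.det
     !![rowL M 0, Zop A' B' C' (rowL M 0), C (M 0 0)*Zop A' B' C' A'+C (M 0 1)*Zop A' B' C' B'+C (M 0 2)*Zop A' B' C' C';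
        rowL M 1, Zop A' B' C' (rowL M 1), C (M 1 0)*Zop A' B' C' A'+C (M 1 1)*Zop A' B' C' B'+C (M 1 2)*Zop A' B' C' C';
        rowL M 2, Zop A' B' C' (rowL M 2), C (M 2 0)*Zop A' B' C' A'+C (M 2 1)*Zop A' B' C' B'+C (M 2 2)*Zop A' B' C' C'] := by
    rw [extactic_eq]
    simp only [Zop_rowL]
    simp only [rowL, Matrix.det_fin_three, Matrix.of_apply, Matrix.cons_val, map_sub,
      map_add, map_mul]
    ring
  rw [e1, h0, h1, h2, k0, k1, k2, extactic_eq]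
  simp only [Matrix.det_fin_three, Matrix.of_apply, Matrix.cons_val, subst3_add, subst3_sub,
    subst3_mul, subst3_X, map_pow]
  ring
lemma RelP.pb {M : Matrix (Fin 3) (Fin 3) ℂ} {s : ℂ}
    {q A B Cz A' B' C' : MvPolynomial (Fin 3) ℂ} (h : RelP M s q A B Cz A' B' C') (i : Fin 3) :
    C s*pb3 M (OmZ A B Cz) i = C M.det*OmZ A' B' C' i := by
  obtain ⟨h0, h1, h2⟩ := h
  rw [Zop_rowL] at h0 h1 h2
  have k0 : C s*subst3 M A = C (M 0 0)*A'+C (M 0 1)*B'+C (M 0 2)*C'-q*rowL M 0 := by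
    rw [h0]; ring
  have k1 : C s*subst3 M B = C (M 1 0)*A'+C (M 1 1)*B'+C (M 1 2)*C'-q*rowL M 1 := by
    rw [h1]; ring
  have k2 : C s*subst3 M Cz = C (M 2 0)*A'+C (M 2 1)*B'+C (M 2 2)*C'-q*rowL M 2 := by
    rw [h2]; ring
  have e : C s*pb3 M (OmZ A B Cz) i =
      C (M 0 i)*(rowL M 2*(C s*subst3 M B)-rowL M 1*(C s*subst3 M Cz)) +
      C (M 1 i)*(rowL M 0*(C s*subst3 M Cz)-rowL M 2*(C s*subst3 M A)) +
      C (M 2 i)*(rowL M 1*(C s*subst3 M A)-rowL M 0*(C s*subst3 M B)) := by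
    simp only [pb3, Fin.sum_univ_three, OmZ, Matrix.cons_val, subst3_sub, subst3_mul, subst3_X]
    ring
  rw [e, k0, k1, k2]
  fin_cases i <;>
  · simp only [OmZ, Matrix.det_fin_three, rowL, Matrix.cons_val, map_sub, map_add, map_mul,
      Fin.zero_eta, Fin.mk_one, Fin.reduceFinMk]
    ring
lemma subst3_comp (M N : Matrix (Fin 3) (Fin 3) ℂ) (f : MvPolynomial (Fin 3) ℂ) :
    subst3 N (subst3 M f) = subst3 (M*N) f := by
  induction f using MvPolynomial.induction_on with
  | C a => simp [subst3_C]
  | add p r hp hr => simp only [subst3_add, hp, hr]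
  | mul_X p i hp =>
    rw [subst3_mul, subst3_mul, subst3_mul, hp, subst3_X, subst3_X]
    congr 1
    simp only [rowL, subst3_add, subst3_mul, subst3_C, subst3_X, Matrix.mul_apply,
      Fin.sum_univ_three, map_add, map_mul]
    ring
lemma LinConj3.trans' {M : Matrix (Fin 3) (Fin 3) ℂ} {k : ℂ} (hM : IsUnit M.det) (hk : k ≠0)
    {Ω Ω' Ω'' : Fin 3 → MvPolynomial (Fin 3) ℂ} (h : pb3 M Ω = fun i => C k * Ω' i)
    (h' : LinConj3 Ω' Ω'') : LinConj3 Ω Ω'' := by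
  obtain ⟨N, c, hN, hc, e⟩ := h'
  refine ⟨M*N, k*c, by rw [Matrix.det_mul]; exact hM.mul hN, mul_ne_zero hk hc, ?_⟩
  funext i
  have e1 : pb3 (M*N) Ω i = ∑ j, C (N j i)*subst3 N (pb3 M Ω j) := by
    simp only [pb3, Fin.sum_univ_three, Matrix.mul_apply, subst3_add, subst3_mul, subst3_C,
      subst3_comp, map_add, map_mul]
    ring
  have e2 := congrFun e i
  rw [e1, h]
  simp only [subst3_mul, subst3_C]
  rw [map_mul, mul_assoc, ← e2]
  simp only [pb3, Fin.sum_univ_three]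
  ring
lemma RelP.conj {M : Matrix (Fin 3) (Fin 3) ℂ} {s : ℂ}
    {q A B Cz A' B' C' : MvPolynomial (Fin 3) ℂ} (h : RelP M s q A B Cz A' B' C')
    (hM : M.det ≠0) (hs : s ≠0) {Ω : Fin 3 → MvPolynomial (Fin 3) ℂ}
    (h' : LinConj3 (OmZ A' B' C') Ω) : LinConj3 (OmZ A B Cz) Ω := by
  refine LinConj3.trans' (M := M) (k := s⁻¹*M.det) (isUnit_iff_ne_zero.2 hM)
    (mul_ne_zero (inv_ne_zero hs) hM) ?_ h'
  funext i
  have := h.pb i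
  rw [map_mul, mul_assoc, ← this, ← mul_assoc, ← map_mul, inv_mul_cancel₀ hs]
  simp
def cub (a : Fin 10 → ℂ) (x y z : ℂ) : ℂ :=
  a 0*x^3+a 1*x^2*y+a 2*x*y^2+a 3*y^3
    + z*(a 4*x^2+a 5*x*y+a 6*y^2)+z^2*(a 7*x+a 8*y)+a 9*z^3
def cubx (a : Fin 10 → ℂ) (x y z : ℂ) : ℂ :=
  3*a 0*x^2+2*a 1*x*y+a 2*y^2+z*(2*a 4*x+a 5*y)+z^2*a 7
def cuby (a : Fin 10 → ℂ) (x y z : ℂ) : ℂ :=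
  a 1*x^2+2*a 2*x*y+3*a 3*y^2+z*(a 5*x+2*a 6*y)+z^2*a 8
def cubz (a : Fin 10 → ℂ) (x y z : ℂ) : ℂ :=
  a 4*x^2+a 5*x*y+a 6*y^2+2*z*(a 7*x+a 8*y)+3*a 9*z^2
def Pc (a : Fin 10 → ℂ) : MvPolynomial (Fin 3) ℂ :=
  C (a 0)*X 0^3+C (a 1)*X 0^2*X 1+C (a 2)*X 0*X 1^2+C (a 3)*X 1^3
    + X 2*(C (a 4)*X 0^2+C (a 5)*X 0*X 1+C (a 6)*X 1^2)
    + X 2^2*(C (a 7)*X 0+C (a 8)*X 1)+C (a 9)*X 2^3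
lemma eval_Pc (a : Fin 10 → ℂ) (v : Fin 3 → ℂ) : eval v (Pc a) = cub a (v 0) (v 1) (v 2) := by
  simp [Pc, cub]
lemma eval_Zop (A B D : MvPolynomial (Fin 3) ℂ) (a : Fin 10 → ℂ) (v : Fin 3 → ℂ) :
    eval v (Zop A B D (Pc a)) = eval v A*cubx a (v 0) (v 1) (v 2) +
      eval v B*cuby a (v 0) (v 1) (v 2)+eval v D*cubz a (v 0) (v 1) (v 2) := by
  simp [Zop, Pc, cubx, cuby, cubz, pderiv_X, Derivation.leibniz, Derivation.leibniz_pow]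
  ring
lemma exists_Pc {A : MvPolynomial (Fin 3) ℂ} (hA : A.IsHomogeneous 3) : ∃ a, A = Pc a := by
  rw [A.as_sum]
  refine Finset.sum_induction _ (fun p => ∃ a, p = Pc a) ?_ ?_ ?_
  · rintro _ _ ⟨a, rfl⟩ ⟨b, rfl⟩
    exact ⟨a+b, by simp only [Pc, Pi.add_apply, map_add]; ring⟩
  · exact ⟨0, by simp [Pc]⟩
  · intro d hd
    have h3 : d 0+d 1+d 2 =3 := by
      have := hA (mem_support_iff.1 hd)
      rw [Finsupp.weight_apply, Finsupp.sum_fintype _ _ (by simp)] at this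
      simpa [Fin.sum_univ_three] using this
    rw [monomial_eq, Finsupp.prod_fintype _ _ (by simp), Fin.prod_univ_three]
    generalize coeff d A = k
    generalize d 0 = p at *
    generalize d 1 = q at *
    obtain h2 : d 2 =3-p-q := by omega
    rw [h2]
    have hp : p ≤ 3 := by omega
    have hq : q ≤ 3-p := by omega
    interval_cases p <;> interval_cases q
    · exact ⟨![0,0,0,0,0,0,0,0,0,k], by simp [Pc]⟩
    · exact ⟨![0,0,0,0,0,0,0,0,k,0], by simp [Pc]; ring⟩
    · exact ⟨![0,0,0,0,0,0,k,0,0,0], by simp [Pc]; ring⟩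
    · exact ⟨![0,0,0,k,0,0,0,0,0,0], by simp [Pc]⟩
    · exact ⟨![0,0,0,0,0,0,0,k,0,0], by simp [Pc]; ring⟩
    · exact ⟨![0,0,0,0,0,k,0,0,0,0], by simp [Pc]; ring⟩
    · exact ⟨![0,0,k,0,0,0,0,0,0,0], by simp [Pc]; ring⟩
    · exact ⟨![0,0,0,0,k,0,0,0,0,0], by simp [Pc]; ring⟩
    · exact ⟨![0,k,0,0,0,0,0,0,0,0], by simp [Pc]; ring⟩
    · exact ⟨![k,0,0,0,0,0,0,0,0,0], by simp [Pc]⟩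
lemma Pc_homog (a : Fin 10 → ℂ) : (Pc a).IsHomogeneous 3 := by
  have hX := fun i : Fin 3 => isHomogeneous_X ℂ i
  have hp := fun (i : Fin 3) (n : ℕ) => (isHomogeneous_X ℂ i).pow n
  have e : Pc a = C (a 0)*(X 0^3)+C (a 1)*(X 0^2*X 1)+C (a 2)*(X 0*X 1^2)
      + C (a 3)*X 1^3+C (a 4)*(X 2*X 0^2)+C (a 5)*(X 2*X 0*X 1)
      + C (a 6)*(X 2*X 1^2)+C (a 7)*(X 2^2*X 0)+C (a 8)*(X 2^2*X 1)
      + C (a 9)*X 2^3 := by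
    simp only [Pc]; ring
  rw [e]
  refine (((((((((?_ : IsHomogeneous _ _).add ?_).add ?_).add ?_).add ?_).add ?_).add ?_).add
    ?_).add ?_).add ?_ <;> refine IsHomogeneous.C_mul ?_ _
  · exact hp 0 3
  · exact (hp 0 2).mul (hX 1)
  · exact (hX 0).mul (hp 1 2)
  · exact hp 1 3
  · exact (hX 2).mul (hp 0 2)
  · exact ((hX 2).mul (hX 0)).mul (hX 1)
  · exact (hX 2).mul (hp 1 2)
  · exact (hp 2 2).mul (hX 0)
  · exact (hp 2 2).mul (hX 1)
  · exact hp 2 3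
def ExtV (a b c : Fin 10 → ℂ) (x y z : ℂ) : ℂ :=
  let A := cub a x y z
  let B := cub b x y z
  let D := cub c x y z
  let A' := A*cubx a x y z+B*cuby a x y z+D*cubz a x y z
  let B' := A*cubx b x y z+B*cuby b x y z+D*cubz b x y z
  let D' := A*cubx c x y z+B*cuby c x y z+D*cubz c x y z
  x*(B*D'-D*B')-y*(A*D'-D*A')+z*(A*B'-B*A')
lemma eval_ext (a b c : Fin 10 → ℂ) (v : Fin 3 → ℂ) :
    eval v (extactic (Pc a) (Pc b) (Pc c)) = ExtV a b c (v 0) (v 1) (v 2) := by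
  rw [extactic_eq, Matrix.det_fin_three]
  simp only [Matrix.of_apply, Matrix.cons_val, map_add, map_sub, map_mul, eval_X, eval_Zop,
    eval_Pc, ExtV]
  ring
def lin (l : Fin 3 → ℂ) (x y z : ℂ) : ℂ := l 0*x+l 1*y+l 2*z
def InvL (a b c : Fin 10 → ℂ) (l : Fin 3 → ℂ) : Prop :=
  ∀ x y z, lin l x y z =0 →
    l 0*cub a x y z+l 1*cub b x y z+l 2*cub c x y z =0
def SingL (a b c : Fin 10 → ℂ) (l : Fin 3 → ℂ) : Prop :=
  ∀ x y z, lin l x y z =0 → y*cub c x y z = z*cub b x y z ∧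
    z*cub a x y z = x*cub c x y z ∧ x*cub b x y z = y*cub a x y z
def FactL (G : (Fin 3 → ℂ) → Prop) (K : ℂ → ℂ → ℂ → ℂ) : Prop :=
  ∃ (k : ℂ) (l : List (Fin 3 → ℂ)), k ≠0 ∧ (∀ m ∈ l, G m) ∧
    ∀ x y z, K x y z = k*(l.map (fun m => lin m x y z)).prod
structure Bad (a b c : Fin 10 → ℂ) : Prop where
  ng : ∀ i : Fin 4, ¬ LinConj3 (OmZ (Pc a) (Pc b) (Pc c))
        (OmZ (models10 i).1 (models10 i).2.1 (models10 i).2.2)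
  ncl : ∀ l, l ≠0 → ¬ SingL a b c l
  lines : FactL (fun l => l ≠0 ∧ InvL a b c l) (ExtV a b c)
def quad (q : Fin 6 → ℂ) (x y z : ℂ) : ℂ :=
  q 0*x^2+q 1*x*y+q 2*y^2+z*(q 3*x+q 4*y)+q 5*z^2
def Qc (q : Fin 6 → ℂ) : MvPolynomial (Fin 3) ℂ :=
  C (q 0)*X 0^2+C (q 1)*X 0*X 1+C (q 2)*X 1^2
    + X 2*(C (q 3)*X 0+C (q 4)*X 1)+C (q 5)*X 2^2
def RelV (M : Matrix (Fin 3) (Fin 3) ℂ) (s : ℂ) (q : Fin 6 → ℂ) (a b c a' b' c' : Fin 10 → ℂ) :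
    Prop :=
  ∀ x y z,
    M 0 0*cub a' x y z+M 0 1*cub b' x y z+M 0 2*cub c' x y z =
      s*cub a (lin (M 0) x y z) (lin (M 1) x y z) (lin (M 2) x y z) +
        quad q x y z*lin (M 0) x y z ∧
    M 1 0*cub a' x y z+M 1 1*cub b' x y z+M 1 2*cub c' x y z =
      s*cub b (lin (M 0) x y z) (lin (M 1) x y z) (lin (M 2) x y z) +
        quad q x y z*lin (M 1) x y z ∧
    M 2 0*cub a' x y z+M 2 1*cub b' x y z+M 2 2*cub c' x y z =
      s*cub c (lin (M 0) x y z) (lin (M 1) x y z) (lin (M 2) x y z) +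
        quad q x y z*lin (M 2) x y z
lemma eval_subst3 (M : Matrix (Fin 3) (Fin 3) ℂ) (f : MvPolynomial (Fin 3) ℂ) (v : Fin 3 → ℂ) :
    eval v (subst3 M f) = eval (fun i => lin (M i) (v 0) (v 1) (v 2)) f := by
  induction f using MvPolynomial.induction_on with
  | C a => simp [subst3_C]
  | add p r hp hr => simp only [subst3_add, map_add, hp, hr]
  | mul_X p i hp =>
    rw [subst3_mul, map_mul, map_mul, hp, subst3_X]
    simp [rowL, lin]
lemma RelV.toP {M : Matrix (Fin 3) (Fin 3) ℂ} {s : ℂ} {q : Fin 6 → ℂ}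
    {a b c a' b' c' : Fin 10 → ℂ} (h : RelV M s q a b c a' b' c') :
    RelP M s (Qc q) (Pc a) (Pc b) (Pc c) (Pc a') (Pc b') (Pc c') := by
  have hq : ∀ v, eval v (Qc q) = quad q (v 0) (v 1) (v 2) := by
    intro v; simp [Qc, quad]
  refine ⟨?_, ?_, ?_⟩ <;>
  · refine MvPolynomial.funext fun v => ?_
    rw [Zop_rowL]
    simp only [map_add, map_mul, eval_C, eval_Pc, eval_subst3, hq]
    have := h (v 0) (v 1) (v 2)
    first
    | simpa [rowL, lin] using this.1
    | simpa [rowL, lin] using this.2.1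
    | simpa [rowL, lin] using this.2.2
lemma exists_preim (M : Matrix (Fin 3) (Fin 3) ℂ) (hM : M.det ≠0) (X Y Z : ℂ) :
    ∃ x y z, lin (M 0) x y z = X ∧ lin (M 1) x y z = Y ∧ lin (M 2) x y z = Z := by
  have hu : IsUnit M.det := isUnit_iff_ne_zero.2 hM
  let w : Fin 3 → ℂ := M⁻¹.mulVec ![X, Y, Z]
  have hw : M.mulVec w = ![X, Y, Z] := by
    simp only [w, Matrix.mulVec_mulVec, Matrix.mul_nonsing_inv _ hu, Matrix.one_mulVec]
  refine ⟨w 0, w 1, w 2, ?_, ?_, ?_⟩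
  · have := congrFun hw 0; simpa [Matrix.mulVec, dotProduct, Fin.sum_univ_three, lin] using this
  · have := congrFun hw 1; simpa [Matrix.mulVec, dotProduct, Fin.sum_univ_three, lin] using this
  · have := congrFun hw 2; simpa [Matrix.mulVec, dotProduct, Fin.sum_univ_three, lin] using this
lemma lin_inj (l : Fin 3 → ℂ) : (∀ x y z, lin l x y z =0) → l =0 := by
  intro h
  funext i
  fin_cases i
  · simpa [lin] using h 1 0 0
  · simpa [lin] using h 0 1 0
  · simpa [lin] using h 0 0 1
def pl (M : Matrix (Fin 3) (Fin 3) ℂ) (l : Fin 3 → ℂ) : Fin 3 → ℂ :=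
  fun j => l 0*M 0 j+l 1*M 1 j+l 2*M 2 j
lemma lin_pl (M : Matrix (Fin 3) (Fin 3) ℂ) (l : Fin 3 → ℂ) (x y z : ℂ) :
    lin (pl M l) x y z = lin l (lin (M 0) x y z) (lin (M 1) x y z) (lin (M 2) x y z) := by
  simp only [lin, pl]; ring
lemma RelV.inv {M : Matrix (Fin 3) (Fin 3) ℂ} {s : ℂ} {q : Fin 6 → ℂ}
    {a b c a' b' c' : Fin 10 → ℂ} (h : RelV M s q a b c a' b' c') {l : Fin 3 → ℂ}
    (hl : InvL a b c l) : InvL a' b' c' (pl M l) := by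
  intro x y z e
  rw [lin_pl] at e
  have := hl _ _ _ e
  obtain ⟨h0, h1, h2⟩ := h x y z
  simp only [pl]
  have e' := e
  rw [lin] at e'
  linear_combination l 0*h0+l 1*h1+l 2*h2+s*this+quad q x y z*e'
theorem Bad.trans {M : Matrix (Fin 3) (Fin 3) ℂ} {s : ℂ} {q : Fin 6 → ℂ}
    {a b c a' b' c' : Fin 10 → ℂ} (H : Bad a b c) (hM : M.det ≠0) (hs : s ≠0)
    (h : RelV M s q a b c a' b' c') : Bad a' b' c' ∧
    ∀ x y z, M.det*ExtV a' b' c' x y z =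
      s^3*ExtV a b c (lin (M 0) x y z) (lin (M 1) x y z) (lin (M 2) x y z) := by
  have hE : ∀ x y z, M.det*ExtV a' b' c' x y z =
      s^3*ExtV a b c (lin (M 0) x y z) (lin (M 1) x y z) (lin (M 2) x y z) := by
    intro x y z
    have := congrArg (eval ![x, y, z]) (h.toP.ext (Pc_homog a) (Pc_homog b) (Pc_homog c))
    simp only [map_mul, eval_C, eval_subst3, eval_ext] at this
    simpa using this
  refine ⟨⟨?_, ?_, ?_⟩, hE⟩
  · intro i hi
    exact H.ng i (h.toP.conj hM hs hi)
  · intro l hl hS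
    have hu : IsUnit M.det := isUnit_iff_ne_zero.2 hM
    have hl' : pl M (pl M⁻¹ l) = l := by
      have e1 := Matrix.nonsing_inv_mul M hu
      have e : ∀ i j, M⁻¹ i 0*M 0 j+M⁻¹ i 1*M 1 j+M⁻¹ i 2*M 2 j = (1 : Matrix (Fin 3) (Fin 3) ℂ) i j := by
        intro i j; rw [← e1, Matrix.mul_apply, Fin.sum_univ_three]
      funext j
      have := e 0 j
      have h1 := e 1 j
      have h2 := e 2 j
      have : pl M (pl M⁻¹ l) j = l 0*(1 : Matrix (Fin 3) (Fin 3) ℂ) 0 j +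
          l 1*(1 : Matrix (Fin 3) (Fin 3) ℂ) 1 j+l 2*(1 : Matrix (Fin 3) (Fin 3) ℂ) 2 j := by
        rw [← this, ← h1, ← h2]; simp only [pl]; ring
      rw [this]
      fin_cases j <;> simp [Matrix.one_apply]
    refine H.ncl (pl M⁻¹ l) ?_ ?_
    · intro h0
      rw [h0] at hl'
      apply hl
      rw [← hl']; funext j; simp [pl]
    · intro X Y Z e
      obtain ⟨x, y, z, rfl, rfl, rfl⟩ := exists_preim M hM X Y Z
      rw [← lin_pl, hl'] at e
      obtain ⟨s0, s1, s2⟩ := hS x y z e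
      obtain ⟨h0, h1, h2⟩ := h x y z
      refine ⟨?_, ?_, ?_⟩ <;> refine mul_left_cancel₀ hs ?_ <;> simp only [lin] at * <;> grind
  · obtain ⟨k, l, hk, hl, e⟩ := H.lines
    refine ⟨s^3*k / M.det, l.map (pl M), by positivity, ?_, ?_⟩
    · intro m hm
      obtain ⟨m', hm', rfl⟩ := List.mem_map.1 hm
      refine ⟨?_, h.inv (hl m' hm').2⟩
      intro h0
      apply (hl m' hm').1
      apply lin_inj
      intro X Y Z
      obtain ⟨x, y, z, rfl, rfl, rfl⟩ := exists_preim M hM X Y Z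
      rw [← lin_pl, h0]; simp [lin]
    · intro x y z
      have := hE x y z
      rw [e] at this
      rw [List.map_map]
      have e2 : (fun m => lin m x y z) ∘ pl M = fun m => lin m (lin (M 0) x y z) (lin (M 1) x y z) (lin (M 2) x y z) := by
        funext m; simp [lin_pl]
      rw [e2]
      field_simp
      linear_combination this
lemma FactL.cont {G : (Fin 3 → ℂ) → Prop} {K : ℂ → ℂ → ℂ → ℂ} (h : FactL G K)
    {f g e : ℂ → ℂ} (hf : Continuous f) (hg : Continuous g) (he : Continuous e) :
    Continuous fun t => K (f t) (g t) (e t) := by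
  obtain ⟨k, l, -, -, hl⟩ := h
  simp only [hl]
  refine continuous_const.mul ?_
  clear hl
  induction l with
  | nil => simpa using continuous_const
  | cons m l ih =>
    simp only [List.map_cons, List.prod_cons]
    refine Continuous.mul ?_ ih
    unfold lin; fun_prop
lemma FactL.mono {G G' : (Fin 3 → ℂ) → Prop} {K : ℂ → ℂ → ℂ → ℂ} (h : FactL G K)
    (hG : ∀ l, G l → G' l) : FactL G' K := by
  obtain ⟨k, l, hk, hl, e⟩ := h
  exact ⟨k, l, hk, fun m hm => hG m (hl m hm), e⟩
lemma FactL.pull {G : (Fin 3 → ℂ) → Prop} {K : ℂ → ℂ → ℂ → ℂ} (h : FactL G K)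
    {x0 y0 z0 : ℂ} (h0 : K x0 y0 z0 =0) :
    ∃ m, G m ∧ lin m x0 y0 z0 =0 ∧ ∃ K', FactL G K' ∧ ∀ x y z, K x y z = lin m x y z*K' x y z := by
  obtain ⟨k, l, hk, hl, e⟩ := h
  rw [e] at h0
  rcases mul_eq_zero.1 h0 with h1 | h1
  · exact absurd h1 hk
  · rw [List.prod_eq_zero_iff] at h1
    obtain ⟨m, hm, hm0⟩ := List.mem_map.1 h1
    obtain ⟨s, t, rfl⟩ := List.append_of_mem hm
    refine ⟨m, hl m hm, hm0, fun x y z => k*((s ++ t).map (fun m => lin m x y z)).prod,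
      ⟨k, s ++ t, hk, ?_, fun _ _ _ => rfl⟩, ?_⟩
    · intro m' hm'
      apply hl
      simp only [List.mem_append, List.mem_cons] at *
      tauto
    · intro x y z
      rw [e]
      simp only [List.map_append, List.map_cons, List.prod_append, List.prod_cons]
      ring
lemma FactL.split {G : (Fin 3 → ℂ) → Prop} {K : ℂ → ℂ → ℂ → ℂ} (h : FactL G K)
    (p : (Fin 3 → ℂ) → Prop) :
    ∃ (k : ℂ) (l1 l2 : List (Fin 3 → ℂ)), k ≠0 ∧ (∀ m ∈ l1, G m ∧ p m) ∧ (∀ m ∈ l2, G m ∧ ¬ p m) ∧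
      ∀ x y z, K x y z = k*((l1.map (fun m => lin m x y z)).prod *
        (l2.map (fun m => lin m x y z)).prod) := by
  classical
  obtain ⟨k, l, hk, hl, e⟩ := h
  suffices H : ∃ l1 l2 : List (Fin 3 → ℂ), (∀ m ∈ l1, G m ∧ p m) ∧ (∀ m ∈ l2, G m ∧ ¬ p m) ∧
      ∀ x y z, (l.map (fun m => lin m x y z)).prod = ((l1.map (fun m => lin m x y z)).prod *
        (l2.map (fun m => lin m x y z)).prod) by
    obtain ⟨l1, l2, h1, h2, h3⟩ := H
    exact ⟨k, l1, l2, hk, h1, h2, fun x y z => by rw [e, h3]⟩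
  clear e
  induction l with
  | nil => exact ⟨[], [], by simp, by simp, by simp⟩
  | cons m l ih =>
    obtain ⟨l1, l2, h1, h2, h3⟩ := ih (fun m' hm' => hl m' (List.mem_cons_of_mem _ hm'))
    by_cases hp : p m
    · refine ⟨m :: l1, l2, ?_, h2, ?_⟩
      · intro m' hm'
        rcases List.mem_cons.1 hm' with rfl | h
        · exact ⟨hl _ (by simp), hp⟩
        · exact h1 _ h
      · intro x y z
        simp only [List.map_cons, List.prod_cons, h3]; ring
    · refine ⟨l1, m :: l2, h1, ?_, ?_⟩
      · intro m' hm'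
        rcases List.mem_cons.1 hm' with rfl | h
        · exact ⟨hl _ (by simp), hp⟩
        · exact h2 _ h
      · intro x y z
        simp only [List.map_cons, List.prod_cons, h3]; ring
lemma cont_ext {f g : ℂ → ℂ} (hf : Continuous f) (hg : Continuous g)
    (h : ∀ t, t ≠0 → f t = g t) (t : ℂ) : f t = g t := by
  have : f = g := Continuous.ext_on (dense_compl_singleton (0 : ℂ)) hf hg (fun t ht => h t ht)
  rw [this]
lemma pow_cancel {f g : ℂ → ℂ} (hf : Continuous f) (hg : Continuous g) (n : ℕ)
    (h : ∀ t, t ^ n*f t = t ^ n*g t) (t : ℂ) : f t = g t :=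
  cont_ext hf hg (fun t ht => mul_left_cancel₀ (pow_ne_zero n ht) (h t)) t
lemma pow_lt_zero {f g : ℂ → ℂ} (hf : Continuous f) (hg : Continuous g) {n m : ℕ} (hnm : n < m)
    (h : ∀ t, t ^ n*f t = t ^ m*g t) : f 0 =0 := by
  obtain ⟨d, rfl⟩ := Nat.exists_eq_add_of_lt hnm
  have := pow_cancel hf (g := fun t => t ^ (d+1)*g t) (by fun_prop) n
    (fun t => by rw [h t]; ring) 0
  simpa using this
lemma poly8 {c0 c1 c2 c3 c4 c5 c6 c7 c8 : ℂ}
    (h : ∀ x : ℂ, c0+c1*x+c2*x^2+c3*x^3+c4*x^4+c5*x^5+c6*x^6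
      + c7*x^7+c8*x^8 =0) :
    c0 =0 ∧ c1 =0 ∧ c2 =0 ∧ c3 =0 ∧ c4 =0 ∧ c5 =0 ∧ c6 =0 ∧ c7 =0 ∧ c8 =0 := by
  have hp : (Polynomial.C c0+Polynomial.C c1*Polynomial.X+Polynomial.C c2*Polynomial.X^2
    + Polynomial.C c3*Polynomial.X^3+Polynomial.C c4*Polynomial.X^4
    + Polynomial.C c5*Polynomial.X^5+Polynomial.C c6*Polynomial.X^6
    + Polynomial.C c7*Polynomial.X^7+Polynomial.C c8*Polynomial.X^8) =0 := by
    refine Polynomial.funext fun x => ?_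
    simpa using h x
  have hc := fun n => congrArg (fun q => Polynomial.coeff q n) hp
  refine ⟨?_, ?_, ?_, ?_, ?_, ?_, ?_, ?_, ?_⟩
  · simpa [Polynomial.coeff_X, Polynomial.coeff_C, Polynomial.coeff_X_pow] using hc 0
  · simpa [Polynomial.coeff_X, Polynomial.coeff_C, Polynomial.coeff_X_pow] using hc 1
  · simpa [Polynomial.coeff_X, Polynomial.coeff_C, Polynomial.coeff_X_pow] using hc 2
  · simpa [Polynomial.coeff_X, Polynomial.coeff_C, Polynomial.coeff_X_pow] using hc 3
  · simpa [Polynomial.coeff_X, Polynomial.coeff_C, Polynomial.coeff_X_pow] using hc 4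
  · simpa [Polynomial.coeff_X, Polynomial.coeff_C, Polynomial.coeff_X_pow] using hc 5
  · simpa [Polynomial.coeff_X, Polynomial.coeff_C, Polynomial.coeff_X_pow] using hc 6
  · simpa [Polynomial.coeff_X, Polynomial.coeff_C, Polynomial.coeff_X_pow] using hc 7
  · simpa [Polynomial.coeff_X, Polynomial.coeff_C, Polynomial.coeff_X_pow] using hc 8
lemma noroot {c0 c1 c2 c3 c4 : ℂ}
    (h : ∀ x : ℂ, c0+c1*x+c2*x^2+c3*x^3+c4*x^4 ≠0) :
    c1 =0 ∧ c2 =0 ∧ c3 =0 ∧ c4 =0 := by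
  let p := (Polynomial.C c0+Polynomial.C c1*Polynomial.X+Polynomial.C c2*Polynomial.X^2
    + Polynomial.C c3*Polynomial.X^3+Polynomial.C c4*Polynomial.X^4)
  have hd : p.degree =0 := by
    by_contra hd
    obtain ⟨x, hx⟩ := IsAlgClosed.exists_root p hd
    exact h x (by simpa [p, Polynomial.IsRoot] using hx)
  have hp := Polynomial.eq_C_of_degree_eq_zero hd
  have hc := fun n => congrArg (fun q => Polynomial.coeff q n) hp
  simp only [p] at hc
  refine ⟨?_, ?_, ?_, ?_⟩
  · simpa [Polynomial.coeff_X, Polynomial.coeff_C, Polynomial.coeff_X_pow] using hc 1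
  · simpa [Polynomial.coeff_X, Polynomial.coeff_C, Polynomial.coeff_X_pow] using hc 2
  · simpa [Polynomial.coeff_X, Polynomial.coeff_C, Polynomial.coeff_X_pow] using hc 3
  · simpa [Polynomial.coeff_X, Polynomial.coeff_C, Polynomial.coeff_X_pow] using hc 4
lemma nonvan (l : List (Fin 3 → ℂ)) (h : ∀ m ∈ l, m 0 ≠0 ∨ m 1 ≠0) :
    ∃ t, (l.map (fun m => lin m 1 t 0)).prod ≠0 := by
  by_contra! hc
  let p : Polynomial ℂ := (l.map (fun m => Polynomial.C (m 0)+Polynomial.C (m 1)*Polynomial.X)).prod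
  have hp : p =0 := by
    refine Polynomial.funext fun t => ?_
    rw [Polynomial.eval_zero, ← hc t]
    simp only [p, Polynomial.eval_list_prod, List.map_map]
    congr 2
    funext m
    simp [lin]
  rw [List.prod_eq_zero_iff] at hp
  obtain ⟨m, hm, h0⟩ := List.mem_map.1 hp
  have h1 := congrArg (fun q => Polynomial.coeff q 0) h0
  have h2 := congrArg (fun q => Polynomial.coeff q 1) h0
  simp [Polynomial.coeff_C] at h1 h2
  rcases h m hm with h | h
  · exact h h1
  · exact h h2
lemma cont_prod (l : List (Fin 3 → ℂ)) {f g e : ℂ → ℂ} (hf : Continuous f) (hg : Continuous g)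
    (he : Continuous e) : Continuous fun t => (l.map (fun m => lin m (f t) (g t) (e t))).prod := by
  have : FactL (fun _ => True) (fun x y z => 1*(l.map (fun m => lin m x y z)).prod) :=
    ⟨1, l, one_ne_zero, by simp, fun _ _ _ => rfl⟩
  simpa using this.cont hf hg he
lemma tool2 {G : (Fin 3 → ℂ) → Prop} {E K : ℂ → ℂ → ℂ → ℂ} (hE : FactL G E)
    (hG : ∀ l, G l → l ≠0) (n : ℕ) (h : ∀ x y z, E x y z = z ^ n*K x y z)
    (hK : ∀ x y, Continuous fun z => K x y z) (hnz : ∃ x y, K x y 0 ≠0) :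
    FactL (fun l => (l 0 ≠0 ∨ l 1 ≠0) ∧ G l) K := by
  obtain ⟨k, l1, l2, hk, h1, h2, e⟩ := hE.split (fun l => l 0 ≠0 ∨ l 1 ≠0)
  have h3 : ∃ k' ≠0, ∀ x y z, (l2.map (fun m => lin m x y z)).prod = k'*z ^ l2.length := by
    clear e
    induction l2 with
    | nil => exact ⟨1, one_ne_zero, by simp⟩
    | cons m l ih =>
      obtain ⟨k', hk', e'⟩ := ih (fun m hm => h2 m (List.mem_cons_of_mem _ hm))
      obtain ⟨g, g'⟩ := h2 m (by simp)
      push Not at g'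
      have hm2 : m 2 ≠0 := by
        intro h0
        apply hG m g
        funext i; fin_cases i
        · exact g'.1
        · exact g'.2
        · exact h0
      refine ⟨m 2*k', mul_ne_zero hm2 hk', fun x y z => ?_⟩
      simp only [List.map_cons, List.prod_cons, List.length_cons]
      rw [e']
      simp only [lin, g'.1, g'.2]
      ring
  obtain ⟨k', hk', e'⟩ := h3
  have hc1 : ∀ x y, Continuous fun z => (l1.map (fun m => lin m x y z)).prod := fun x y =>
    cont_prod l1 continuous_const continuous_const continuous_id
  have key : ∀ x y z, z ^ l2.length*(k*k'*(l1.map (fun m => lin m x y z)).prod) =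
      z ^ n*K x y z := by
    intro x y z; rw [← h, e, e']; ring
  rcases lt_trichotomy l2.length n with hlt | heq | hlt
  · exfalso
    obtain ⟨t, ht⟩ := nonvan l1 (fun m hm => (h1 m hm).2)
    have := pow_lt_zero (continuous_const.mul (hc1 1 t)) (hK 1 t) hlt (key 1 t)
    exact ht ((mul_eq_zero.1 this).resolve_left (mul_ne_zero hk hk'))
  · refine ⟨k*k', l1, mul_ne_zero hk hk', fun m hm => ⟨(h1 m hm).2, (h1 m hm).1⟩, fun x y z => ?_⟩
    rw [heq] at key
    exact (pow_cancel (continuous_const.mul (hc1 x y)) (hK x y) n (key x y) z).symm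
  · exfalso
    obtain ⟨x, y, hxy⟩ := hnz
    exact hxy (pow_lt_zero (hK x y) (continuous_const.mul (hc1 x y)) hlt
      (fun t => (key x y t).symm))
lemma tool1 {G : (Fin 3 → ℂ) → Prop} {E : ℂ → ℂ → ℂ → ℂ} (hE : FactL G E)
    (hG : ∀ l, G l → l ≠0) (hGs : ∀ l (k : ℂ), k ≠0 → G l → G (k • l))
    (r : ℕ) (w : ℂ → ℂ → ℂ → ℂ)
    (hw : ∀ x y, Continuous fun t => w t x y)
    (h : ∀ t x y, E (t*x) (t*y) 1 = t ^ r*w t x y) (hnz : ∃ x y, w 0 x y ≠0) :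
    FactL (fun l => (l 2 =0 ∧ (l 0 ≠0 ∨ l 1 ≠0)) ∧ G l) (fun x y _ => w 0 x y) ∧
    ∃ l2 : List (Fin 3 → ℂ), (∀ m ∈ l2, m 2 =1 ∧ G m) ∧
      ∀ x y z, E x y z = w 0 x y*(l2.map (fun m => lin m x y z)).prod := by
  obtain ⟨k, l1, l2, hk, h1, h2, e⟩ := hE.split (fun l => l 2 =0)
  have hl1 : ∀ m ∈ l1, (m 2 =0 ∧ (m 0 ≠0 ∨ m 1 ≠0)) ∧ G m := by
    intro m hm
    obtain ⟨g, g2⟩ := h1 m hm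
    refine ⟨⟨g2, ?_⟩, g⟩
    by_contra! hc
    apply hG m g
    funext i; fin_cases i
    · exact hc.1
    · exact hc.2
    · exact g2
  have h3 : ∃ k' ≠0, ∃ l3 : List (Fin 3 → ℂ), (∀ m ∈ l3, m 2 =1 ∧ G m) ∧
      ∀ x y z, (l2.map (fun m => lin m x y z)).prod = k'*(l3.map (fun m => lin m x y z)).prod := by
    clear e
    induction l2 with
    | nil => exact ⟨1, one_ne_zero, [], by simp, by simp⟩
    | cons m l ih =>
      obtain ⟨k', hk', l3, hl3, e'⟩ := ih (fun m hm => h2 m (List.mem_cons_of_mem _ hm))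
      obtain ⟨g, g'⟩ := h2 m (by simp)
      refine ⟨m 2*k', mul_ne_zero g' hk', ((m 2)⁻¹ • m) :: l3, ?_, fun x y z => ?_⟩
      · intro m' hm'
        rcases List.mem_cons.1 hm' with rfl | h
        · exact ⟨by simp [g'], hGs _ _ (inv_ne_zero g') g⟩
        · exact hl3 _ h
      · simp only [List.map_cons, List.prod_cons]
        rw [e']
        have : lin m x y z = m 2*lin ((m 2)⁻¹ • m) x y z := by
          simp only [lin, Pi.smul_apply, smul_eq_mul]; field_simp
        rw [this]; ring
  obtain ⟨k', hk', l3, hl3, e'⟩ := h3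
  have h4 : ∀ t x y z, (l1.map (fun m => lin m (t*x) (t*y) z)).prod =
      t ^ l1.length*(l1.map (fun m => lin m x y 0)).prod := by
    clear e h1
    induction l1 with
    | nil => simp
    | cons m l ih =>
      intro t x y z
      simp only [List.map_cons, List.prod_cons, List.length_cons]
      rw [ih (fun m hm => hl1 m (List.mem_cons_of_mem _ hm))]
      simp only [lin, (hl1 m (by simp)).1.1]; ring
  have h4' : ∀ x y z, (l1.map (fun m => lin m x y z)).prod = (l1.map (fun m => lin m x y 0)).prod := by
    intro x y z; simpa using h4 1 x y z
  have h5 : ∀ m ∈ l3, lin m 0 0 1 =1 := fun m hm => by simp [lin, (hl3 m hm).1]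
  have h6 : (l3.map (fun m => lin m 0 0 1)).prod =1 := by
    apply List.prod_eq_one
    intro q hq
    obtain ⟨m, hm, rfl⟩ := List.mem_map.1 hq
    exact h5 m hm
  have hc : ∀ x y, Continuous fun t => (k*k'*(l1.map (fun m => lin m x y 0)).prod) *
      (l3.map (fun m => lin m (t*x) (t*y) 1)).prod := fun x y =>
    continuous_const.mul (cont_prod l3 (by fun_prop) (by fun_prop) continuous_const)
  have key : ∀ x y t, t ^ l1.length*((k*k'*(l1.map (fun m => lin m x y 0)).prod) *
      (l3.map (fun m => lin m (t*x) (t*y) 1)).prod) = t ^ r*w t x y := by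
    intro x y t; rw [← h, e, e', h4]; ring
  have hlen : l1.length = r := by
    rcases lt_trichotomy l1.length r with hlt | heq | hlt
    · exfalso
      obtain ⟨t, ht⟩ := nonvan l1 (fun m hm => (hl1 m hm).1.2)
      have := pow_lt_zero (hc 1 t) (hw 1 t) hlt (key 1 t)
      simp only [zero_mul, h6, mul_one] at this
      exact ht ((mul_eq_zero.1 this).resolve_left (mul_ne_zero hk hk'))
    · exact heq
    · exfalso
      obtain ⟨x, y, hxy⟩ := hnz
      exact hxy (pow_lt_zero (hw x y) (hc x y) hlt (fun t => (key x y t).symm))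
  have hw0 : ∀ x y, w 0 x y = k*k'*(l1.map (fun m => lin m x y 0)).prod := by
    intro x y
    rw [hlen] at key
    have := pow_cancel (hc x y) (hw x y) r (key x y) 0
    simp only [zero_mul, h6, mul_one] at this
    exact this.symm
  refine ⟨⟨k*k', l1, mul_ne_zero hk hk', hl1, ?_⟩, l3, hl3, ?_⟩
  · intro x y z
    change w 0 x y = _
    rw [hw0, h4' x y z]
  · intro x y z
    rw [e, e', hw0, h4' x y z]; ring
lemma InvL.smul {a b c : Fin 10 → ℂ} {l : Fin 3 → ℂ} (h : InvL a b c l) {k : ℂ} (hk : k ≠0) :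
    InvL a b c (k • l) := by
  intro x y z e
  have e' : lin l x y z =0 := by
    have : lin (k • l) x y z = k*lin l x y z := by simp [lin]; ring
    rw [this] at e
    exact (mul_eq_zero.1 e).resolve_left hk
  have := h x y z e'
  simp only [Pi.smul_apply, smul_eq_mul]
  linear_combination k*this
lemma nz_mul {f g : ℂ → ℂ → ℂ}
    (hf : ∀ x0 y0 u v, Differentiable ℂ fun s : ℂ => f (x0+s*u) (y0+s*v))
    (hg : ∀ x0 y0 u v, Differentiable ℂ fun s : ℂ => g (x0+s*u) (y0+s*v))
    (h1 : ∃ x y, f x y ≠0) (h2 : ∃ x y, g x y ≠0) : ∃ x y, f x y*g x y ≠0 := by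
  obtain ⟨x0, y0, h1⟩ := h1
  obtain ⟨x1, y1, h2⟩ := h2
  by_contra! hc
  have a1 : AnalyticOnNhd ℂ (fun s : ℂ => f (x0+s*(x1-x0)) (y0+s*(y1-y0))) Set.univ :=
    (hf _ _ _ _).differentiableOn.analyticOnNhd isOpen_univ
  have a2 : AnalyticOnNhd ℂ (fun s : ℂ => g (x0+s*(x1-x0)) (y0+s*(y1-y0))) Set.univ :=
    (hg _ _ _ _).differentiableOn.analyticOnNhd isOpen_univ
  rcases AnalyticOnNhd.eq_zero_or_eq_zero_of_mul_eq_zero a1 a2 (fun s _ => hc _ _)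
    isPreconnected_univ with h | h
  · exact h1 (by simpa using h 0 trivial)
  · exact h2 (by simpa using h 1 trivial)
lemma FactL.pullr {G : (Fin 3 → ℂ) → Prop} (hGs : ∀ l (k : ℂ), k ≠0 → G l → G (k • l))
    {K : ℂ → ℂ → ℂ → ℂ} (h : FactL (fun l => (l 0 ≠0 ∨ l 1 ≠0) ∧ G l) K) {x0 y0 u v : ℂ}
    (huv : y0*u-x0*v ≠0) (r : ℕ) {f : ℂ → ℂ} (hf : Continuous f)
    (h0 : ∀ s, K (x0+s*u) (y0+s*v) 0 = s ^ (r+1)*f s) :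
    ∃ c, G ![y0, -x0, -c] ∧ ∃ K', FactL (fun l => (l 0 ≠0 ∨ l 1 ≠0) ∧ G l) K' ∧
      (∀ x y z, K x y z = (y0*x-x0*y-c*z)*K' x y z) ∧ ∃ f' : ℂ → ℂ, Continuous f' ∧
      ∀ s, K' (x0+s*u) (y0+s*v) 0 = s ^ r*f' s := by
  have h00 : K x0 y0 0 =0 := by simpa using h0 0
  obtain ⟨m, ⟨hm, hG⟩, hm0, K', hK', e⟩ := h.pull h00
  have hxy : x0 ≠0 ∨ y0 ≠0 := by
    by_contra! hc
    apply huv; rw [hc.1, hc.2]; ring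
  have hm1 : m 0*x0+m 1*y0 =0 := by simpa [lin] using hm0
  have hk : ∃ k ≠0, m 0 = k*y0 ∧ m 1 = - k*x0 := by
    by_cases hx : x0 =0
    · have hy : y0 ≠0 := by tauto
      have hm' : m 1 =0 := by
        rw [hx] at hm1; simpa [hy] using hm1
      refine ⟨m 0 / y0, div_ne_zero (by tauto) hy, by field_simp, by rw [hx, hm']; ring⟩
    · refine ⟨- m 1 / x0, ?_, ?_, by field_simp⟩
      · intro h
        have hm' : m 1 =0 := by field_simp at h; simpa using h
        rw [hm'] at hm1
        have : m 0 =0 := by simpa [hx] using hm1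
        tauto
      · field_simp; linear_combination hm1
  obtain ⟨k, hk, k0, k1⟩ := hk
  refine ⟨- m 2 / k, ?_, fun x y z => k*K' x y z, ?_, ?_, fun s => f s / (y0*u-x0*v),
    by fun_prop, ?_⟩
  · have : ![y0, -x0, -(- m 2 / k)] = k⁻¹ • m := by
      funext i; fin_cases i
      · simp [k0, hk]
      · simp [k1, hk]
      · simp; field_simp
    rw [this]
    exact hGs _ _ (inv_ne_zero hk) hG
  · obtain ⟨k', l, hk', hl, e'⟩ := hK'
    exact ⟨k*k', l, mul_ne_zero hk hk', hl, fun x y z => by simp only [e']; ring⟩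
  · intro x y z
    rw [e, lin, k0, k1]; field_simp; ring
  · refine fun s => cont_ext (f := fun s => k*K' (x0+s*u) (y0+s*v) 0)
      (g := fun s => s ^ r*(f s / (y0*u-x0*v)))
      (continuous_const.mul (hK'.cont (by fun_prop) (by fun_prop) continuous_const)) (by fun_prop) ?_ s
    intro s hs
    have := h0 s
    rw [e, lin, k0, k1] at this
    have h2 : s*((y0*u-x0*v)*(k*K' (x0+s*u) (y0+s*v) 0)) = s*(s ^ r*f s) := by
      linear_combination this
    have h3 := mul_left_cancel₀ hs h2
    rw [← mul_div_assoc, eq_div_iff huv, ← h3]; ring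
def Gd (a b c : Fin 10 → ℂ) (l : Fin 3 → ℂ) : Prop := l ≠0 ∧ InvL a b c l
lemma Gd_smul {a b c : Fin 10 → ℂ} (l : Fin 3 → ℂ) (k : ℂ) (hk : k ≠0) (h : Gd a b c l) :
    Gd a b c (k • l) := ⟨smul_ne_zero hk h.1, h.2.smul hk⟩
def KV (a b : Fin 10 → ℂ) (x y z : ℂ) : ℂ :=
  cub a x y z*(cub a x y z*cubx b x y z+cub b x y z*cuby b x y z) -
  cub b x y z*(cub a x y z*cubx a x y z+cub b x y z*cuby a x y z)
lemma cub_zero (x y z : ℂ) : cub 0 x y z =0 := by simp [cub]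
lemma ExtV_zero (a b : Fin 10 → ℂ) (x y z : ℂ) : ExtV a b 0 x y z = z*KV a b x y z := by
  simp [ExtV, KV, cub_zero, cubx, cuby, cubz]
def Pf (a b : Fin 10 → ℂ) (x y : ℂ) : ℂ := x*cub b x y 0-y*cub a x y 0
def Jf (a b : Fin 10 → ℂ) (x y : ℂ) : ℂ :=
  cubx a x y 0*cuby b x y 0-cuby a x y 0*cubx b x y 0
lemma KV_z0 (a b : Fin 10 → ℂ) (x y : ℂ) : KV a b x y 0 = Pf a b x y*(Jf a b x y / 3) := by
  simp only [KV, Pf, Jf, cub, cubx, cuby]; ring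
lemma Bad.P_ne {a b : Fin 10 → ℂ} (H : Bad a b 0) : ∃ x y, Pf a b x y ≠0 := by
  by_contra! hc
  refine H.ncl ![0,0,1] (by simp) ?_
  intro x y z hz
  have hz : z =0 := by simpa [lin] using hz
  subst hz
  have := hc x y
  rw [Pf] at this
  refine ⟨by simp [cub_zero], by simp [cub_zero], by linear_combination this⟩
lemma Bad.KV_nz {a b : Fin 10 → ℂ} (H : Bad a b 0) (hJ : ∃ x y, Jf a b x y ≠0) :
    ∃ x y, KV a b x y 0 ≠0 := by
  simp only [KV_z0]
  refine nz_mul (f := Pf a b) (g := fun x y => Jf a b x y / 3) ?_ ?_ H.P_ne ?_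
  · intro x0 y0 u v; simp only [Pf, cub]; fun_prop
  · intro x0 y0 u v; simp only [Jf, cubx, cuby]; fun_prop
  · obtain ⟨x, y, h⟩ := hJ
    exact ⟨x, y, div_ne_zero h (by norm_num)⟩
lemma Bad.KV_fact {a b : Fin 10 → ℂ} (H : Bad a b 0) (hK : ∃ x y, KV a b x y 0 ≠0) :
    FactL (fun l => (l 0 ≠0 ∨ l 1 ≠0) ∧ Gd a b 0 l) (KV a b) := by
  refine tool2 (G := Gd a b 0) (E := ExtV a b 0) H.lines (fun l h => h.1) 1 ?_ ?_ hK
  · intro x y z; rw [ExtV_zero]; ring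
  · intro x y; simp only [KV, cub, cubx, cuby]; fun_prop
lemma LinConj3.refl (Ω : Fin 3 → MvPolynomial (Fin 3) ℂ) : LinConj3 Ω Ω := by
  refine ⟨1,1, by simp, one_ne_zero, ?_⟩
  have : ∀ f, subst3 1 f = f := by
    intro f
    rw [subst3]
    have : (fun i : Fin 3 => ∑ j, C ((1 : Matrix (Fin 3) (Fin 3) ℂ) i j)*X j) =
        (X : Fin 3 → MvPolynomial (Fin 3) ℂ) := by
      funext i; simp [Matrix.one_apply]
    rw [this, aeval_X_left]; rfl
  funext i
  simp [pb3, this, Matrix.one_apply]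
lemma Bad.m0 (H : Bad ![1,0,0,0,0,0,0,0,0,0] ![0,0,0,1,0,0,0,0,0,0] 0) : False := by
  refine H.ng 0 ?_
  have h1 : Pc ![1,0,0,0,0,0,0,0,0,0] = X 0^3 := by simp [Pc]
  have h2 : Pc ![0,0,0,1,0,0,0,0,0,0] = X 1^3 := by simp [Pc]
  have h3 : Pc 0 =0 := by simp [Pc]
  rw [h1, h2, h3]
  exact LinConj3.refl _
lemma Bad.m1 (H : Bad ![1,3,0,0,0,0,0,0,0,0] ![0,0,3,1,0,0,0,0,0,0] 0) : False := by
  refine H.ng 1 ?_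
  have e3 : (C 3 : MvPolynomial (Fin 3) ℂ) =3 := rfl
  have h1 : Pc ![1,3,0,0,0,0,0,0,0,0] = X 0^2*(X 0+3*X 1) := by simp [Pc, e3]; ring
  have h2 : Pc ![0,0,3,1,0,0,0,0,0,0] = X 1^2*(3*X 0+X 1) := by simp [Pc, e3]; ring
  have h3 : Pc 0 =0 := by simp [Pc]
  rw [h1, h2, h3]
  exact LinConj3.refl _
lemma Bad.m2 (H : Bad 0 ![0,0,0,1,0,0,0,0,0,0] ![1,0,0,0,0,0,0,0,0,0]) : False := by
  refine H.ng 2 ?_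
  have h1 : Pc ![1,0,0,0,0,0,0,0,0,0] = X 0^3 := by simp [Pc]
  have h2 : Pc ![0,0,0,1,0,0,0,0,0,0] = X 1^3 := by simp [Pc]
  have h3 : Pc 0 =0 := by simp [Pc]
  rw [h1, h2, h3]
  exact LinConj3.refl _
lemma Bad.m3 (H : Bad ![1,0,0,0,0,0,0,0,0,0] ![0,0,0,1,0,0,0,0,0,0] ![0,0,0,0,0,0,0,0,0,1]) :
    False := by
  refine H.ng 3 ?_
  have h1 : Pc ![1,0,0,0,0,0,0,0,0,0] = X 0^3 := by simp [Pc]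
  have h2 : Pc ![0,0,0,1,0,0,0,0,0,0] = X 1^3 := by simp [Pc]
  have h3 : Pc ![0,0,0,0,0,0,0,0,0,1] = X 2^3 := by simp [Pc]
  rw [h1, h2, h3]
  exact LinConj3.refl _
lemma Bad.congr {a b c a' b' c' : Fin 10 → ℂ} (H : Bad a b c) (h1 : a = a') (h2 : b = b')
    (h3 : c = c') : Bad a' b' c' := by subst h1 h2 h3; exact H
def sw (a : Fin 10 → ℂ) : Fin 10 → ℂ := ![a 3, a 2, a 1, a 0, a 6, a 5, a 4, a 8, a 7, a 9]
lemma cub_sw (a : Fin 10 → ℂ) (x y z : ℂ) : cub (sw a) x y z = cub a y x z := by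
  simp [cub, sw]; ring
lemma Bad.swap {a b c : Fin 10 → ℂ} (H : Bad a b c) : Bad (sw b) (sw a) (sw c) := by
  refine (H.trans (M := !![0,1,0;1,0,0;0,0,1]) (s := 1) (q := 0) ?_ one_ne_zero ?_).1
  · simp [Matrix.det_fin_three]
  · intro x y z
    simp [cub_sw, lin, quad]
def shr (t : ℂ) (a : Fin 10 → ℂ) : Fin 10 → ℂ :=
  ![a 0+a 1*t+a 2*t^2+a 3*t^3, a 1+2*a 2*t+3*a 3*t^2,
    a 2+3*a 3*t, a 3, a 4+a 5*t+a 6*t^2, a 5+2*a 6*t, a 6,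
    a 7+a 8*t, a 8, a 9]
lemma cub_shr (t : ℂ) (a : Fin 10 → ℂ) (x y z : ℂ) : cub (shr t a) x y z = cub a x (y+t*x) z := by
  simp [cub, shr]; ring
lemma cub_sub (a b : Fin 10 → ℂ) (k x y z : ℂ) :
    cub (a-k • b) x y z = cub a x y z-k*cub b x y z := by
  simp [cub]; ring
lemma Bad.shear {a b c : Fin 10 → ℂ} (H : Bad a b c) (t : ℂ) :
    Bad (shr t a) (shr t b-t • shr t a) (shr t c) := by
  refine (H.trans (M := !![1,0,0;t,1,0;0,0,1]) (s := 1) (q := 0) ?_ one_ne_zero ?_).1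
  · simp [Matrix.det_fin_three]
  · intro x y z
    have : t*x+y = y+t*x := by ring
    simp [cub_shr, cub_sub, lin, quad, this]
def dg (α β γ : ℂ) (a : Fin 10 → ℂ) : Fin 10 → ℂ :=
  ![a 0 * α^3, a 1 * α^2 * β, a 2 * α * β^2, a 3 * β^3, a 4 * α^2 * γ, a 5 * α * β * γ,
    a 6 * β^2 * γ, a 7 * α * γ^2, a 8 * β * γ^2, a 9 * γ^3]
lemma cub_dg (α β γ : ℂ) (a : Fin 10 → ℂ) (x y z : ℂ) :
    cub (dg α β γ a) x y z = cub a (α*x) (β*y) (γ*z) := by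
  simp [cub, dg]; ring
lemma cub_smul (a : Fin 10 → ℂ) (k x y z : ℂ) : cub (k • a) x y z = k*cub a x y z := by
  simp [cub]; ring
lemma Bad.diag {a b c : Fin 10 → ℂ} (H : Bad a b c) {α β γ s : ℂ} (hα : α ≠0) (hβ : β ≠0)
    (hγ : γ ≠0) (hs : s ≠0) :
    Bad ((s / α) • dg α β γ a) ((s / β) • dg α β γ b) ((s / γ) • dg α β γ c) := by
  refine (H.trans (M := !![α,0,0;0,β,0;0,0,γ]) (s := s) (q := 0) ?_ hs ?_).1
  · simp [Matrix.det_fin_three, hα, hβ, hγ]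
  · intro x y z
    simp [cub_dg, cub_smul, lin, quad]
    field_simp; simp
def tr (α β : ℂ) (a : Fin 10 → ℂ) : Fin 10 → ℂ :=
  ![a 0, a 1, a 2, a 3, a 4+3*a 0 * α+a 1 * β, a 5+2*a 1 * α+2*a 2 * β,
    a 6+a 2 * α+3*a 3 * β,
    a 7+2*a 4 * α+a 5 * β+3*a 0 * α^2+2*a 1 * α * β+a 2 * β^2,
    a 8+a 5 * α+2*a 6 * β+a 1 * α^2+2*a 2 * α * β+3*a 3 * β^2,
    cub a α β 1]
lemma cub_tr (α β : ℂ) (a : Fin 10 → ℂ) (x y z : ℂ) :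
    cub (tr α β a) x y z = cub a (x+α*z) (y+β*z) z := by
  simp [cub, tr]; ring
lemma Bad.transl {a b : Fin 10 → ℂ} (H : Bad a b 0) (α β : ℂ) : Bad (tr α β a) (tr α β b) 0 := by
  refine (H.trans (M := !![1,0,α;0,1,β;0,0,1]) (s := 1) (q := 0) ?_ one_ne_zero ?_).1
  · simp [Matrix.det_fin_three]
  · intro x y z
    simp [cub_tr, lin, quad, cub_zero]
lemma sw_zero : sw 0 =0 := by funext i; fin_cases i <;> simp [sw]
lemma shr_zero (t : ℂ) : shr t 0 =0 := by funext i; fin_cases i <;> simp [shr]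
lemma dg_zero (α β γ : ℂ) : dg α β γ 0 =0 := by funext i; fin_cases i <;> simp [dg]
lemma Bad.swap0 {a b : Fin 10 → ℂ} (H : Bad a b 0) : Bad (sw b) (sw a) 0 := by
  simpa [sw_zero] using H.swap
lemma Bad.shear0 {a b : Fin 10 → ℂ} (H : Bad a b 0) (t : ℂ) :
    Bad (shr t a) (shr t b-t • shr t a) 0 := by
  simpa [shr_zero] using H.shear t
lemma Bad.diag0 {a b : Fin 10 → ℂ} (H : Bad a b 0) {α β γ s : ℂ} (hα : α ≠0) (hβ : β ≠0)
    (hγ : γ ≠0) (hs : s ≠0) :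
    Bad ((s / α) • dg α β γ a) ((s / β) • dg α β γ b) 0 := by
  simpa [dg_zero] using H.diag hα hβ hγ hs
lemma ord3 {a b : Fin 10 → ℂ} (H : Bad a b 0) (h0 : a 0 ≠0) (h1 : a 1 =0) (h2 : a 2 =0)
    (h3 : a 3 =0) (hb : b 3 ≠0) : a 5 =0 ∧ a 6 =0 ∧ a 8 =0 := by
  have hJ : ∃ x y, Jf a b x y ≠0 := by
    by_contra! hc
    have := poly8 (c0 := 3*a 0*b 1) (c1 := 6*a 0*b 2) (c2 := 9*a 0*b 3) (c3 := 0)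
      (c4 := 0) (c5 := 0) (c6 := 0) (c7 := 0) (c8 := 0) (fun t => by
        have := hc 1 t
        simp only [Jf, cubx, cuby, h1, h2, h3] at this
        linear_combination this)
    have h := this.2.2.1
    simp [h0, hb] at h
  have hF := H.KV_fact (H.KV_nz hJ)
  obtain ⟨c1, -, K1, hK1, e1, f1, hf1, e1'⟩ := hF.pullr Gd_smul (x0 := 0) (y0 := 1) (u := 1) (v := 0)
    (by norm_num) 2 (f := fun x => (cub b x 1 0-a 0*x^2)*(a 0*cuby b x 1 0))
    (by simp only [cub, cuby]; fun_prop) (by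
      intro s
      simp only [KV, cub, cubx, cuby, h1, h2, h3]; ring)
  obtain ⟨c2, -, K2, hK2, e2, f2, hf2, e2'⟩ := hK1.pullr Gd_smul (by norm_num) 1 hf1 e1'
  obtain ⟨c3, -, K3, hK3, e3, f3, hf3, e3'⟩ := hK2.pullr Gd_smul (by norm_num) 0 hf2 e2'
  have key : ∀ ξ t, KV a b (t * ξ) 1 t = t^3*((ξ-c1)*(ξ-c2)*(ξ-c3)*K3 (t * ξ) 1 t) := by
    intro ξ t
    rw [e1, e2, e3]; ring
  have hcont : ∀ ξ : ℂ, Continuous fun t => ((ξ-c1)*(ξ-c2)*(ξ-c3)*K3 (t * ξ) 1 t) :=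
    fun ξ => continuous_const.mul (hK3.cont (by fun_prop) continuous_const continuous_id)
  have h6 : a 6 =0 := by
    have := pow_lt_zero (n := 1) (m := 3) (f := fun t =>
      (a 6+t*a 8+t^2*a 9) *
        (t*(a 6+t*a 8+t^2*a 9)*cubx b 0 1 t+cub b 0 1 t*cuby b 0 1 t)
        - cub b 0 1 t*((a 6+t*a 8+t^2*a 9)*cubx a 0 1 t
          + cub b 0 1 t*(2*a 6+t*a 8))) (by simp only [cub, cubx, cuby]; fun_prop) (hcont 0)
      (by norm_num) (fun t => by
        rw [← key]
        simp only [KV, cub, cubx, cuby, h1, h2, h3]; ring)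
    simp [cub, cubx, cuby, h2] at this
    have h : a 6*(b 3*b 3) =0 := by linear_combination this
    simpa [hb] using h
  have h58 : ∀ ξ, a 5 * ξ+a 8 =0 := by
    intro ξ
    have := pow_lt_zero (n := 2) (m := 3) (f := fun t =>
      (a 5 * ξ+a 8+t*(a 0 * ξ^3+a 4 * ξ^2+a 7 * ξ+a 9)) *
        (t^2*(a 5 * ξ+a 8+t*(a 0 * ξ^3+a 4 * ξ^2+a 7 * ξ+a 9))*cubx b (t * ξ) 1 t
          + cub b (t * ξ) 1 t*cuby b (t * ξ) 1 t)
        - cub b (t * ξ) 1 t*((a 5 * ξ+a 8+t*(a 0 * ξ^3+a 4 * ξ^2+a 7 * ξ+a 9))*cubx a (t * ξ) 1 t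
          + cub b (t * ξ) 1 t*(a 5 * ξ+a 8))) (by simp only [cub, cubx, cuby]; fun_prop) (hcont ξ)
      (by norm_num) (fun t => by
        rw [← key]
        simp only [KV, cub, cubx, cuby, h1, h2, h3, h6]; ring)
    simp [cub, cubx, cuby, h2] at this
    have h : (a 5 * ξ+a 8)*(b 3*b 3) =0 := by linear_combination this / 2
    simpa [hb] using h
  have h8 : a 8 =0 := by simpa using h58 0
  have h5 : a 5 =0 := by simpa [h8] using h58 1
  exact ⟨h5, h6, h8⟩
lemma vec10 {a : Fin 10 → ℂ} {c0 c1 c2 c3 c4 c5 c6 c7 c8 c9 : ℂ} (h0 : a 0 = c0) (h1 : a 1 = c1)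
    (h2 : a 2 = c2) (h3 : a 3 = c3) (h4 : a 4 = c4) (h5 : a 5 = c5) (h6 : a 6 = c6) (h7 : a 7 = c7)
    (h8 : a 8 = c8) (h9 : a 9 = c9) : a = ![c0, c1, c2, c3, c4, c5, c6, c7, c8, c9] := by
  funext i; fin_cases i <;> assumption
lemma H1end (e : ℂ) (H : Bad ![1,0,0,0,0,0,0,e,0,0] ![0,0,0,1,0,0,0,0,e,0] 0) : False := by
  by_cases he : e =0
  · subst he; exact H.m0
  · obtain ⟨γ, hγ⟩ := IsSquare.exists_sq (-e) (IsAlgClosed.exists_pow_nat_eq (-e) (n := 2) (by norm_num) |>.elim fun r hr => ⟨r, by rw [← hr]; ring⟩)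
    have hγ0 : γ ≠0 := by rintro rfl; apply he; linear_combination -hγ
    refine Bad.m3 (H.trans (M := !![γ,0,0;0,γ,0;0,0,1]) (s := (γ^2)⁻¹) (q := ![0,0,0,0,0,1]) ?_ ?_ ?_).1
    · simp [Matrix.det_fin_three, hγ0]
    · simp [hγ0]
    · intro x y z
      have h2 : e = - γ^2 := by linear_combination -hγ
      subst h2
      simp [cub, lin, quad]
      refine ⟨?_, ?_, by ring⟩ <;> field_simp <;> ring
lemma H1case {a b : Fin 10 → ℂ} (H : Bad a b 0) (h0 : a 0 =1) (h1 : a 1 =0) (h2 : a 2 =0)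
    (h3 : a 3 =0) (g0 : b 0 =0) (g1 : b 1 =0) (g2 : b 2 =0) (g3 : b 3 =1) : False := by
  obtain ⟨h5, h6, h8⟩ := ord3 H (by simp [h0]) h1 h2 h3 (by simp [g3])
  obtain ⟨g5, g4, g7⟩ := ord3 H.swap0 (by simp [sw, g3]) (by simp [sw, g2]) (by simp [sw, g1])
    (by simp [sw, g0]) (by simp [sw, h0])
  simp only [sw, Matrix.cons_val] at g5 g4 g7
  have hk : ∀ x y, KV a b x y 0 =3*x^3*y^3*(y^2-x^2) := by
    intro x y; simp only [KV, cub, cubx, cuby, h0, h1, h2, h3, g0, g1, g2, g3]; ring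
  have hF := H.KV_fact ⟨1,2, by rw [hk]; norm_num⟩
  obtain ⟨c, hc, -⟩ := hF.pullr Gd_smul (x0 := 1) (y0 := 1) (u := 1) (v := 0) (by norm_num) 0
    (f := fun s => 3*(1+s)^3*(-(s+2))) (by fun_prop) (by intro s; rw [hk]; ring)
  obtain ⟨d, hd, -⟩ := hF.pullr Gd_smul (x0 := -1) (y0 := 1) (u := 1) (v := 0) (by norm_num) 0
    (f := fun s => 3*(-1+s)^3*(2-s)) (by fun_prop) (by intro s; rw [hk]; ring)
  have H' := H.transl ((c+d) / 2) ((d-c) / 2)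
  have hc' : ∀ x, cub (tr ((c+d) / 2) ((d-c) / 2) a) x x 1 = cub (tr ((c+d) / 2) ((d-c) / 2) b) x x 1 := by
    intro x
    have := hc.2 (x+(c+d) / 2 *1) (x+(d-c) / 2 *1) 1 (by simp [lin]; ring)
    rw [cub_tr, cub_tr]
    simp [cub_zero] at this ⊢
    linear_combination this
  have hd' : ∀ x, cub (tr ((c+d) / 2) ((d-c) / 2) a) x (-x) 1 = - cub (tr ((c+d) / 2) ((d-c) / 2) b) x (-x) 1 := by
    intro x
    have := hd.2 (x+(c+d) / 2 *1) (-x+(d-c) / 2 *1) 1 (by simp [lin]; ring)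
    rw [cub_tr, cub_tr]
    simp [cub_zero] at this ⊢
    linear_combination this
  have ha : ∃ p q r, tr ((c+d) / 2) ((d-c) / 2) a = ![1,0,0,0,p,0,0,q,0,r] :=
    ⟨_, _, _, vec10 (by simp [tr, h0]) (by simp [tr, h1]) (by simp [tr, h2]) (by simp [tr, h3]) rfl
      (by simp [tr, h1, h2, h5]) (by simp [tr, h2, h3, h6]) rfl (by simp [tr, h1, h2, h3, h5, h6, h8]) rfl⟩
  have hb : ∃ p q r, tr ((c+d) / 2) ((d-c) / 2) b = ![0,0,0,1,0,0,p,0,q,r] :=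
    ⟨_, _, _, vec10 (by simp [tr, g0]) (by simp [tr, g1]) (by simp [tr, g2]) (by simp [tr, g3])
      (by simp [tr, g0, g1, g4]) (by simp [tr, g1, g2, g5]) rfl (by simp [tr, g0, g1, g2, g4, g5, g7]) rfl rfl⟩
  obtain ⟨p, q, r, ha⟩ := ha
  obtain ⟨p', q', r', hb⟩ := hb
  rw [ha, hb] at H' hc' hd'
  obtain ⟨i0, i1, i2, -⟩ := poly8 (c0 := r-r') (c1 := q-q') (c2 := p-p') (c3 := 0) (c4 := 0)
    (c5 := 0) (c6 := 0) (c7 := 0) (c8 := 0) (fun x => by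
      have := hc' x; simp [cub] at this; linear_combination this)
  obtain ⟨j0, j1, j2, -⟩ := poly8 (c0 := r+r') (c1 := q-q') (c2 := p+p') (c3 := 0) (c4 := 0)
    (c5 := 0) (c6 := 0) (c7 := 0) (c8 := 0) (fun x => by
      have := hd' x; simp [cub] at this; linear_combination this)
  have hr : r =0 := by linear_combination (i0+j0) / 2
  have hr' : r' =0 := by linear_combination (j0-i0) / 2
  have hp : p =0 := by linear_combination (i2+j2) / 2
  have hp' : p' =0 := by linear_combination (j2-i2) / 2
  have hq : q' = q := by linear_combination-i1
  subst hr hr' hp hp' hq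
  exact H1end _ H'
lemma ord2 {a b : Fin 10 → ℂ} (H : Bad a b 0) (hK : ∃ x y, KV a b x y 0 ≠0) (h2 : a 2 =0)
    (h3 : a 3 =0) : ∃ c d K, Gd a b 0 ![1,0, -c] ∧ Gd a b 0 ![1,0, -d] ∧
      FactL (fun l => (l 0 ≠0 ∨ l 1 ≠0) ∧ Gd a b 0 l) K ∧
      ∀ x y z, KV a b x y z = (x-c*z)*(x-d*z)*K x y z := by
  have hF := H.KV_fact hK
  obtain ⟨c1, g1, K1, hK1, e1, f1, hf1, e1'⟩ := hF.pullr Gd_smul (x0 := 0) (y0 := 1) (u := 1) (v := 0)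
    (by norm_num) 1 (f := fun x => (a 0*x+a 1)*(x^2*(a 0*x+a 1)*cubx b x 1 0
      + cub b x 1 0*cuby b x 1 0)-cub b x 1 0*((a 0*x+a 1)*(3*a 0*x^2+2*a 1*x)
        + cub b x 1 0*a 1))
    (by simp only [cub, cubx, cuby]; fun_prop) (by
      intro s
      simp only [KV, cub, cubx, cuby, h2, h3]; ring)
  obtain ⟨c2, g2, K2, hK2, e2, f2, hf2, e2'⟩ := hK1.pullr Gd_smul (by norm_num) 0 hf1 e1'
  refine ⟨c1, c2, K2, by simpa using g1, by simpa using g2, hK2, fun x y z => ?_⟩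
  rw [e1, e2]; ring
lemma ord2a {a b : Fin 10 → ℂ} (H : Bad a b 0) (hK : ∃ x y, KV a b x y 0 ≠0) (h2 : a 2 =0)
    (h3 : a 3 =0) (hb : b 3 ≠0) : a 6 =0 := by
  obtain ⟨c, d, K, -, -, hF, e⟩ := ord2 H hK h2 h3
  have := pow_lt_zero (n := 1) (m := 2) (f := fun t =>
      (a 6+t*a 8+t^2*a 9) *
        (t*(a 6+t*a 8+t^2*a 9)*cubx b 0 1 t+cub b 0 1 t*cuby b 0 1 t)
        - cub b 0 1 t*((a 6+t*a 8+t^2*a 9)*cubx a 0 1 t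
          + cub b 0 1 t*(2*a 6+t*a 8))) (g := fun t => c*d*K 0 1 t)
      (by simp only [cub, cubx, cuby]; fun_prop)
      (continuous_const.mul (hF.cont continuous_const continuous_const continuous_id))
      (by norm_num) (fun t => by
        have := e 0 1 t
        simp only [KV, cub, cubx, cuby, h2, h3] at this ⊢; linear_combination this)
  simp [cub, cubx, cuby, h2] at this
  have h : a 6*(b 3*b 3) =0 := by linear_combination this
  simpa [hb] using h
lemma H3end (g : ℂ) (H : Bad ![1,3,0,0,0,0,0,-g,-3*g,0] ![0,0,3,1,0,0,0,-3*g,-g,0] 0) : False := by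
  by_cases hg : g =0
  · subst hg; exact Bad.m1 (by simpa using H)
  · obtain ⟨γ, rfl⟩ := IsAlgClosed.exists_pow_nat_eq g (n := 2) (by norm_num)
    have hγ0 : γ ≠0 := by rintro rfl; simp at hg
    refine Bad.m3 (H.trans (M := !![1,1,-2;1,1,2;-1/γ,1/γ,0]) (s := -1/8) (q := ![1,1,1,0,0,0]) ?_ ?_ ?_).1
    · simp [Matrix.det_fin_three]; field_simp; norm_num
    · norm_num
    · intro x y z
      simp [cub, lin, quad]
      refine ⟨?_, ?_, ?_⟩ <;> field_simp <;> ring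
lemma H3half {a b : Fin 10 → ℂ} (H : Bad a b 0) (hK : ∃ x y, KV a b x y 0 ≠0)
    (h0 : a 0 =1) (h1 : a 1 =3) (h2 : a 2 =0)
    (h3 : a 3 =0) (g0 : b 0 =0) (g1 : b 1 =0) (g2 : b 2 =3) (g3 : b 3 =1)
    (h4 : a 4 =0) (h5 : a 5 =0) (h6 : a 6 =0) (g4 : b 4 =0) (g5 : b 5 =0) (g6 : b 6 =0) :
    ∃ g, a 7 = -g ∧ a 8 = -3*g ∧ a 9 =0 := by
  obtain ⟨c, d, K, hc, hd, hF, e⟩ := ord2 H hK h2 h3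
  have inv : ∀ c, Gd a b 0 ![1,0,-c] → a 8 = -3*c^2 ∧ c^3+a 7*c+a 9 =0 := by
    intro c hc
    have : ∀ y, c^3+3*c^2*y+a 7*c+a 8*y+a 9 =0 := by
      intro y
      have := hc.2 c y 1 (by simp [lin])
      simp [lin, cub, h0, h1, h2, h3, h4, h5, h6] at this
      linear_combination this
    have i0 := this 0
    have i1 := this 1
    exact ⟨by linear_combination i1-i0, by linear_combination i0⟩
  obtain ⟨c8, c9⟩ := inv c hc
  obtain ⟨d8, d9⟩ := inv d hd
  by_cases hcd : c = d
  · subst hcd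
    have key : ∀ y, cub b c y 1*((3*c^2+6*c*y+a 7)*cuby b c y 1-(3*c^2+6*c*y+a 7)^2-cub b c y 1*(6*c)) =0 := by
      intro y
      have := pow_lt_zero (n := 1) (m := 2) (f := fun w =>
        let U := (w^2+3*c*w+3*w*y+3*c^2+6*c*y+a 7)
        w*U^2*cubx b (c+w) y 1+U*cub b (c+w) y 1*cuby b (c+w) y 1
          - cub b (c+w) y 1*U*(U+w*(2*w+3*c+3*y))-cub b (c+w) y 1^2*(3*w+6*c))
        (g := fun w => K (c+w) y 1) (by simp only [cub, cubx, cuby]; fun_prop)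
        (hF.cont (by fun_prop) continuous_const continuous_const)
        (by norm_num) (fun w => by
          have := e (c+w) y 1
          have h9 : a 9 = -(c^3+a 7*c) := by linear_combination c9
          have h : (w)^2*K (c+w) y 1 = KV a b (c+w) y 1 := by rw [this]; ring
          rw [h]
          simp only [KV]
          have e1 : cub a (c+w) y 1 = w*(w^2+3*c*w+3*w*y+3*c^2+6*c*y+a 7) := by
            simp only [cub, h0, h1, h2, h3, h4, h5, h6, c8, h9]; ring
          have e2 : cubx a (c+w) y 1 = (w^2+3*c*w+3*w*y+3*c^2+6*c*y+a 7)+w*(2*w+3*c+3*y) := by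
            simp only [cubx, h0, h1, h2, h3, h4, h5, h6, c8, h9]; ring
          have e3 : cuby a (c+w) y 1 = w*(3*w+6*c) := by
            simp only [cuby, h0, h1, h2, h3, h4, h5, h6, c8, h9]; ring
          rw [e1, e2, e3]; ring)
      simp only [add_zero] at this
      linear_combination this
    simp only [cub, cuby, g0, g1, g2, g3, g4, g5, g6] at key
    have hc0 : c =0 := by
      linear_combination ((1*key 0 -6*key 1+15*key 2 -20*key 3+15*key 4 -6*key 5+1*key 6) / 720) / 12
    subst hc0
    have h7 : a 7 =0 := by
      linear_combination ((-1*key 0+5*key 1 -10*key 2+10*key 3 -5*key 4+1*key 5) / 120) / 3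
    refine ⟨0, by simp [h7], by simpa using c8, by simpa using c9⟩
  · have hdc : d = -c := by
      have : (c-d)*(c+d) =0 := by linear_combination (c8-d8)/(3)
      rcases mul_eq_zero.1 this with h | h
      · exact absurd (by linear_combination h) hcd
      · linear_combination h
    have hc0 : c ≠0 := by rintro rfl; apply hcd; rw [hdc]; ring
    subst hdc
    have h9 : a 9 =0 := by linear_combination (c9+d9)/2
    refine ⟨c^2, ?_, by linear_combination c8, h9⟩
    have : c*(a 7+c^2) =0 := by linear_combination c9-h9
    have := (mul_eq_zero.1 this).resolve_left hc0
    linear_combination this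
lemma nzK {a b : Fin 10 → ℂ} (h0 : a 0 =1) (h1 : a 1 =3) (h2 : a 2 =0)
    (h3 : a 3 =0) (g0 : b 0 =0) (g1 : b 1 =0) (g2 : b 2 =3) (g3 : b 3 =1) :
    ∃ x y, KV a b x y 0 ≠0 := by
  refine ⟨1,2, ?_⟩
  simp only [KV, cub, cubx, cuby, h0, h1, h2, h3, g0, g1, g2, g3]; norm_num
lemma H3sum {a b : Fin 10 → ℂ} (H : Bad a b 0) (h0 : a 0 =1) (h1 : a 1 =3) (h2 : a 2 =0)
    (h3 : a 3 =0) (g0 : b 0 =0) (g1 : b 1 =0) (g2 : b 2 =3) (g3 : b 3 =1) :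
    b 5-2*b 6+a 5-2*a 6 =0 ∧
        b 4-b 5+b 6+a 4-a 5+a 6 =0 ∧ b 7-b 8+a 7-a 8 =0 := by
  obtain ⟨i5, i6, i8⟩ := ord3 (H.shear0 (-1)).swap0 (by simp [sw, shr, h3, g3])
      (by simp [sw, shr, h3, g3, h2, g2]) (by simp [sw, shr, h3, g3, h2, g2, h1, g1]; norm_num)
      (by simp [sw, shr, h3, g3, h2, g2, h1, g1, h0, g0]; norm_num)
      (by simp [sw, shr, h3, h2, h1, h0]; norm_num)
  simp [sw, shr] at i5 i6 i8
  exact ⟨by linear_combination i5, by linear_combination i6, by linear_combination i8⟩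
lemma H3pre {a' b' : Fin 10 → ℂ} (H' : Bad a' b' 0) (k0 : a' 0 =1) (k1 : a' 1 =3) (k2 : a' 2 =0) (k3 : a' 3 =0) (k4 : a' 4 =0) (k5 : a' 5 =0) (k6 : a' 6 =0)
    (l0 : b' 0 =0) (l1 : b' 1 =0) (l2 : b' 2 =3) (l3 : b' 3 =1) (l4 : b' 4 =0) (l5 : b' 5 =0) (l6 : b' 6 =0) : False := by
  obtain ⟨g, m7, m8, m9⟩ := H3half H' (nzK k0 k1 k2 k3 l0 l1 l2 l3) k0 k1 k2 k3 l0 l1 l2 l3 k4 k5 k6 l4 l5 l6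
  obtain ⟨g', n8, n7, n9⟩ := H3half H'.swap0 (nzK
    (by simp [sw, l3]) (by simp [sw, l2]) (by simp [sw, l1]) (by simp [sw, l0]) (by simp [sw, k3]) (by simp [sw, k2]) (by simp [sw, k1]) (by simp [sw, k0]))
    (by simp [sw, l3]) (by simp [sw, l2]) (by simp [sw, l1]) (by simp [sw, l0]) (by simp [sw, k3]) (by simp [sw, k2]) (by simp [sw, k1]) (by simp [sw, k0])
    (by simp [sw, l6]) (by simp [sw, l5]) (by simp [sw, l4]) (by simp [sw, k6]) (by simp [sw, k5]) (by simp [sw, k4])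
  simp only [sw, Matrix.cons_val] at n7 n8 n9
  obtain ⟨-, -, s8⟩ := H3sum H' k0 k1 k2 k3 l0 l1 l2 l3
  have hg : g' = g := by linear_combination (-s8+n7-n8+m7-m8) / 2
  subst hg
  rw [vec10 k0 k1 k2 k3 k4 k5 k6 m7 m8 m9, vec10 l0 l1 l2 l3 l4 l5 l6 n7 n8 n9] at H'
  exact H3end _ H'
lemma H3case {a b : Fin 10 → ℂ} (H : Bad a b 0) (h0 : a 0 =1) (h1 : a 1 =3) (h2 : a 2 =0)
    (h3 : a 3 =0) (g0 : b 0 =0) (g1 : b 1 =0) (g2 : b 2 =3) (g3 : b 3 =1) : False := by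
  have h6 : a 6 =0 := ord2a H (nzK h0 h1 h2 h3 g0 g1 g2 g3) h2 h3 (by simp [g3])
  have g4 : b 4 =0 := by
    simpa [sw] using ord2a H.swap0 (nzK (by simp [sw, g3]) (by simp [sw, g2]) (by simp [sw, g1])
      (by simp [sw, g0]) (by simp [sw, h3]) (by simp [sw, h2]) (by simp [sw, h1]) (by simp [sw, h0]))
      (by simp [sw, g1]) (by simp [sw, g0]) (by simp [sw, h0])
  obtain ⟨s5, s4, -⟩ := H3sum H h0 h1 h2 h3 g0 g1 g2 g3
  have H' := H.transl (-a 5 / 6) (-b 5 / 6)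
  set a' := tr (-a 5 / 6) (-b 5 / 6) a with ha
  set b' := tr (-a 5 / 6) (-b 5 / 6) b with hb
  have k0 : a' 0 =1 := by simp [ha, tr, h0]
  have k1 : a' 1 =3 := by simp [ha, tr, h1]
  have k2 : a' 2 =0 := by simp [ha, tr, h2]
  have k3 : a' 3 =0 := by simp [ha, tr, h3]
  have k4 : a' 4 =0 := by simp [ha, tr, h0, h1]; linear_combination s4+s5 / 2-g4
  have k5 : a' 5 =0 := by simp [ha, tr, h1, h2]; ring
  have k6 : a' 6 =0 := by simp [ha, tr, h6, h2, h3]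
  have l0 : b' 0 =0 := by simp [hb, tr, g0]
  have l1 : b' 1 =0 := by simp [hb, tr, g1]
  have l2 : b' 2 =3 := by simp [hb, tr, g2]
  have l3 : b' 3 =1 := by simp [hb, tr, g3]
  have l4 : b' 4 =0 := by simp [hb, tr, g0, g1, g4]
  have l5 : b' 5 =0 := by simp [hb, tr, g1, g2]; ring
  have l6 : b' 6 =0 := by simp [hb, tr, g2, g3]; linear_combination -s5 / 2-h6
  exact H3pre H' k0 k1 k2 k3 k4 k5 k6 l0 l1 l2 l3 l4 l5 l6
lemma Bad.JP {a b : Fin 10 → ℂ} (H : Bad a b 0) (hK : ∃ x y, KV a b x y 0 ≠0) {x y : ℂ}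
    (hJ : Jf a b x y =0) : Pf a b x y =0 := by
  obtain ⟨m, ⟨hm, hG⟩, hm0, -⟩ := (H.KV_fact hK).pull (x0 := x) (y0 := y) (z0 := 0)
    (by rw [KV_z0, hJ]; ring)
  have h1 := hG.2 x y 0 hm0
  simp only [cub_zero, mul_zero, add_zero, lin] at h1 hm0
  rw [Pf]
  rcases hm with hm | hm
  · apply mul_left_cancel₀ hm
    linear_combination -y*h1+cub b x y 0*hm0
  · apply mul_left_cancel₀ hm
    linear_combination x*h1-cub a x y 0*hm0
lemma S2n {a b : Fin 10 → ℂ} (H : Bad a b 0) (h0 : a 0 =1) (h2 : a 2 =0)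
    (h3 : a 3 =0) (g0 : b 0 =0) (g1 : b 1 =0) (g3 : b 3 =1) (hne : a 1*b 2 ≠1) : False := by
  have hPJ : ∀ {a b : Fin 10 → ℂ}, Bad a b 0 → a 0 =1 → a 2 =0 → a 3 =0 → b 0 =0 → b 1 =0 →
      b 3 =1 → ¬ (a 1 =0 ∧ b 2 =0) → ∀ t, t ≠0 →
      6*b 2+(9+3*(a 1*b 2))*t+6*a 1*t^2 =0 →
      t^2+(b 2-a 1)*t-1 =0 := by
    intro a b H h0 h2 h3 g0 g1 g3 hn t ht h
    have hK : ∃ x y, KV a b x y 0 ≠0 := by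
      apply H.KV_nz
      by_contra! hc
      have c1 := hc 1 1
      have c2 := hc 1 (-1)
      have c3 := hc 1 2
      simp only [Jf, cubx, cuby, h0, h2, h3, g0, g1, g3] at c1 c2 c3
      exact hn ⟨by linear_combination (-3*c1-c2+c3) / 36, by linear_combination (c1-c2) / 12-(-3*c1-c2+c3) / 36⟩
    have := H.JP hK (x := 1) (y := t) (by
      simp only [Jf, cubx, cuby, h0, h2, h3, g0, g1, g3]; linear_combination t*h)
    simp only [Pf, cub, h0, h2, h3, g0, g1, g3] at this
    apply mul_left_cancel₀ ht
    linear_combination this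
  have one : ∀ {a b : Fin 10 → ℂ}, Bad a b 0 → a 0 =1 → a 2 =0 → a 3 =0 → b 0 =0 → b 1 =0 →
      b 3 =1 → b 2 =0 → a 1 ≠0 → False := by
    intro a b H h0 h2 h3 g0 g1 g3 g2 h1
    have h := hPJ H h0 h2 h3 g0 g1 g3 (by tauto) (-3 / (2*a 1)) (by simp [h1]) (by
      rw [g2]; field_simp; ring)
    rw [g2] at h
    field_simp at h
    have h : a 1^2 = -9 / 2 := by linear_combination h / 2
    have h' : 1 / a 1^2 = - 2 / 9 := by rw [h]; norm_num
    refine H3case ((H.diag0 (α := 1) (β := -3 / (2*a 1)) (γ := 1) (s := -2) one_ne_zero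
      (by simp [h1]) one_ne_zero (by norm_num)).shear0 1) ?_ ?_ ?_ ?_ ?_ ?_ ?_ ?_ <;>
    simp [shr, dg, h0, h2, h3, g0, g1, g2, g3] <;> field_simp <;> (try rw [h]) <;> norm_num
  by_cases h1 : a 1 =0
  · by_cases g2 : b 2 =0
    · exact H1case H h0 h1 h2 h3 g0 g1 g2 g3
    · exact one H.swap0 (by simp [sw, g3]) (by simp [sw, g1]) (by simp [sw, g0]) (by simp [sw, h3])
        (by simp [sw, h2]) (by simp [sw, h0]) (by simp [sw, h1]) (by simpa [sw] using g2)
  by_cases g2 : b 2 =0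
  · exact one H h0 h2 h3 g0 g1 g3 g2 h1
  have hP := hPJ H h0 h2 h3 g0 g1 g3 (by tauto)
  clear hPJ one
  obtain ⟨δ, hδ⟩ := IsAlgClosed.exists_pow_nat_eq ((9+3*(a 1*b 2))^2-144*(a 1*b 2)) (n := 2) (by norm_num)
  set β := a 1 with hβ
  set κ := b 2 with hκ
  have ht : ∀ t,6 * κ+(9+3*(β * κ))*t+6 * β*t^2 =0 → t^2+(κ-β)*t-1 =0 := by
    intro t h
    refine hP t ?_ h
    rintro rfl
    apply g2; linear_combination h / 6
  have r1 := ht ((-(9+3*(β * κ))+δ) / (12 * β)) (by field_simp; linear_combination 6*hδ)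
  have r2 := ht ((-(9+3*(β * κ))-δ) / (12 * β)) (by field_simp; linear_combination 6*hδ)
  by_cases hd : δ =0
  · subst hd
    have : (β * κ-1)*(β * κ-9) =0 := by linear_combination-hδ / 9
    have h9 : β * κ =9 := by
      rcases mul_eq_zero.1 this with h | h
      · exact absurd (by linear_combination h) hne
      · linear_combination h
    rw [h9] at r1
    field_simp at r1
    have hβ2 : (β-3)*(β+3) =0 := by linear_combination r1 / 288+h9*(3/2)
    rcases mul_eq_zero.1 hβ2 with h | h
    · have h1' : β =3 := by linear_combination h
      have g2' : κ =3 := by rw [h1'] at h9; linear_combination h9 / 3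
      exact H3case H h0 h1' h2 h3 g0 g1 g2' g3
    · have h1' : a 1 = -3 := by linear_combination h
      have g2' : b 2 = -3 := by
        have h9' : a 1*b 2 =9 := h9
        rw [h1'] at h9'; linear_combination -h9' / 3
      refine H3case (H.diag0 (α := 1) (β := -1) (γ := 1) (s := 1) one_ne_zero
        (by norm_num) one_ne_zero one_ne_zero) ?_ ?_ ?_ ?_ ?_ ?_ ?_ ?_ <;>
      simp [dg, h0, h1', h2, h3, g0, g1, g2', g3] <;> norm_num
  · have e1 : -(9+3*(β * κ)) / (6 * β)+(κ-β) =0 := by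
      have : (-(9+3*(β * κ)) / (6 * β)+(κ-β))*(δ / (6 * β)) =0 := by
        linear_combination r1-r2
      rcases mul_eq_zero.1 this with h | h
      · exact h
      · simp [hd, h1] at h
    field_simp at e1 r1
    have h5 : δ^2 = (9+3*(β * κ))^2-144*(β * κ) := hδ
    have e2 : κ * β-2 * β^2-3 =0 := by linear_combination e1 / 3
    have e3 : β*(κ+β) =0 := by
      linear_combination -(r1-6*(-(9+3*(β * κ))+δ)*e2-h5) / 144
    have e4 : κ = -β := by
      have := (mul_eq_zero.1 e3).resolve_left h1
      linear_combination this
    apply hne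
    rw [e4] at e2 ⊢
    linear_combination e2/3
lemma cubroot (a : Fin 10 → ℂ) : ∃ x y, ¬ (x =0 ∧ y =0) ∧ cub a x y 0 =0 := by
  by_contra! hc
  have h := noroot (c0 := a 0) (c1 := a 1) (c2 := a 2) (c3 := a 3) (c4 := 0) (fun t h =>
    hc 1 t (by simp) (by simp only [cub]; linear_combination h))
  exact hc 0 1 (by simp) (by simp [cub, h.2.2.1])
lemma S2c {a b : Fin 10 → ℂ} (H : Bad a b 0) (h0 : a 0 ≠0) (h2 : a 2 =0)
    (h3 : a 3 =0) (g0 : b 0 =0) (g1 : b 1 =0) (g3 : b 3 ≠0) (hne : a 1*b 2 ≠ a 0*b 3) :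
    False := by
  obtain ⟨α, hα⟩ := IsAlgClosed.exists_pow_nat_eq (1 / a 0) (n := 2) (by norm_num)
  obtain ⟨β, hβ⟩ := IsAlgClosed.exists_pow_nat_eq (1 / b 3) (n := 2) (by norm_num)
  have hα0 : α ≠0 := by rintro rfl; simp at hα; exact h0 hα.symm
  have hβ0 : β ≠0 := by rintro rfl; simp at hβ; exact g3 hβ.symm
  have eα : a 0 * α^2 =1 := by rw [hα]; field_simp
  have eβ : b 3 * β^2 =1 := by rw [hβ]; field_simp
  refine S2n (H.diag0 (α := α) (β := β) (γ := 1) (s := 1) hα0 hβ0 one_ne_zero one_ne_zero)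
    ?_ ?_ ?_ ?_ ?_ ?_ ?_
  · simp [dg]; field_simp; linear_combination eα
  · simp [dg, h2]
  · simp [dg, h3]
  · simp [dg, g0]
  · simp [dg, g1]
  · simp [dg]; field_simp; linear_combination eβ
  · simp [dg]; field_simp
    intro h
    apply hne
    have e : (a 1*b 2-a 0*b 3)*(α^2 * β^2) =0 := by
      linear_combination h-b 3 * β^2*eα-eβ
    have := (mul_eq_zero.1 e).resolve_right (by simp [hα0, hβ0])
    linear_combination this
lemma S2b {a b : Fin 10 → ℂ} (H : Bad a b 0)
    (hc : ∀ x y, cub a x y 0 =0 → cub b x y 0 =0 → x =0 ∧ y =0)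
    (hJ : ∃ x y, Jf a b x y ≠0) (hr : Jf a b 0 1 =0) : False := by
  have h3 : a 3 =0 := by
    have := H.JP (H.KV_nz hJ) hr
    simpa [Pf, cub] using this
  have g3 : b 3 ≠0 := by
    intro h
    have := (hc 0 1 (by simp [cub, h3]) (by simp [cub, h])).2
    simp at this
  have h2 : a 2 =0 := by
    simpa [Jf, cubx, cuby, h3, g3] using hr
  obtain ⟨t, ht⟩ : ∃ t, Jf a b 1 t =0 := by
    by_contra! hn
    obtain ⟨-, i2, i3, -⟩ := noroot (c0 := 3*(a 0*b 1-a 1*b 0)) (c1 := 6*a 0*b 2)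
      (c2 := 9*a 0*b 3+3*a 1*b 2) (c3 := 6*a 1*b 3) (c4 := 0) (fun t h => hn t (by
        simp only [Jf, cubx, cuby, h2, h3]; linear_combination h))
    have h1 : a 1 =0 := by simpa [g3] using i3
    have h0 : a 0 =0 := by simpa [g3, h1] using i2
    obtain ⟨x, y, hxy, e⟩ := cubroot b
    exact hxy (hc x y (by simp [cub, h0, h1, h2, h3]) e)
  have H' := H.shear0 t
  have hc' : ∀ x y, cub (shr t a) x y 0 =0 → cub (shr t b-t • shr t a) x y 0 =0 → x =0 ∧ y =0 := by
    intro x y e1 e2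
    rw [cub_sub, e1, cub_shr] at e2
    rw [cub_shr] at e1
    obtain ⟨i, j⟩ := hc _ _ e1 (by linear_combination e2)
    subst i
    exact ⟨rfl, by linear_combination j⟩
  have hJ0 : Jf (shr t a) (shr t b-t • shr t a) 1 0 =0 := by
    simp [shr, Jf, cubx, cuby, cub] at ht ⊢; linear_combination ht
  have h3' : shr t a 3 =0 := by simp [shr, h3]
  have h2' : shr t a 2 =0 := by simp [shr, h3, h2]
  have g3' : (shr t b-t • shr t a) 3 ≠0 := by simp [shr, h3, g3]
  set a' := shr t a
  set b' := shr t b-t • shr t a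
  clear_value a' b'
  have hJ' : ∃ x y, Jf a' b' x y ≠0 := by
    by_contra! hn
    obtain ⟨-, -, i2, i3, -⟩ := poly8 (c0 := 3*(a' 0*b' 1-a' 1*b' 0)) (c1 := 6*a' 0*b' 2)
      (c2 := 9*a' 0*b' 3+3*a' 1*b' 2) (c3 := 6*a' 1*b' 3) (c4 := 0) (c5 := 0)
      (c6 := 0) (c7 := 0) (c8 := 0) (fun t => by
        have := hn 1 t
        simp only [Jf, cubx, cuby, h2', h3'] at this; linear_combination this)
    have h1 : a' 1 =0 := by simpa [g3'] using i3
    have h0 : a' 0 =0 := by simpa [g3', h1] using i2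
    obtain ⟨x, y, hxy, e⟩ := cubroot b'
    exact hxy (hc' x y (by simp [cub, h0, h1, h2', h3']) e)
  have g0 : b' 0 =0 := by
    have := H'.JP (H'.KV_nz hJ') hJ0
    simpa [Pf, cub] using this
  have h0 : a' 0 ≠0 := by
    intro h
    have := (hc' 1 0 (by simp [cub, h]) (by simp [cub, g0])).1
    simp at this
  have g1 : b' 1 =0 := by
    simpa [Jf, cubx, cuby, g0, h0] using hJ0
  refine S2c H' h0 h2' h3' g0 g1 g3' ?_
  intro h
  have := hc' (-a' 1) (a' 0) (by simp only [cub, h2', h3']; ring) (by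
    simp only [cub, g0, g1]; linear_combination -a' 0^2*h)
  exact h0 this.2
lemma S2 {a b : Fin 10 → ℂ} (H : Bad a b 0)
    (hc : ∀ x y, cub a x y 0 =0 → cub b x y 0 =0 → x =0 ∧ y =0) : False := by
  have hJ : ∃ x y, Jf a b x y ≠0 := by
    by_contra! hn
    obtain ⟨m01, m02, m0312, m13, m23, -⟩ := poly8 (c0 := 3*(a 0*b 1-a 1*b 0))
      (c1 := 6*(a 0*b 2-a 2*b 0)) (c2 := 9*(a 0*b 3-a 3*b 0)+3*(a 1*b 2-a 2*b 1))
      (c3 := 6*(a 1*b 3-a 3*b 1)) (c4 := 3*(a 2*b 3-a 3*b 2)) (c5 := 0)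
      (c6 := 0) (c7 := 0) (c8 := 0) (fun t => by
        have := hn 1 t
        simp only [Jf, cubx, cuby] at this; linear_combination this)
    have m03 : a 0*b 3-a 3*b 0 =0 := by
      have : (a 0*b 3-a 3*b 0)^2 =0 := by
        linear_combination (a 0*b 3-a 3*b 0)*m0312 / 9+(m01 / 9*(a 2*b 3-a 3*b 2) *3-m02 / 18*(a 1*b 3-a 3*b 1) *3) / 3
      exact pow_eq_zero_iff (two_ne_zero) |>.1 this
    have m12 : a 1*b 2-a 2*b 1 =0 := by linear_combination m0312 / 3-3*m03
    obtain ⟨x, y, hxy, e⟩ := cubroot a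
    by_cases hB : cub b x y 0 =0
    · exact hxy (hc x y e hB)
    have z0 : a 0*cub b x y 0 =0 := by
      simp only [cub] at e ⊢; linear_combination b 0*e+x^2*y*m01/3+x*y^2*m02/6+y^3*m03
    have z1 : a 1*cub b x y 0 =0 := by
      simp only [cub] at e ⊢; linear_combination b 1*e-x^3*m01/3+x*y^2*m12+y^3*m13/6
    have z2 : a 2*cub b x y 0 =0 := by
      simp only [cub] at e ⊢; linear_combination b 2*e-x^3*m02/6-x^2*y*m12+y^3*m23/3
    have z3 : a 3*cub b x y 0 =0 := by
      simp only [cub] at e ⊢; linear_combination b 3*e-x^3*m03-x^2*y*m13/6-x*y^2*m23/3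
    simp only [mul_eq_zero, hB, or_false] at z0 z1 z2 z3
    obtain ⟨x, y, hxy, e⟩ := cubroot b
    exact hxy (hc x y (by simp [cub, z0, z1, z2, z3]) e)
  by_cases h01 : Jf a b 0 1 =0
  · exact S2b H hc hJ h01
  obtain ⟨t, ht⟩ : ∃ t, Jf a b 1 t =0 := by
    by_contra! hn
    obtain ⟨-, -, -, m23⟩ := noroot (c0 := 3*(a 0*b 1-a 1*b 0))
      (c1 := 6*(a 0*b 2-a 2*b 0)) (c2 := 9*(a 0*b 3-a 3*b 0)+3*(a 1*b 2-a 2*b 1))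
      (c3 := 6*(a 1*b 3-a 3*b 1)) (c4 := 3*(a 2*b 3-a 3*b 2)) (fun t h => hn t (by
        simp only [Jf, cubx, cuby]; linear_combination h))
    apply h01
    simp only [Jf, cubx, cuby]; linear_combination m23
  refine S2b (H.shear0 t).swap0 ?_ ?_ ?_
  · intro x y e1 e2
    rw [cub_sw, cub_shr] at e2
    rw [cub_sw, cub_sub, cub_shr, cub_shr, e2] at e1
    obtain ⟨i, j⟩ := hc _ _ e2 (by linear_combination e1)
    subst i
    exact ⟨by linear_combination j, rfl⟩
  · refine ⟨1,0, ?_⟩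
    intro h
    apply h01
    simp [sw, shr, Jf, cubx, cuby, cub] at h ⊢; linear_combination h
  · simp [sw, shr, Jf, cubx, cuby, cub] at ht ⊢; linear_combination ht
lemma Bad.E_ne {a b c : Fin 10 → ℂ} (H : Bad a b c) : ∃ x y z, ExtV a b c x y z ≠0 := by
  obtain ⟨k, l, hk, hl, e⟩ := H.lines
  by_contra! hc
  let p : Polynomial ℂ := (l.map (fun m => Polynomial.C (m 0)+Polynomial.C (m 1)*Polynomial.X
    + Polynomial.C (m 2)*Polynomial.X^2)).prod
  have hp : p =0 := by
    refine Polynomial.funext fun t => ?_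
    have := hc 1 t (t^2)
    rw [e, mul_eq_zero] at this
    rw [Polynomial.eval_zero, ← this.resolve_left hk]
    simp only [p, Polynomial.eval_list_prod, List.map_map]
    congr 2
    funext m
    simp [lin]
  rw [List.prod_eq_zero_iff] at hp
  obtain ⟨m, hm, h0⟩ := List.mem_map.1 hp
  have h1 := congrArg (fun q => Polynomial.coeff q 0) h0
  have h2 := congrArg (fun q => Polynomial.coeff q 1) h0
  have h3 := congrArg (fun q => Polynomial.coeff q 2) h0
  simp [Polynomial.coeff_C, Polynomial.coeff_X, Polynomial.coeff_X_pow] at h1 h2 h3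
  apply (hl m hm).1
  funext i; fin_cases i
  · exact h1
  · exact h2
  · exact h3
lemma Bad.dich {a b c : Fin 10 → ℂ} (H : Bad a b c) :
    (∃ m, m 2 =1 ∧ InvL a b c m) ∨
    (FactL (fun l => l 2 =0 ∧ Gd a b c l) (ExtV a b c) ∧
      ∀ x y z, ExtV a b c x y z = ExtV a b c x y 0) := by
  obtain ⟨k, l, hk, hl, e⟩ := H.lines
  by_cases h : ∃ m ∈ l, m 2 ≠0
  · obtain ⟨m, hm, h2⟩ := h
    left
    exact ⟨(m 2)⁻¹ • m, by simp [h2], (hl m hm).2.smul (inv_ne_zero h2)⟩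
  · push Not at h
    right
    refine ⟨⟨k, l, hk, fun m hm => ⟨h m hm, hl m hm⟩, e⟩, fun x y z => ?_⟩
    rw [e, e]
    congr 2
    apply List.map_congr_left
    intro m hm
    simp [lin, h m hm]
def N2 (a : Fin 10 → ℂ) : Prop := a 7 =0 ∧ a 8 =0 ∧ a 9 =0
def N3 (a : Fin 10 → ℂ) : Prop := a 4 =0 ∧ a 5 =0 ∧ a 6 =0 ∧ N2 a
lemma lineoff {a b c : Fin 10 → ℂ} (H : Bad a b c) (ha : N2 a) (hb : N2 b) (hc : N3 c)
    {m : Fin 3 → ℂ} (hm : m 2 =1) (hi : InvL a b c m) :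
    Bad ![a 0-m 0*a 4-(m 0*a 4+m 1*b 4),
      a 1-m 0*a 5-m 1*a 4-(m 0*a 5+m 1*b 5),
      a 2-m 0*a 6-m 1*a 5-(m 0*a 6+m 1*b 6), a 3-m 1*a 6, a 4, a 5, a 6,0,0,0]
      ![b 0-m 0*b 4, b 1-m 0*b 5-m 1*b 4-(m 0*a 4+m 1*b 4),
      b 2-m 0*b 6-m 1*b 5-(m 0*a 5+m 1*b 5),
      b 3-m 1*b 6-(m 0*a 6+m 1*b 6), b 4, b 5, b 6,0,0,0] 0 := by
  obtain ⟨a7, a8, a9⟩ := ha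
  obtain ⟨b7, b8, b9⟩ := hb
  obtain ⟨c4, c5, c6, c7, c8, c9⟩ := hc
  refine (H.trans (M := !![1,0,0;0,1,0;-m 0,-m 1,1]) (s := 1)
    (q := ![-(m 0*a 4+m 1*b 4), -(m 0*a 5+m 1*b 5), -(m 0*a 6+m 1*b 6),0,0,0]) ?_ one_ne_zero ?_).1
  · simp [Matrix.det_fin_three]
  · intro x y z
    have h := hi x y (-(m 0*x+m 1*y)) (by simp [lin, hm])
    simp only [hm, cub, a7, a8, a9, b7, b8, b9, c4, c5, c6, c7, c8, c9] at h
    simp [cub, lin, quad, a7, a8, a9, b7, b8, b9, c4, c5, c6, c7, c8, c9]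
    refine ⟨by ring, by ring, by linear_combination -h⟩
lemma minors {a b : Fin 10 → ℂ} (hn : ∀ t, Jf a b 1 t =0) :
    a 0*b 1 = a 1*b 0 ∧ a 0*b 2 = a 2*b 0 ∧ a 0*b 3 = a 3*b 0 ∧
    a 1*b 2 = a 2*b 1 ∧ a 1*b 3 = a 3*b 1 ∧ a 2*b 3 = a 3*b 2 := by
  obtain ⟨m01, m02, m0312, m13, m23, -⟩ := poly8 (c0 := 3*(a 0*b 1-a 1*b 0))
      (c1 := 6*(a 0*b 2-a 2*b 0)) (c2 := 9*(a 0*b 3-a 3*b 0)+3*(a 1*b 2-a 2*b 1))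
      (c3 := 6*(a 1*b 3-a 3*b 1)) (c4 := 3*(a 2*b 3-a 3*b 2)) (c5 := 0)
      (c6 := 0) (c7 := 0) (c8 := 0) (fun t => by
        have := hn t
        simp only [Jf, cubx, cuby] at this; linear_combination this)
  have m03 : a 0*b 3-a 3*b 0 =0 := by
    have : (a 0*b 3-a 3*b 0)^2 =0 := by
      linear_combination (a 0*b 3-a 3*b 0)*m0312 / 9+(m01 / 9*(a 2*b 3-a 3*b 2) *3-m02 / 18*(a 1*b 3-a 3*b 1) *3) / 3
    exact pow_eq_zero_iff (two_ne_zero) |>.1 this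
  exact ⟨by linear_combination m01 / 3, by linear_combination m02 / 6, by linear_combination m03,
    by linear_combination m0312 / 3-3*m03, by linear_combination m13 / 6, by linear_combination m23 / 3⟩
lemma depB {a b : Fin 10 → ℂ} (hn : ∀ t, Jf a b 1 t =0) :
    (b 0 =0 ∧ b 1 =0 ∧ b 2 =0 ∧ b 3 =0) ∨
    ∃ t, ∀ i : Fin 4, (shr t (sw a)-t • shr t (sw b)) (i.castLE (by norm_num)) =0 := by
  obtain ⟨m01, m02, m03, m12, m13, m23⟩ := minors hn
  by_cases h : b 0 =0 ∧ b 1 =0 ∧ b 2 =0 ∧ b 3 =0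
  · exact Or.inl h
  right
  have key : ∃ t, a 0 = t*b 0 ∧ a 1 = t*b 1 ∧ a 2 = t*b 2 ∧ a 3 = t*b 3 := by
    by_cases h0 : b 0 =0
    · by_cases h1 : b 1 =0
      · by_cases h2 : b 2 =0
        · have h3 : b 3 ≠0 := by tauto
          refine ⟨a 3 / b 3, ?_, ?_, ?_, ?_⟩ <;> field_simp <;> assumption
        · refine ⟨a 2 / b 2, ?_, ?_, ?_, ?_⟩ <;> field_simp <;> first | assumption | exact m23.symm
      · refine ⟨a 1 / b 1, ?_, ?_, ?_, ?_⟩ <;> field_simp <;> first | assumption | exact m12.symm | exact m13.symm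
    · refine ⟨a 0 / b 0, ?_, ?_, ?_, ?_⟩ <;> field_simp <;> first | exact m01.symm | exact m02.symm | exact m03.symm
  obtain ⟨t, i0, i1, i2, i3⟩ := key
  refine ⟨t, fun i => ?_⟩
  fin_cases i <;> simp [shr, sw, Fin.castLE, i0, i1, i2, i3] <;> ring
lemma N2.sw {a : Fin 10 → ℂ} (h : N2 a) : N2 (sw a) := by
  obtain ⟨h7, h8, h9⟩ := h
  exact ⟨by simp [_root_.sw, h8], by simp [_root_.sw, h7], by simp [_root_.sw, h9]⟩
lemma N2.shr {a : Fin 10 → ℂ} (h : N2 a) (t : ℂ) : N2 (shr t a) := by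
  obtain ⟨h7, h8, h9⟩ := h
  exact ⟨by simp [_root_.shr, h8, h7], by simp [_root_.shr, h8], by simp [_root_.shr, h9]⟩
lemma N2.sub {a b : Fin 10 → ℂ} (h : N2 a) (h' : N2 b) (t : ℂ) : N2 (a-t • b) := by
  obtain ⟨h7, h8, h9⟩ := h
  obtain ⟨k7, k8, k9⟩ := h'
  exact ⟨by simp [h7, k7], by simp [h8, k8], by simp [h9, k9]⟩
lemma N3.sw {a : Fin 10 → ℂ} (h : N3 a) : N3 (sw a) := by
  obtain ⟨h7, h8, h9, h⟩ := h
  exact ⟨by simp [_root_.sw, h9], by simp [_root_.sw, h8], by simp [_root_.sw, h7], h.sw⟩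
lemma N3.shr {a : Fin 10 → ℂ} (h : N3 a) (t : ℂ) : N3 (shr t a) := by
  obtain ⟨h7, h8, h9, h⟩ := h
  exact ⟨by simp [_root_.shr, h7, h8, h9], by simp [_root_.shr, h8, h9], by simp [_root_.shr, h9], h.shr t⟩
lemma N3.sub {a b : Fin 10 → ℂ} (h : N3 a) (h' : N3 b) (t : ℂ) : N3 (a-t • b) := by
  obtain ⟨h7, h8, h9, h⟩ := h
  obtain ⟨k7, k8, k9, k⟩ := h'
  exact ⟨by simp [h7, k7], by simp [h8, k8], by simp [h9, k9], h.sub k t⟩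
lemma Bad.nocom {a b c : Fin 10 → ℂ} (H : Bad a b c) {x0 y0 : ℂ} (h : ¬ (x0 =0 ∧ y0 =0))
    (h0 : ∀ s z, cub a (s*x0) (s*y0) z =0 ∧ cub b (s*x0) (s*y0) z =0 ∧
      cub c (s*x0) (s*y0) z =0) : False := by
  refine H.ncl ![y0, -x0,0] ?_ ?_
  · intro e
    apply h
    have e0 := congrFun e 0
    have e1 := congrFun e 1
    simp at e0 e1
    exact ⟨e1, e0⟩
  · intro x y z e
    have e : y0*x-x0*y =0 := by simp [lin] at e; linear_combination e
    obtain ⟨s, hx, hy⟩ : ∃ s, x = s*x0 ∧ y = s*y0 := by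
      by_cases hx : x0 =0
      · have hy : y0 ≠0 := by tauto
        refine ⟨y / y0, ?_, by field_simp⟩
        rw [hx] at e ⊢
        simpa [hy] using e
      · exact ⟨x / x0, by field_simp, by field_simp; linear_combination -e⟩
    rw [hx, hy]
    obtain ⟨i, j, k⟩ := h0 s z
    rw [i, j, k]; simp
lemma cub_N3 {a : Fin 10 → ℂ} (h : N3 a) (x y z : ℂ) : cub a x y z = cub a x y 0 := by
  obtain ⟨h4, h5, h6, h7, h8, h9⟩ := h
  simp [cub, h4, h5, h6, h7, h8, h9]
lemma cub_hom (a : Fin 10 → ℂ) (s x y : ℂ) : cub a (s*x) (s*y) 0 = s^3*cub a x y 0 := by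
  simp only [cub]; ring
lemma NU3off {a b c : Fin 10 → ℂ} (H : Bad a b c) (ha : N3 a) (hb : N3 b) (hc : N3 c)
    {m : Fin 3 → ℂ} (hm : m 2 =1) (hi : InvL a b c m) : False := by
  have H' := lineoff H ha.2.2.2 hb.2.2.2 hc hm hi
  obtain ⟨h4, h5, h6, -⟩ := ha
  obtain ⟨g4, g5, g6, -⟩ := hb
  simp only [h4, h5, h6, g4, g5, g6] at H'
  refine S2 H' ?_
  intro x y e1 e2
  by_contra hxy
  refine H'.nocom hxy fun s z => ?_
  rw [cub_N3 (by simp [N3, N2]), cub_N3 (a := ![b 0 - _, _, _, _, _, _, _, _, _, _]) (by simp [N3, N2]),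
    cub_hom, cub_hom, e1, e2]
  simp [cub_zero]
lemma cub_top {a : Fin 10 → ℂ} (h0 : a 0 =0) (h1 : a 1 =0) (h2 : a 2 =0) (h3 : a 3 =0) (h : N3 a) :
    a =0 := by
  obtain ⟨h4, h5, h6, h7, h8, h9⟩ := h
  funext i; fin_cases i <;> assumption
lemma NU3root {a c : Fin 10 → ℂ} (H : Bad a 0 c) (ha : N3 a) (hc : N3 c) :
    (∀ x y, cub a x y 0 =0 → cub c x y 0 =0 → x =0 ∧ y =0) ∧
    ∀ x, Jf a c x 1 =0 → cub a x 1 0 =0 ∧ cubx a x 1 0 =0 := by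
  have hco : ∀ x y, cub a x y 0 =0 → cub c x y 0 =0 → x =0 ∧ y =0 := by
    intro x y e1 e2
    by_contra hxy
    refine H.nocom hxy fun s z => ?_
    rw [cub_N3 ha, cub_N3 hc, cub_hom, cub_hom, e1, e2]
    simp [cub_zero]
  refine ⟨hco, ?_⟩
  intro x hJ
  have hE : ExtV a 0 c x 1 0 = cub a x 1 0*(Jf a c x 1 / 3) := by
    obtain ⟨h4, h5, h6, h7, h8, h9⟩ := ha
    obtain ⟨k4, k5, k6, k7, k8, k9⟩ := hc
    simp only [ExtV, cub, cubx, cuby, cubz, Jf, h4, h5, h6, h7, h8, h9, k4, k5, k6, k7, k8, k9, Pi.zero_apply]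
    ring
  rw [hJ] at hE
  rcases H.dich with ⟨m, hm, hi⟩ | ⟨hF, -⟩
  · exact (NU3off H ha (by simp [N3, N2]) hc hm hi).elim
  obtain ⟨m, ⟨hm2, hG⟩, hm0, -⟩ := hF.pull (x0 := x) (y0 := 1) (z0 := 0) (by rw [hE]; ring)
  have hg : cub a x 1 0 =0 := by
    have h1 := hG.2 x 1 0 hm0
    simp only [hm2, cub_zero, mul_zero, add_zero, zero_mul, mul_eq_zero] at h1
    rcases h1 with h | h
    · exfalso
      apply hG.1
      simp [lin, h] at hm0
      funext i; fin_cases i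
      · exact h
      · exact hm0
      · exact hm2
    · exact h
  refine ⟨hg, ?_⟩
  have hh : cub c x 1 0 ≠0 := fun h => by simpa using (hco x 1 hg h).2
  have : cubx a x 1 0*cub c x 1 0 =0 := by
    have e : Jf a c x 1 =3*(cubx a x 1 0*cub c x 1 0-cub a x 1 0*cubx c x 1 0) := by
      simp only [Jf, cub, cubx, cuby]; ring
    rw [hJ, hg] at e
    linear_combination -e / 3
  simpa [hh] using this
lemma NU3c {a c : Fin 10 → ℂ} (H : Bad a 0 c) (ha : N3 a) (hc : N3 c) (h2 : a 2 =0) (h3 : a 3 =0) :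
    False := by
  obtain ⟨hco, hr⟩ := NU3root H ha hc
  have c3 : c 3 ≠0 := by
    intro h
    simpa using (hco 0 1 (by simp [cub, h3]) (by simp [cub, h])).2
  have h1 : a 1 =0 := by
    by_contra h1
    obtain ⟨i1, i2, i3, -⟩ := noroot (c0 := 6*a 1*c 3) (c1 := 9*a 0*c 3+3*a 1*c 2)
      (c2 := 6*a 0*c 2) (c3 := 3*(a 0*c 1-a 1*c 0)) (c4 := 0) (fun x h => by
        have hx : x ≠0 := by
          rintro rfl
          simp [h1, c3] at h
        obtain ⟨e1, e2⟩ := hr x (by simp only [Jf, cubx, cuby, h2, h3]; linear_combination x*h)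
        simp only [cub, cubx, h2, h3] at e1 e2
        have : a 1*x^2 =0 := by linear_combination 3*e1-x*e2
        simp [h1, hx] at this)
    have h0 : a 0 =0 := by
      by_contra h0
      have : c 2 =0 := by simpa [h0] using i2
      simp [this, h0, c3] at i1
    have k2 : c 2 =0 := by simpa [h0, h1] using i1
    have k0 : c 0 =0 := by simpa [h0, h1] using i3
    simpa using (hco 1 0 (by simp [cub, h0]) (by simp [cub, k0])).1
  have h0 : a 0 ≠0 := by
    intro h0
    obtain ⟨x, y, hxy, e⟩ := cubroot c
    exact hxy (hco x y (by simp [cub, h0, h1, h2, h3]) e)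
  obtain ⟨i1, i2, -⟩ := noroot (c0 := 3*c 3) (c1 := 2*c 2) (c2 := c 1) (c3 := 0) (c4 := 0) (fun x h => by
        have hx : x ≠0 := by
          rintro rfl
          simp [c3] at h
        obtain ⟨e1, e2⟩ := hr x (by
          simp only [Jf, cubx, cuby, h1, h2, h3]; linear_combination 3*a 0*x^2*h)
        simp [cub, h0, h1, h2, h3, hx] at e1)
  have k2 : c 2 =0 := by simpa using i1
  obtain ⟨h4, h5, h6, h7, h8, h9⟩ := ha
  obtain ⟨k4, k5, k6, k7, k8, k9⟩ := hc
  refine Bad.m2 (H.trans (M := !![0,1,0;1,0,0;0,c 0 / a 0,c 3 / a 0]) (s := (a 0)⁻¹) (q := 0) ?_ ?_ ?_).1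
  · simp [Matrix.det_fin_three, h0, c3]
  · simp [h0]
  · intro x y z
    simp [cub, lin, quad, h1, h2, h3, h4, h5, h6, h7, h8, h9, i2, k2, k4, k5, k6, k7, k8, k9]
    constructor
    · field_simp
    · field_simp
lemma NU3b {a c : Fin 10 → ℂ} (H : Bad a 0 c) (ha : N3 a) (hc : N3 c) : False := by
  obtain ⟨hco, hr⟩ := NU3root H ha hc
  by_cases hx : ∃ x, Jf a c x 1 =0
  · obtain ⟨t, ht⟩ := hx
    obtain ⟨e1, e2⟩ := hr t ht
    have H' := (H.swap.shear t).swap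
    have : sw (shr t (sw a)-t • shr t (sw 0)) = sw (shr t (sw a)) := by
      rw [sw_zero, shr_zero]; simp
    rw [this, sw_zero, shr_zero, sw_zero] at H'
    refine NU3c H' (ha.sw.shr t).sw (hc.sw.shr t).sw ?_ ?_
    · simp [sw, shr]; simp [cubx] at e2; linear_combination e2
    · simp [sw, shr]; simp [cub] at e1; linear_combination e1
  · push Not at hx
    obtain ⟨i1, i2, i3, i4⟩ := noroot (c0 := 3*(a 2*c 3-a 3*c 2))
      (c3 := 6*(a 0*c 2-a 2*c 0)) (c2 := 9*(a 0*c 3-a 3*c 0)+3*(a 1*c 2-a 2*c 1))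
      (c1 := 6*(a 1*c 3-a 3*c 1)) (c4 := 3*(a 0*c 1-a 1*c 0)) (fun x h => hx x (by
        simp only [Jf, cubx, cuby]; linear_combination h))
    by_cases h23 : a 2*c 3-a 3*c 2 =0
    · apply hx 0
      simp [Jf, cubx, cuby]; linear_combination 3*h23
    have m03 : a 0*c 3-a 3*c 0 =0 := by
      have : (a 0*c 3-a 3*c 0)^2 =0 := by
        linear_combination (a 0*c 3-a 3*c 0)*i2 / 9+(i4 / 9*(a 2*c 3-a 3*c 2) *3-i3 / 18*(a 1*c 3-a 3*c 1) *3) / 3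
      exact pow_eq_zero_iff (two_ne_zero) |>.1 this
    have z0 : a 0 =0 := by
      have : a 0*(a 2*c 3-a 3*c 2) =0 := by linear_combination a 2*m03-a 3*i3 / 6
      simpa [h23] using this
    have y0 : c 0 =0 := by
      have : c 0*(a 2*c 3-a 3*c 2) =0 := by linear_combination c 2*m03-c 3*i3 / 6
      simpa [h23] using this
    simpa using (hco 1 0 (by simp [cub, z0]) (by simp [cub, y0])).1
lemma NU3 {a b c : Fin 10 → ℂ} (H : Bad a b c) (ha : N3 a) (hb : N3 b) (hc : N3 c) : False := by
  rcases H.dich with ⟨m, hm, hi⟩ | ⟨-, hE⟩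
  · exact NU3off H ha hb hc hm hi
  have hPJ : ∀ x y, Pf a b x y*Jf a b x y =0 := by
    intro x y
    have h1 := hE x y 1
    obtain ⟨h4, h5, h6, h7, h8, h9⟩ := ha
    obtain ⟨g4, g5, g6, g7, g8, g9⟩ := hb
    obtain ⟨k4, k5, k6, k7, k8, k9⟩ := hc
    simp only [ExtV, cub, cubx, cuby, cubz, Jf, Pf, h4, h5, h6, h7, h8, h9, k4, k5, k6, k7, k8, k9,
      g4, g5, g6, g7, g8, g9] at h1 ⊢
    linear_combination 3*h1
  by_cases hP : ∃ x y, Pf a b x y ≠0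
  · have hJ : ∀ x y, Jf a b x y =0 := by
      by_contra! hJ
      obtain ⟨x, y, h⟩ := nz_mul (f := Pf a b) (g := Jf a b)
        (by intro x0 y0 u v; simp only [Pf, cub]; fun_prop)
        (by intro x0 y0 u v; simp only [Jf, cubx, cuby]; fun_prop) hP hJ
      exact h (hPJ x y)
    rcases depB (fun t => hJ 1 t) with ⟨i0, i1, i2, i3⟩ | ⟨t, ht⟩
    · obtain rfl := cub_top i0 i1 i2 i3 hb
      exact NU3b H ha hc
    · have H' := H.swap.shear t
      have := cub_top (ht 0) (ht 1) (ht 2) (ht 3) ((ha.sw.shr t).sub (hb.sw.shr t) t)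
      rw [this] at H'
      exact NU3b H' (hb.sw.shr t) (hc.sw.shr t)
  · push Not at hP
    obtain ⟨x, y, z, h⟩ := H.E_ne
    apply h
    obtain ⟨p0, p1, p2, p3, p4, -⟩ := poly8 (c0 := b 0) (c1 := b 1-a 0) (c2 := b 2-a 1) (c3 := b 3-a 2)
      (c4 := - a 3) (c5 := 0) (c6 := 0) (c7 := 0) (c8 := 0) (fun t => by
        have := hP 1 t
        simp only [Pf, cub] at this; linear_combination this)
    obtain ⟨h4, h5, h6, h7, h8, h9⟩ := ha
    obtain ⟨g4, g5, g6, g7, g8, g9⟩ := hb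
    obtain ⟨k4, k5, k6, k7, k8, k9⟩ := hc
    have e1 : b 1 = a 0 := by linear_combination p1
    have e2 : b 2 = a 1 := by linear_combination p2
    have e3 : b 3 = a 2 := by linear_combination p3
    have e4 : a 3 =0 := by linear_combination -p4
    simp only [ExtV, cub, cubx, cuby, cubz, Jf, Pf, h4, h5, h6, h7, h8, h9, k4, k5, k6, k7, k8, k9,
      g4, g5, g6, g7, g8, g9, p0, e1, e2, e3, e4]
    ring
def q2 (a : Fin 10 → ℂ) (x y : ℂ) : ℂ := a 4*x^2+a 5*x*y+a 6*y^2
def q2x (a : Fin 10 → ℂ) (x y : ℂ) : ℂ := 2*a 4*x+a 5*y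
def q2y (a : Fin 10 → ℂ) (x y : ℂ) : ℂ := a 5*x+2*a 6*y
def k5 (a b : Fin 10 → ℂ) (x y : ℂ) : ℂ :=
  q2 a x y^2*q2x b x y+q2 a x y*q2 b x y*(q2y b x y-q2x a x y)-q2 b x y^2*q2y a x y
def k6 (a b : Fin 10 → ℂ) (x y : ℂ) : ℂ :=
  2*q2 a x y*cub a x y 0*q2x b x y+q2 a x y^2*cubx b x y 0
  + (q2 a x y*cub b x y 0+cub a x y 0*q2 b x y)*(q2y b x y-q2x a x y)
  + q2 a x y*q2 b x y*(cuby b x y 0-cubx a x y 0)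
  - 2*q2 b x y*cub b x y 0*q2y a x y-q2 b x y^2*cuby a x y 0
def k7 (a b : Fin 10 → ℂ) (x y : ℂ) : ℂ :=
  cub a x y 0^2*q2x b x y+2*q2 a x y*cub a x y 0*cubx b x y 0
  + cub a x y 0*cub b x y 0*(q2y b x y-q2x a x y)
  + (q2 a x y*cub b x y 0+cub a x y 0*q2 b x y)*(cuby b x y 0-cubx a x y 0)
  - cub b x y 0^2*q2y a x y-2*q2 b x y*cub b x y 0*cuby a x y 0
lemma KV_exp {a b : Fin 10 → ℂ} (ha : N2 a) (hb : N2 b) (x y z : ℂ) :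
    KV a b x y z = z^3*k5 a b x y+z^2*k6 a b x y+z*k7 a b x y+KV a b x y 0 := by
  obtain ⟨h7, h8, h9⟩ := ha
  obtain ⟨g7, g8, g9⟩ := hb
  have e1 : cub a x y z = z*q2 a x y+cub a x y 0 := by simp [cub, q2, h7, h8, h9]; ring
  have e2 : cub b x y z = z*q2 b x y+cub b x y 0 := by simp [cub, q2, g7, g8, g9]; ring
  have e3 : cubx a x y z = z*q2x a x y+cubx a x y 0 := by simp [cubx, q2x, h7]; ring
  have e4 : cubx b x y z = z*q2x b x y+cubx b x y 0 := by simp [cubx, q2x, g7]; ring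
  have e5 : cuby a x y z = z*q2y a x y+cuby a x y 0 := by simp [cuby, q2y, h8]; ring
  have e6 : cuby b x y z = z*q2y b x y+cuby b x y 0 := by simp [cuby, q2y, g8]; ring
  simp only [KV, e1, e2, e3, e4, e5, e6, k5, k6, k7]
  ring
lemma KV_hom (a b : Fin 10 → ℂ) (t x y z : ℂ) : KV a b (t*x) (t*y) (t*z) = t^8*KV a b x y z := by
  simp only [KV, cub, cubx, cuby]; ring
lemma KV_scale {a b : Fin 10 → ℂ} (ha : N2 a) (hb : N2 b) (t x y : ℂ) :
    KV a b (t*x) (t*y) 1 = t^5*(k5 a b x y+t*k6 a b x y+t^2*k7 a b x y+t^3*KV a b x y 0) := by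
  rw [KV_exp ha hb]
  simp only [k5, k6, k7, KV, cub, cubx, cuby, q2, q2x, q2y]; ring
lemma low {a b : Fin 10 → ℂ} (H : Bad a b 0) (r : ℕ) (w : ℂ → ℂ → ℂ → ℂ)
    (hw : ∀ x y, Continuous fun t => w t x y)
    (h : ∀ t x y, KV a b (t*x) (t*y) 1 = t ^ r*w t x y) (hnz : ∃ x y, w 0 x y ≠0) :
    (∀ x y, w 0 x y =0 → ∀ z, x*cub b x y z = y*cub a x y z) ∧
    ∃ F : ℂ → ℂ → ℂ, (∀ x, Continuous (F x)) ∧ (∀ x y, KV a b x y 1 = w 0 x y*F x y) ∧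
      ((∃ m, m 2 =1 ∧ (m 0 ≠0 ∨ m 1 ≠0) ∧ InvL a b 0 m) ∨ ∀ x y, F x y =1) := by
  obtain ⟨h1, l2, hl2, e⟩ := tool1 (G := Gd a b 0) (E := ExtV a b 0) H.lines (fun l h => h.1) Gd_smul r w hw
    (fun t x y => by rw [ExtV_zero, h]; ring) hnz
  refine ⟨fun x y h0 z => ?_, fun x y => (l2.map (fun m => lin m x y 1)).prod, ?_, ?_, ?_⟩
  · obtain ⟨m, ⟨⟨hm2, hm⟩, hG⟩, hm0, -⟩ := h1.pull (x0 := x) (y0 := y) (z0 := z) h0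
    have h2 := hG.2 x y z hm0
    simp only [cub_zero, mul_zero, add_zero, lin, hm2, zero_mul] at h2 hm0
    rcases hm with hm | hm
    · apply mul_left_cancel₀ hm
      linear_combination -y*h2+cub b x y z*hm0
    · apply mul_left_cancel₀ hm
      linear_combination x*h2-cub a x y z*hm0
  · intro x
    exact cont_prod l2 continuous_const continuous_id continuous_const
  · intro x y
    have := e x y 1
    rw [ExtV_zero] at this
    linear_combination this
  · by_cases hm : ∃ m ∈ l2, m 0 ≠0 ∨ m 1 ≠0
    · obtain ⟨m, hm, h0⟩ := hm
      exact Or.inl ⟨m, (hl2 m hm).1, h0, (hl2 m hm).2.2⟩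
    · push Not at hm
      right
      intro x y
      apply List.prod_eq_one
      intro v hv
      obtain ⟨m, hm', rfl⟩ := List.mem_map.1 hv
      simp [lin, hm m hm', (hl2 m hm').1]
lemma low5 {a b : Fin 10 → ℂ} (H : Bad a b 0) (ha : N2 a) (hb : N2 b) (hnz : ∃ x y, k5 a b x y ≠0) :
    (∀ x y, k5 a b x y =0 → ∀ z, x*cub b x y z = y*cub a x y z) ∧
    ∃ F : ℂ → ℂ → ℂ, (∀ x, Continuous (F x)) ∧ (∀ x y, KV a b x y 1 = k5 a b x y*F x y) ∧
      ((∃ m, m 2 =1 ∧ (m 0 ≠0 ∨ m 1 ≠0) ∧ InvL a b 0 m) ∨ ∀ x y, F x y =1) := by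
  have := low H 5 (fun t x y => k5 a b x y+t*k6 a b x y+t^2*k7 a b x y+t^3*KV a b x y 0)
    (fun x y => by fun_prop) (fun t x y => KV_scale ha hb t x y)
  simp only [zero_mul, add_zero, zero_pow (two_ne_zero), zero_pow (three_ne_zero)] at this
  exact this hnz
lemma low6 {a b : Fin 10 → ℂ} (H : Bad a b 0) (ha : N2 a) (hb : N2 b) (h5 : ∀ x y, k5 a b x y =0)
    (hnz : ∃ x y, k6 a b x y ≠0) :
    (∀ x y, k6 a b x y =0 → ∀ z, x*cub b x y z = y*cub a x y z) ∧
    ∃ F : ℂ → ℂ → ℂ, (∀ x, Continuous (F x)) ∧ (∀ x y, KV a b x y 1 = k6 a b x y*F x y) ∧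
      ((∃ m, m 2 =1 ∧ (m 0 ≠0 ∨ m 1 ≠0) ∧ InvL a b 0 m) ∨ ∀ x y, F x y =1) := by
  have := low H 6 (fun t x y => k6 a b x y+t*k7 a b x y+t^2*KV a b x y 0)
    (fun x y => by fun_prop) (fun t x y => by rw [KV_scale ha hb, h5]; ring)
  simp only [zero_mul, add_zero, zero_pow (two_ne_zero)] at this
  exact this hnz
lemma Bad.nocom2 {a b : Fin 10 → ℂ} (H : Bad a b 0) {x0 y0 : ℂ} (h : ¬ (x0 =0 ∧ y0 =0))
    (ha : N2 a) (hb : N2 b) (h1 : q2 a x0 y0 =0) (h2 : q2 b x0 y0 =0) (h3 : cub a x0 y0 0 =0)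
    (h4 : cub b x0 y0 0 =0) : False := by
  obtain ⟨h7, h8, h9⟩ := ha
  obtain ⟨g7, g8, g9⟩ := hb
  refine H.nocom h fun s z => ⟨?_, ?_, cub_zero _ _ _⟩
  · simp only [cub, q2, h7, h8, h9] at *; linear_combination s^3*h3+s^2*z*h1
  · simp only [cub, q2, g7, g8, g9] at *; linear_combination s^3*h4+s^2*z*h2
lemma yord {a b : Fin 10 → ℂ} {n m : ℕ} (hnm : n < m) {Q G : ℂ → ℂ → ℂ} (hQ : ∀ x, Continuous (Q x))
    (hG : ∀ x, Continuous (G x)) (h1 : ∀ x y, KV a b x y 1 = y ^ n*Q x y)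
    (h2 : ∀ x y, KV a b x y 1 = y ^ m*G x y) (x : ℂ) : Q x 0 =0 :=
  pow_lt_zero (hQ x) (hG x) hnm (fun t => by rw [← h1, ← h2])
lemma y2cond {a b : Fin 10 → ℂ} (H : Bad a b 0) (ha : N2 a) (hb : N2 b) (h0 : b 0 =0) (h4 : b 4 =0)
    {G : ℂ → ℂ → ℂ} (hG : ∀ x, Continuous (G x)) (h2 : ∀ x y, KV a b x y 1 = y^2*G x y) :
    (b 1 =0 ∨ b 1-a 0 =0) ∧ (b 5 =0 ∨ b 1-a 0 =0) ∧ (b 5 =0 ∨ b 5-a 4 =0) := by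
  obtain ⟨a7, a8, a9⟩ := id ha
  obtain ⟨b7, b8, b9⟩ := id hb
  have key := yord (n := 1) (m := 2) (by norm_num) (Q := fun x y =>
    cub a x y 1*(cub a x y 1*(2*b 1*x+b 2*y+b 5)+(b 1*x^2+b 2*x*y+b 3*y^2
      + b 5*x+b 6*y)*cuby b x y 1)-(b 1*x^2+b 2*x*y+b 3*y^2
      + b 5*x+b 6*y)*(cub a x y 1*cubx a x y 1+cub b x y 1*cuby a x y 1)) (G := G)
    (by intro x; simp only [cub, cubx, cuby]; fun_prop) hG (fun x y => by
      simp only [KV, cub, cubx, cuby, h0, h4, b7, b8, b9]; ring) h2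
  simp only [cub, cubx, cuby, a7, a8, a9, h0, h4, b7, b8, b9] at key
  have key : ∀ x, x^4*((a 0*x+a 4)*(b 1*(b 1-a 0)*x^2+2*b 5*(b 1-a 0)*x
      + b 5*(b 5-a 4))) =0 := fun x => by linear_combination key x
  have key : ∀ x, (a 0*x+a 4)*(b 1*(b 1-a 0)*x^2+2*b 5*(b 1-a 0)*x
      + b 5*(b 5-a 4)) =0 := by
    refine cont_ext (by fun_prop) (by fun_prop) (fun x hx => ?_)
    simpa [hx] using key x
  obtain ⟨e0, e1, e2, e3, -⟩ := poly8 (c0 := a 4*(b 5*(b 5-a 4)))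
    (c1 := a 0*(b 5*(b 5-a 4))+a 4*(2*b 5*(b 1-a 0)))
    (c2 := a 0*(2*b 5*(b 1-a 0))+a 4*(b 1*(b 1-a 0))) (c3 := a 0*(b 1*(b 1-a 0)))
    (c4 := 0) (c5 := 0) (c6 := 0) (c7 := 0) (c8 := 0) (fun x => by linear_combination key x)
  rw [← mul_eq_zero, ← mul_eq_zero, ← mul_eq_zero]
  by_cases h : a 0 =0
  · have h4' : a 4 ≠0 := by
      intro h'
      exact H.nocom2 (x0 := 1) (y0 := 0) (by simp) ha hb (by simp [q2, h']) (by simp [q2, h4])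
        (by simp [cub, h]) (by simp [cub, h0])
    rw [h] at e1 e2 ⊢
    simp only [zero_mul, zero_add, mul_eq_zero, h4', false_or, two_ne_zero] at e0 e1 e2
    refine ⟨by simpa using e2, by simpa using e1, by simpa using e0⟩
  · have f3 := (mul_eq_zero.1 e3).resolve_left h
    rw [f3] at e2
    have f2 : b 5*(b 1-a 0) =0 := by
      apply mul_left_cancel₀ h; linear_combination e2 / 2
    refine ⟨f3, f2, ?_⟩
    apply mul_left_cancel₀ h; linear_combination e1-2*a 4*f2
lemma y3cond {a b : Fin 10 → ℂ} (ha : N2 a) (hb : N2 b) (h0 : b 0 =0) (h4 : b 4 =0)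
    (h3 : b 3 =0) (g2 : a 2 =0) (g3 : a 3 =0) (g6 : a 6 =0)
    (c1 : b 1*(b 1-a 0) =0) (c2 : b 5*(b 1-a 0) =0) (c3 : b 5*(b 5-a 4) =0)
    {G : ℂ → ℂ → ℂ} (hG : ∀ x, Continuous (G x)) (h2 : ∀ x y, KV a b x y 1 = y^3*G x y) (x : ℂ) :
    (a 0*x^3+a 4*x^2)*((a 1*x^2+a 5*x)*(2*b 1*x+b 5)+(a 0*x^3+a 4*x^2)*b 2
      +3*(b 1*x^2+b 5*x)*(b 2*x+b 6)-(b 2*x+b 6)*(3*a 0*x^2+2*a 4*x)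
      - (b 1*x^2+b 5*x)*(2*a 1*x+a 5))
      - (b 1*x^2+b 5*x)^2*(a 1*x^2+a 5*x) =0 := by
  obtain ⟨a7, a8, a9⟩ := id ha
  obtain ⟨b7, b8, b9⟩ := id hb
  have key := yord (a := a) (b := b) (n := 2) (m := 3) (by norm_num) (Q := fun x y =>
    (a 0*x^3+a 4*x^2+y*(a 1*x^2+a 5*x))*((a 1*x^2+a 5*x)*(2*b 1*x+b 5)+(a 0*x^3+a 4*x^2)*b 2
      +3*(b 1*x^2+b 5*x)*(b 2*x+b 6)-(b 2*x+b 6)*(3*a 0*x^2+2*a 4*x)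
      - (b 1*x^2+b 5*x)*(2*a 1*x+a 5)+y*((a 1*x^2+a 5*x)*b 2+2*(b 2*x+b 6)^2
      - (b 2*x+b 6)*(2*a 1*x+a 5)))
      - (b 1*x^2+b 5*x+y*(b 2*x+b 6))^2*(a 1*x^2+a 5*x)) (G := G)
    (by intro x; fun_prop) hG (fun x y => by
      simp only [KV, cub, cubx, cuby, h0, h4, h3, g2, g3, g6, a7, a8, a9, b7, b8, b9]
      linear_combination y*(a 0*x^3+a 4*x^2+y*(a 1*x^2+a 5*x)) *
        (x^4*c1+2*x^3*c2+x^2*c3)) h2 x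
  simpa using key
lemma hom5 {a b : Fin 10 → ℂ} (ha : N2 a) (hb : N2 b) (h : ∀ x y, KV a b x y 1 = k5 a b x y) (x y : ℂ) :
    k6 a b x y =0 ∧ k7 a b x y =0 ∧ KV a b x y 0 =0 := by
  have key : ∀ t, t ≠0 → k6 a b x y+t*k7 a b x y+t^2*KV a b x y 0 =0 := by
    intro t ht
    have := KV_scale ha hb t x y
    rw [h] at this
    have e : k5 a b (t*x) (t*y) = t^5*k5 a b x y := by
      simp only [k5, q2, q2x, q2y]; ring
    rw [e] at this
    apply mul_left_cancel₀ (pow_ne_zero 6 ht); linear_combination -this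
  have e1 := key 1 one_ne_zero
  have e2 := key (-1) (by norm_num)
  have e3 := key 2 (by norm_num)
  exact ⟨by linear_combination e1+e2 / 3-e3 / 3, by linear_combination (e1-e2) / 2,
    by linear_combination (-3*e1+e2+2*e3) / 6⟩
lemma noP4 {a b : Fin 10 → ℂ} (H : Bad a b 0) (h0 : b 0 =0) (h1 : b 1 = a 0) (h2 : b 2 = a 1)
    (h3 : b 3 = a 2) (h4 : a 3 =0) : False := by
  obtain ⟨x, y, h⟩ := H.P_ne
  apply h
  simp only [Pf, cub, h0, h1, h2, h3, h4]; ring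
lemma IIc_r {a1 a2 r b0 b1 b2 β : ℂ} (hr : r ≠0)
    (H : Bad ![a1, a2,0,0, r,0,0,0,0,0] ![b0, b1, b2,0, β,0,1,0,0,0] 0) : False := by
  have ha : N2 ![a1, a2,0,0, r,0,0,0,0,0] := by simp [N2]
  have hb : N2 ![b0, b1, b2,0, β,0,1,0,0,0] := by simp [N2]
  have e5 : ∀ x y, k5 ![a1, a2,0,0, r,0,0,0,0,0] ![b0, b1, b2,0, β,0,1,0,0,0] x y =
      2*r*x^2*y*(y^2-r*x*y+β*x^2) := by
    intro x y; simp [k5, q2, q2x, q2y]; ring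
  obtain ⟨hroot, F, hF, hK, hm⟩ := low5 H ha hb (by
    by_contra! hc
    have c1 := hc 1 1
    have c2 := hc 1 (-1)
    have c3 := hc 1 2
    rw [e5] at c1 c2 c3
    apply hr
    linear_combination (-3*c1-c2+c3) / 12-(c1+(-1)*c2*(-1) ) *0+((c1+c2) / 2 *0))
  have hβ : β =0 := by
    have h1 := hroot 1 0 (by rw [e5]; ring) 1
    have h0 := hroot 1 0 (by rw [e5]; ring) 0
    simp [cub] at h1 h0
    linear_combination h1-h0
  have hb0 : b0 =0 := by
    have h0 := hroot 1 0 (by rw [e5]; ring) 0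
    simpa [cub] using h0
  subst hβ hb0
  have hr1 := hroot 1 r (by rw [e5]; ring) 0
  simp [cub] at hr1
  have hr1 : b1+b2*r = a1+a2*r := by
    apply mul_left_cancel₀ hr; linear_combination hr1
  have hy := y2cond H ha hb (by simp) (by simp) (G := fun x y => 2*r*x^2*(y-r*x)*F x y)
    (by intro x; have := hF x; fun_prop) (fun x y => by rw [hK, e5]; ring)
  simp at hy
  rcases hy with hy | hy
  · subst hy
    simp at hr1
    rcases hm with ⟨m, hm2, hm, hi⟩ | hm
    · have hm1 : m 1 =0 := by
        have := hi 0 1 (-m 1) (by simp [lin, hm2])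
        simpa [cub] using this
      have hm0 : m 0 ≠0 := by tauto
      have h1 := hi 1 0 (-m 0) (by simp [lin, hm2])
      have h2 := hi 1 1 (-m 0) (by simp [lin, hm2, hm1])
      simp [cub, hm0, hm1] at h1 h2
      have h3 : a2 =0 := by linear_combination h2-h1
      have h4 : a1 = m 0*r := by linear_combination h1
      have h5 : b2 = m 0 := by
        apply mul_right_cancel₀ hr; rw [hr1, h3, h4]; ring
      subst h3 h4
      refine H.ncl m (fun h => hm0 (by simp [h])) ?_
      intro x y z hz
      simp only [lin, hm1, hm2] at hz
      obtain rfl : z = -m 0*x := by linear_combination hz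
      simp [cub, h5]
      refine ⟨?_, ?_⟩ <;> right <;> ring
    · have h6 := fun x y => (hom5 ha hb (fun x y => by rw [hK, hm, mul_one]) x y).1
      have g1 := h6 1 1
      have g2 := h6 1 (-1)
      have g3 := h6 1 2
      simp [k6, q2, q2x, q2y, cub, cubx, cuby] at g1 g2 g3
      have ha2 : a2 =0 := by linear_combination g3 / 12+g2 / 6-g1 / 2
      have hb2 : b2 =0 := by
        apply mul_left_cancel₀ hr; linear_combination (g1-g2) / 12+hr1 / 3+r*ha2
      subst ha2 hb2
      simp at hr1
      subst hr1
      exact noP4 H (by simp) (by simp) (by simp) (by simp) (by simp)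
  · have : b1 = a1 := by linear_combination hy
    subst this
    have : b2 = a2 := by apply mul_right_cancel₀ hr; linear_combination hr1
    exact noP4 H (by simp) (by simp) (by simp [this]) (by simp) (by simp)
lemma IIc_0 {a1 a2 b0 b1 b2 β : ℂ}
    (H : Bad ![a1, a2,0,0,0,0,0,0,0,0] ![b0, b1, b2,0, β,0,1,0,0,0] 0) : False := by
  have ha : N2 ![a1, a2,0,0,0,0,0,0,0,0] := by simp [N2]
  have hb : N2 ![b0, b1, b2,0, β,0,1,0,0,0] := by simp [N2]
  have e5 : ∀ x y, k5 ![a1, a2,0,0,0,0,0,0,0,0] ![b0, b1, b2,0, β,0,1,0,0,0] x y =0 := by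
    intro x y; simp [k5, q2, q2x, q2y]
  have e6 : ∀ x y, k6 ![a1, a2,0,0,0,0,0,0,0,0] ![b0, b1, b2,0, β,0,1,0,0,0] x y =
      x^2*(y^2+β*x^2)*(a2*y^2+2*a1*x*y-a2 * β*x^2) := by
    intro x y; simp [k6, q2, q2x, q2y, cub, cubx, cuby]; ring
  have hane : ¬ (a1 =0 ∧ a2 =0) := by
    rintro ⟨rfl, rfl⟩
    obtain ⟨x, y, z, h⟩ := H.E_ne
    apply h
    simp [ExtV, cub, cubx, cuby, cubz]
  obtain ⟨hroot, F, hF, hK, -⟩ := low6 H ha hb e5 (by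
    by_contra! hc
    obtain ⟨-, c1, c2, c3, c4, -⟩ := poly8 (c0 := -a2 * β^2) (c1 := 2*a1 * β) (c2 := 0) (c3 := 2*a1) (c4 := a2)
      (c5 := 0) (c6 := 0) (c7 := 0) (c8 := 0) (fun y => by
        have := hc 1 y
        rw [e6] at this; linear_combination this)
    exact hane ⟨by linear_combination c3 / 2, c4⟩)
  have hr : ∀ t, (t^2+β)*(a2*t^2+2*a1*t-a2 * β) =0 →
      t^2+β =0 ∧ b0+b1*t+b2*t^2 = t*(a1+a2*t) := by
    intro t ht
    have h := hroot 1 t (by rw [e6]; linear_combination ht)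
    have h1 := h 1
    have h0 := h 0
    simp [cub] at h1 h0
    exact ⟨by linear_combination h1-h0, h0⟩
  by_cases hβ : β =0
  · subst hβ
    obtain ⟨-, hb0⟩ := hr 0 (by ring)
    have hb0 : b0 =0 := by simpa using hb0
    subst hb0
    have ha1 : a1 ≠0 := by
      rintro rfl
      exact H.nocom2 (x0 := 1) (y0 := 0) (by simp) ha hb (by simp [q2]) (by simp [q2])
        (by simp [cub]) (by simp [cub])
    have ha2 : a2 =0 := by
      by_contra ha2
      have := (hr (-2*a1 / a2) (by field_simp; ring)).1
      field_simp at this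
      apply ha1
      simpa using this
    subst ha2
    have hy := (y2cond H ha hb (by simp) (by simp) (G := fun x y => 2*a1*x^3*y*F x y)
      (by intro x; have := hF x; fun_prop) (fun x y => by rw [hK, e6]; ring)).1
    simp at hy
    have hz := y3cond ha hb (by simp) (by simp) (by simp) (by simp) (by simp) (by simp) (by simpa using hy)
      (by simp) (by simp) (G := fun x y => 2*a1*x^3*F x y)
      (by intro x; have := hF x; fun_prop) (fun x y => by rw [hK, e6]; ring)
    have z1 := hz 1
    have z2 := hz (-1)
    simp at z1 z2
    simp only [ha1, false_or] at z1 z2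
    have w1 : b1 = a1 := by linear_combination (z1+z2) / 6+0*z1
    subst w1
    have w2 : b2 =0 := by
      apply mul_left_cancel₀ ha1; linear_combination z1
    subst w2
    exact noP4 H (by simp) (by simp) (by simp) (by simp) (by simp)
  · have ha2 : a2 ≠0 := by
      rintro rfl
      apply hβ
      simpa using (hr 0 (by ring)).1
    obtain ⟨σ, hσ⟩ := IsAlgClosed.exists_pow_nat_eq (a1^2+a2^2 * β) (n := 2) (by norm_num)
    have r1 := hr ((-a1+σ) / a2) (mul_eq_zero_of_right _ (by field_simp; linear_combination hσ))
    have r2 := hr ((-a1-σ) / a2) (mul_eq_zero_of_right _ (by field_simp; linear_combination hσ))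
    have q1 := r1.1
    have q2' := r2.1
    field_simp at q1 q2'
    have hs : a1 * σ =0 := by linear_combination (q2'-q1) / 4
    have hσ0 : σ =0 := by
      rcases mul_eq_zero.1 hs with h | h
      · exfalso
        subst h
        have : 2*a2^2 * β =0 := by linear_combination q1-hσ
        simp [ha2, hβ] at this
      · exact h
    subst hσ0
    simp at r1
    refine H.nocom2 (x0 := 1) (y0 := -a1 / a2) (by simp) ha hb (by simp [q2]) ?_ ?_ ?_
    · simp [q2]; linear_combination r1.1
    · simp [cub]; field_simp; ring
    · simp [cub]
      rw [r1.2]; field_simp; ring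
lemma IIc_1 {a1 a2 b0 b1 b2 β γ : ℂ}
    (H : Bad ![a1, a2,0,0,0,1,0,0,0,0] ![b0, b1, b2,0, β, γ,1,0,0,0] 0) : False := by
  have ha : N2 ![a1, a2,0,0,0,1,0,0,0,0] := by simp [N2]
  have hb : N2 ![b0, b1, b2,0, β, γ,1,0,0,0] := by simp [N2]
  have e5 : ∀ x y, k5 ![a1, a2,0,0,0,1,0,0,0,0] ![b0, b1, b2,0, β, γ,1,0,0,0] x y =
      x^2*(γ*y+β*x)*(y^2-β*x^2) := by
    intro x y; simp [k5, q2, q2x, q2y]; ring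
  have e6 : β =0 → γ =0 → ∀ x y, k6 ![a1, a2,0,0,0,1,0,0,0,0] ![b0, b1, b2,0, β, γ,1,0,0,0] x y =
      2*x^2*y^2*(b0*x^2+b1*x*y+b2*y^2-y*(a1*x+a2*y)) := by
    rintro rfl rfl x y; simp [k6, q2, q2x, q2y, cub, cubx, cuby]; ring
  by_cases hβγ : β =0 ∧ γ =0
  · obtain ⟨rfl, rfl⟩ := hβγ
    have e6 := e6 rfl rfl
    obtain ⟨hroot, F, hF, hK, -⟩ := low6 H ha hb (fun x y => by rw [e5]; ring) (by
      by_contra! hc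
      obtain ⟨-, -, c0, c1, c2, -⟩ := poly8 (c0 := 0) (c1 := 0) (c2 := 2*b0) (c3 := 2*(b1-a1))
        (c4 := 2*(b2-a2)) (c5 := 0) (c6 := 0) (c7 := 0) (c8 := 0) (fun y => by
          have := hc 1 y
          rw [e6] at this; linear_combination this)
      exact noP4 H (by simpa using c0) (by simp; linear_combination c1 / 2)
        (by simp; linear_combination c2 / 2) (by simp) (by simp))
    have hb0 := hroot 1 0 (by rw [e6]; ring) 0
    simp [cub] at hb0
    subst hb0
    have ha1 : a1 ≠0 := by
      rintro rfl
      exact H.nocom2 (x0 := 1) (y0 := 0) (by simp) ha hb (by simp [q2]) (by simp [q2])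
        (by simp [cub]) (by simp [cub])
    have hy := (y2cond H ha hb (by simp) (by simp) (G := fun x y => 2*x^2*y*(b1*x+b2*y-(a1*x+a2*y))*F x y)
      (by intro x; have := hF x; fun_prop) (fun x y => by rw [hK, e6]; ring)).1
    simp at hy
    have hz := y3cond ha hb (by simp) (by simp) (by simp) (by simp) (by simp) (by simp) (by simpa using hy)
      (by simp) (by simp) (G := fun x y => 2*x^2*(b1*x+b2*y-(a1*x+a2*y))*F x y)
      (by intro x; have := hF x; fun_prop) (fun x y => by rw [hK, e6]; ring)
    have z1 := hz 1
    have z2 := hz (-1)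
    simp at z1 z2
    rcases hy with rfl | hy
    · simp [ha1] at z1 z2
      have : a1 *6 =0 := by linear_combination -z1-z2
      simp [ha1] at this
    · obtain rfl : b1 = a1 := by linear_combination hy
      have : b2 = a2 := by
        have : b1^2*(b2-a2) =0 := by linear_combination (z1+z2) / 2
        simp [ha1] at this; linear_combination this
      exact noP4 H (by simp) (by simp) (by simp [this]) (by simp) (by simp)
  · obtain ⟨hroot, F, hF, hK, -⟩ := low5 H ha hb (by
      by_contra! hc
      obtain ⟨-, c1, c2, c3, c4, -⟩ := poly8 (c0 := -β^2) (c1 := -β * γ) (c2 := β) (c3 := γ)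
        (c4 := 0) (c5 := 0) (c6 := 0) (c7 := 0) (c8 := 0) (fun y => by
          have := hc 1 y
          rw [e5] at this; linear_combination this)
      exact hβγ ⟨c2, c3⟩)
    have hr : ∀ t, t^2 = β → γ*t+β =0 := by
      intro t ht
      have h := hroot 1 t (by rw [e5, ht]; ring)
      have h1 := h 1
      have h0 := h 0
      simp [cub] at h1 h0
      linear_combination h1-h0
    obtain ⟨δ, hδ⟩ := IsAlgClosed.exists_pow_nat_eq β (n := 2) (by norm_num)
    have hβ : β =0 := by
      linear_combination (hr δ hδ+hr (-δ) (by rw [← hδ]; ring)) / 2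
    subst hβ
    have hγ : γ ≠0 := by tauto
    have hb0 := hroot 1 0 (by rw [e5]; ring) 0
    simp [cub] at hb0
    subst hb0
    obtain ⟨-, -, h⟩ := (y2cond H ha hb (by simp) (by simp) (G := fun x y => γ*x^2*y*F x y)
      (by intro x; have := hF x; fun_prop) (fun x y => by rw [hK, e5]; ring))
    simp [hγ] at h
lemma IIc {a b : Fin 10 → ℂ} (H : Bad a b 0) (ha : N2 a) (hb : N2 b) (h2 : a 2 =0) (h3 : a 3 =0)
    (h6 : a 6 =0) (g3 : b 3 =0) (g6 : b 6 =1) (h5 : a 5 =0 ∨ a 5 =1) : False := by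
  obtain ⟨h7, h8, h9⟩ := ha
  obtain ⟨g7, g8, g9⟩ := hb
  rcases h5 with h5 | h5
  · have H' := (H.shear0 (-b 5 / 2)).congr (a' := ![a 0+a 1*(-b 5 / 2), a 1,0,0, a 4,0,0,0,0,0])
      (b' := ![_, _, _,0, _,0,1,0,0,0]) (c' := 0) (by
        funext i; fin_cases i <;> simp [shr, h2, h3, h5, h6, h7, h8, h9]) (by
        funext i; fin_cases i <;> simp [shr, h2, h3, h5, h6, h7, h8, h9, g3, g6, g7, g8, g9]
        on_goal 5 => ring
        all_goals rfl) rfl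
    by_cases h4 : a 4 =0
    · rw [h4] at H'; exact IIc_0 H'
    · exact IIc_r h4 H'
  · have H' := (H.shear0 (-a 4)).congr (a' := ![a 0+a 1*(-a 4), a 1,0,0,0,1,0,0,0,0])
      (b' := ![_, _, _,0, _, _,1,0,0,0]) (c' := 0) (by
        funext i; fin_cases i <;> simp [shr, h2, h3, h5, h6, h7, h8, h9]) (by
        funext i; fin_cases i <;> simp [shr, h2, h3, h5, h6, h7, h8, h9, g3, g6, g7, g8, g9]
        all_goals rfl) rfl
    exact IIc_1 H'
lemma quadroots {s p q : ℂ} (hs : s ≠0) : ∃ r1 r2, ∀ y, s*y^2+p*y+q = s*(y-r1)*(y-r2) := by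
  obtain ⟨δ, hδ⟩ := IsAlgClosed.exists_pow_nat_eq (p^2-4*s*q) (n := 2) (by norm_num)
  refine ⟨(-p+δ) / (2*s), (-p-δ) / (2*s), fun y => ?_⟩
  field_simp
  linear_combination hδ
lemma IIb1 {w s b0 b1 b2 : ℂ} (hs : s ≠0) (hs1 : 1-s ≠0)
    (H : Bad ![w, s,0,0, w, s,0,0,0,0] ![b0, b1, b2,0,0, w-1+s,1,0,0,0] 0) : False := by
  have ha : N2 ![w, s,0,0, w, s,0,0,0,0] := by simp [N2]
  have hb : N2 ![b0, b1, b2,0,0, w-1+s,1,0,0,0] := by simp [N2]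
  obtain ⟨r1, r2, hr⟩ := quadroots (s := s) (p := 2*w) (q := w*(w-1+s)) hs
  have e5 : ∀ x y, k5 ![w, s,0,0, w, s,0,0,0,0] ![b0, b1, b2,0,0, w-1+s,1,0,0,0] x y =
      x*(1-s)*y*(y-x)*(s*y^2+2*w*x*y+w*(w-1+s)*x^2) := by
    intro x y; simp [k5, q2, q2x, q2y]; ring
  obtain ⟨hroot, F, hF, hK, -⟩ := low5 H ha hb (by
    by_contra! hc
    obtain ⟨-, -, -, -, c4, -⟩ := poly8 (c0 := 0) (c1 := - (1-s)*w*(w-1+s))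
      (c2 := (1-s)*(w*(w-1+s)-2*w)) (c3 := (1-s)*(2*w-s)) (c4 := (1-s)*s)
      (c5 := 0) (c6 := 0) (c7 := 0) (c8 := 0) (fun y => by
        have := hc 1 y
        rw [e5] at this; linear_combination this)
    simp [hs, hs1] at c4)
  have h0 := hroot 1 0 (by rw [e5]; ring) 0
  have h1 := hroot 1 1 (by rw [e5]; ring) 0
  simp [cub] at h0 h1
  subst h0
  have hrr : ∀ r, s*r^2+2*w*r+w*(w-1+s) =0 → r =0 ∨ r =1 := by
    intro r h
    have g1 := hroot 1 r (by rw [e5]; linear_combination (1-s)*r*(r-1)*h) 1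
    have g0 := hroot 1 r (by rw [e5]; linear_combination (1-s)*r*(r-1)*h) 0
    simp [cub] at g0 g1
    have : (1-s)*(r*(r-1)) =0 := by linear_combination g1-g0
    simp [hs1] at this
    rcases this with h | h
    · exact Or.inl h
    · exact Or.inr (by linear_combination h)
  have hr1 := hrr r1 (by rw [hr]; ring)
  have hr2 := hrr r2 (by rw [hr]; ring)
  have v0 := hr 0
  have v1 := hr 1
  have v2 := hr (-1)
  have c00 : w ≠0 := by
    rintro rfl
    exact H.nocom2 (x0 := 1) (y0 := 0) (by simp) ha hb (by simp [q2]) (by simp [q2]) (by simp [cub]) (by simp [cub])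
  have c11 : w ≠ -s := by
    intro h
    subst h
    exact H.nocom2 (x0 := 1) (y0 := 1) (by simp) ha hb (by simp [q2]) (by simp [q2]; ring) (by simp [cub]) (by simp [cub]; linear_combination h1)
  have hm : s = -2*w := by
    rcases hr1 with rfl | rfl <;> rcases hr2 with rfl | rfl
    · exact absurd (by linear_combination (v1-v2) / 4) c00
    · linear_combination (v1-v2) / 2
    · linear_combination (v1-v2) / 2
    · exact absurd (by linear_combination (v1-v2) / 4) c11
  have hp : w = -1 := by
    have : w*(-w-1) =0 := by
      rcases hr1 with rfl | rfl <;> rcases hr2 with rfl | rfl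
      · exact absurd (by linear_combination (v1-v2) / 4) c00
      · linear_combination v0-w*hm
      · linear_combination v0-w*hm
      · exact absurd (by linear_combination (v1-v2) / 4) c11
    simp [c00] at this
    linear_combination -this
  subst hm hp
  have hy := y2cond H ha hb (by simp) (by simp) (G := fun x y => -2*x*(y-x)^2*F x y)
    (by intro x; have := hF x; fun_prop) (fun x y => by rw [hK, e5]; ring)
  simp at hy
  rcases hy.1 with h | h
  · refine H.ncl ![1,0,1] (by simp) ?_
    intro x y z e
    have e : x = - z := by simp [lin] at e; linear_combination e
    subst e
    have hb2 : b2 =1 := by linear_combination h1-h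
    subst h hb2
    have f1 : cub ![-1, -2 * -1,0,0, -1, -2 * -1,0,0,0,0] (-z) y z =0 := by simp [cub]; ring
    have f2 : cub ![0,0,1,0,0, -1-1 + -2 * -1,1,0,0,0] (-z) y z =0 := by simp [cub]; ring
    rw [f1, f2, cub_zero]; simp
  · exact noP4 H (by simp) (by simp; linear_combination h) (by simp; linear_combination h1-h) (by simp) (by simp)
lemma IIb0 {w s b0 b1 b2 e : ℂ} (hs : s ≠0) (hs1 : 1-s ≠0)
    (H : Bad ![w, s,0,0, w, s,0,0,0,0] ![b0, b1, b2,0,0, e,1,0,0,0] 0) : False := by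
  by_cases hD : e = w
  · subst hD
    have ha : N2 ![e, s,0,0, e, s,0,0,0,0] := by simp [N2]
    have hb : N2 ![b0, b1, b2,0,0, e,1,0,0,0] := by simp [N2]
    obtain ⟨r1, r2, hr⟩ := quadroots (s := s) (p := 2*e) (q := e^2) hs
    have e5 : ∀ x y, k5 ![e, s,0,0, e, s,0,0,0,0] ![b0, b1, b2,0,0, e,1,0,0,0] x y =
        x*(1-s)*y^2*(s*y^2+2*e*x*y+e^2*x^2) := by
      intro x y; simp [k5, q2, q2x, q2y]; ring
    obtain ⟨hroot, -⟩ := low5 H ha hb (by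
      by_contra! hc
      obtain ⟨-, -, -, -, c4, -⟩ := poly8 (c0 := 0) (c1 := 0)
        (c2 := (1-s)*e^2) (c3 := (1-s)*(2*e)) (c4 := (1-s)*s)
        (c5 := 0) (c6 := 0) (c7 := 0) (c8 := 0) (fun y => by
          have := hc 1 y
          rw [e5] at this; linear_combination this)
      simp [hs, hs1] at c4)
    have h0 := hroot 1 0 (by rw [e5]; ring) 0
    simp [cub] at h0
    subst h0
    have h := hr r1
    have g1 := hroot 1 r1 (by rw [e5]; linear_combination (1-s)*r1^2*h) 1
    have g0 := hroot 1 r1 (by rw [e5]; linear_combination (1-s)*r1^2*h) 0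
    simp [cub] at g0 g1
    have : (1-s)*r1^2 =0 := by linear_combination g1-g0
    simp [hs1] at this
    subst this
    have he : e =0 := by simpa using h
    subst he
    exact H.nocom2 (x0 := 1) (y0 := 0) (by simp) ha hb (by simp [q2]) (by simp [q2]) (by simp [cub]) (by simp [cub])
  · have hD : e-w ≠0 := sub_ne_zero.2 hD
    have hα : -(1-s) / (e-w) ≠0 := div_ne_zero (neg_ne_zero.2 hs1) hD
    have H' := H.diag0 (α := -(1-s) / (e-w)) (β := 1) (γ := -(1-s) / (e-w))
      (s := (-(1-s) / (e-w))⁻¹) hα one_ne_zero hα (inv_ne_zero hα)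
    refine IIb1 (w := w*(-(1-s) / (e-w))) (s := s) (b0 := b0*(-(1-s) / (e-w))^2)
      (b1 := b1*(-(1-s) / (e-w))) (b2 := b2) hs hs1 (H'.congr ?_ ?_ rfl)
    · generalize -(1-s) / (e-w) = α at *
      funext i; fin_cases i <;> simp [dg] <;> field_simp
    · have : e*(-(1-s) / (e-w)) = w*(-(1-s) / (e-w))-1+s := by field_simp; ring
      generalize -(1-s) / (e-w) = α at *
      funext i; fin_cases i <;> simp [dg] <;> try field_simp
      linear_combination this
lemma IIb {a b : Fin 10 → ℂ} (H : Bad a b 0) (ha : N2 a) (hb : N2 b) (h2 : a 2 =0) (h3 : a 3 =0)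
    (h6 : a 6 =0) (h4 : a 4 = a 0) (h5 : a 5 = a 1) (g3 : b 3 =0) (g6 : b 6 =1) : False := by
  by_cases s0 : a 5 =0
  · exact IIc H ha hb h2 h3 h6 g3 g6 (Or.inl s0)
  by_cases s1 : a 5 =1
  · exact IIc H ha hb h2 h3 h6 g3 g6 (Or.inr s1)
  obtain ⟨h7, h8, h9⟩ := ha
  obtain ⟨g7, g8, g9⟩ := hb
  have hs1 : 1-a 5 ≠0 := sub_ne_zero.2 (Ne.symm s1)
  obtain ⟨t, t2, ht⟩ := quadroots (s := 1-a 5) (p := b 5-a 4) (q := b 4) hs1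
  have ht := ht t
  have H' := (H.shear0 t).congr (a' := ![a 0+a 1*t, a 5,0,0, a 0+a 1*t, a 5,0,0,0,0])
      (b' := ![_, _, _,0,0, _,1,0,0,0]) (c' := 0) (by
        funext i; fin_cases i <;> simp [shr, h2, h3, h5, h6, h7, h8, h9, h4]) (by
        funext i; fin_cases i <;> simp [shr, h2, h3, h6, h7, h8, h9, g3, g6, g7, g8, g9]
        on_goal 4 => linear_combination ht
        all_goals rfl) rfl
  exact IIb0 s0 hs1 H'
lemma comroot {a b : Fin 10 → ℂ} (H : Bad a b 0) (hJ : ∃ x y, Jf a b x y ≠0) :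
    ∃ a' b', Bad a' b' 0 ∧ (∃ x y, Jf a' b' x y ≠0) ∧ a' 3 =0 ∧ b' 3 =0 ∧
      (N2 a → N2 b → N2 a' ∧ N2 b') := by
  by_contra hcon
  refine S2 H fun x0 y0 e1 e2 => ?_
  by_contra hxy
  apply hcon
  by_cases hx : x0 =0
  · subst hx
    have hy : y0 ≠0 := by simpa using hxy
    refine ⟨a, b, H, hJ, ?_, ?_, fun h1 h2 => ⟨h1, h2⟩⟩
    · simpa [cub, hy] using e1
    · simpa [cub, hy] using e2
  · have e1' : cub a 1 (y0 / x0) 0 =0 := by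
      simp only [cub] at e1 ⊢; field_simp; linear_combination e1
    have e2' : cub b 1 (y0 / x0) 0 =0 := by
      simp only [cub] at e2 ⊢; field_simp; linear_combination e2
    generalize y0 / x0 = t at e1' e2'
    refine ⟨_, _, (H.shear0 t).swap0, ?_, ?_, ?_, fun h1 h2 => ⟨?_, ?_⟩⟩
    · obtain ⟨x, y, h⟩ := hJ
      refine ⟨y-t*x, x, ?_⟩
      intro h'
      apply h
      simp [sw, shr, Jf, cubx, cuby] at h' ⊢
      linear_combination h'
    · simp [sw, shr]
      simp [cub] at e1' e2'
      linear_combination e2'-t*e1'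
    · simp [sw, shr]
      simp [cub] at e1'
      linear_combination e1'
    · exact ((h2.shr t).sub (h1.shr t) t).sw
    · exact (h1.shr t).sw
lemma ord2c {a b : Fin 10 → ℂ} (H : Bad a b 0) (hK : ∃ x y, KV a b x y 0 ≠0) (h3 : a 3 =0)
    (g3 : b 3 =0) : ∃ c d K, Gd a b 0 ![1,0, -c] ∧ Gd a b 0 ![1,0, -d] ∧
      FactL (fun l => (l 0 ≠0 ∨ l 1 ≠0) ∧ Gd a b 0 l) K ∧
      ∀ x y z, KV a b x y z = (x-c*z)*(x-d*z)*K x y z := by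
  have hF := H.KV_fact hK
  obtain ⟨c1, g1, K1, hK1, e1, f1, hf1, e1'⟩ := hF.pullr Gd_smul (x0 := 0) (y0 := 1) (u := 1) (v := 0)
    (by norm_num) 1 (f := fun x =>
      (a 0*x^2+a 1*x+a 2)*((a 0*x^2+a 1*x+a 2)*cubx b x 1 0
        + (b 0*x^2+b 1*x+b 2)*cuby b x 1 0) -
      (b 0*x^2+b 1*x+b 2)*((a 0*x^2+a 1*x+a 2)*cubx a x 1 0
        + (b 0*x^2+b 1*x+b 2)*cuby a x 1 0))
    (by simp only [cub, cubx, cuby]; fun_prop) (by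
      intro s
      simp only [KV, cub, cubx, cuby, h3, g3]; ring)
  obtain ⟨c2, g2, K2, hK2, e2, f2, hf2, e2'⟩ := hK1.pullr Gd_smul (by norm_num) 0 hf1 e1'
  refine ⟨c1, c2, K2, by simpa using g1, by simpa using g2, hK2, fun x y z => ?_⟩
  rw [e1, e2]; ring
lemma sqcond {a b : Fin 10 → ℂ} {c y : ℂ} {U V : ℂ → ℂ} (hU : Continuous U) (hV : Continuous V)
    (e1 : ∀ t, cub a (c+t) y 1 = t*U t) (e2 : ∀ t, cuby a (c+t) y 1 = t*V t)
    {G : (Fin 3 → ℂ) → Prop} {K : ℂ → ℂ → ℂ → ℂ} (hK : FactL G K)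
    (e : ∀ x y z, KV a b x y z = (x-c*z)*(x-c*z)*K x y z) :
    U 0*cub b c y 1*(cuby b c y 1-cubx a c y 1)-cub b c y 1^2*V 0 =0 := by
  have := pow_lt_zero (n := 1) (m := 2) (f := fun t =>
      U t*(t*U t*cubx b (c+t) y 1+cub b (c+t) y 1*cuby b (c+t) y 1)
        - cub b (c+t) y 1*(U t*cubx a (c+t) y 1+cub b (c+t) y 1*V t))
      (g := fun t => K (c+t) y 1)
      (by simp only [cub, cubx, cuby]; fun_prop)
      (hK.cont (by fun_prop) continuous_const continuous_const)
      (by norm_num) (fun t => by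
        have := e (c+t) y 1
        simp only [KV, e1, e2] at this; linear_combination this)
  simp only [add_zero] at this
  linear_combination this
lemma LemD {s2 s1 s0 t2 t1 t0 : ℂ} (h : ∀ y, (s2*y^2+s1*y+s0)*(t2*y^2+t1*y+t0) *
      (2*t2*y+t1-(s2*y^2+s1*y+s0))-(t2*y^2+t1*y+t0)^2*(2*s2*y+s1) =0)
    (hs : s2 ≠0) : t2 =0 ∧ t1 =0 ∧ t0 =0 := by
  obtain ⟨-, -, -, -, c4, c5, c6, -⟩ := poly8 (c0 := (t1-s0)*(s0*t0)-s1*t0^2)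
    (c1 := (2*t2-s1)*(s0*t0)+(t1-s0)*(s1*t0+s0*t1)-2*s2*t0^2-s1*(2*t1*t0))
    (c2 := -s2*(s0*t0)+(2*t2-s1)*(s1*t0+s0*t1)+(t1-s0)*(s2*t0+s1*t1+s0*t2)
      - 2*s2*(2*t1*t0)-s1*(2*t2*t0+t1^2))
    (c3 := -s2*(s1*t0+s0*t1)+(2*t2-s1)*(s2*t0+s1*t1+s0*t2)+(t1-s0)*(s2*t1+s1*t2)
      - 2*s2*(2*t2*t0+t1^2)-s1*(2*t2*t1))
    (c4 := -s2*(s2*t0+s1*t1+s0*t2)+(2*t2-s1)*(s2*t1+s1*t2)+(t1-s0)*(s2*t2)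
      - 2*s2*(2*t2*t1)-s1*t2^2)
    (c5 := -s2*(s2*t1+s1*t2)+(2*t2-s1)*(s2*t2)-2*s2*t2^2)
    (c6 := -s2*(s2*t2)) (c7 := 0) (c8 := 0) (fun y => by linear_combination h y)
  have h2 : t2 =0 := by simpa [hs] using c6
  subst h2
  have h1 : t1 =0 := by simpa [hs] using c5
  subst h1
  exact ⟨rfl, rfl, by simpa [hs] using c4⟩
lemma invx {a b : Fin 10 → ℂ} {c : ℂ} (ha : N2 a) (h3 : a 3 =0) (h : Gd a b 0 ![1,0, -c]) :
    c^2*(a 0*c+a 4) =0 ∧ c*(a 1*c+a 5) =0 ∧ a 2*c+a 6 =0 := by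
  obtain ⟨h7, h8, h9⟩ := ha
  obtain ⟨i, j, k, -⟩ := poly8 (c0 := c^2*(a 0*c+a 4)) (c1 := c*(a 1*c+a 5))
    (c2 := a 2*c+a 6) (c3 := 0) (c4 := 0) (c5 := 0) (c6 := 0) (c7 := 0) (c8 := 0) (fun y => by
      have := h.2 c y 1 (by simp [lin])
      simp [cub, h3, h7, h8, h9] at this
      linear_combination this)
  exact ⟨i, j, k⟩
lemma NU2d {a b : Fin 10 → ℂ} (H : Bad a b 0) (ha : N2 a) (hb : N2 b) (h2 : a 2 =0) (h3 : a 3 =0)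
    (g3 : b 3 =0) {d : ℂ} (hd : d ≠0) (hG : Gd a b 0 ![1,0, -d]) : False := by
  obtain ⟨i, j, k⟩ := invx ha h3 hG
  simp [hd] at i j
  have h6 : a 6 =0 := by simpa [h2] using k
  have g6 : b 6 ≠0 := fun g6 => H.nocom2 (x0 := 0) (y0 := 1) (by simp) ha hb (by simp [q2, h6])
    (by simp [q2, g6]) (by simp [cub, h3]) (by simp [cub, g3])
  obtain ⟨h7, h8, h9⟩ := ha
  obtain ⟨g7, g8, g9⟩ := hb
  have hd' := neg_ne_zero.2 hd
  refine IIb (H.diag0 (α := -d) (β := 1) (γ := 1) (s := (b 6)⁻¹) hd' one_ne_zero one_ne_zero (inv_ne_zero g6))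
    ⟨?_, ?_, ?_⟩ ⟨?_, ?_, ?_⟩ ?_ ?_ ?_ ?_ ?_ ?_ ?_
  all_goals simp [dg, h2, h3, h6, h7, h8, h9, g3, g6, g7, g8, g9]
  · field_simp; exact Or.inl (by linear_combination i)
  · field_simp; linear_combination j
lemma NU2A' {a b : Fin 10 → ℂ} (H : Bad a b 0) (ha : N2 a) (hb : N2 b) (hJ : ∃ x y, Jf a b x y ≠0)
    (h3 : a 3 =0) (g3 : b 3 =0) : False := by
  have hK := H.KV_nz hJ
  obtain ⟨c, d, K, hc, hd, hF, e⟩ := ord2c H hK h3 g3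
  obtain ⟨i, j, k⟩ := invx ha h3 hc
  obtain ⟨i', j', k'⟩ := invx ha h3 hd
  obtain ⟨a7, a8, a9⟩ := id ha
  obtain ⟨b7, b8, b9⟩ := id hb
  have c6 : a 6 =0 → b 6 ≠0 := fun h6 g6 => H.nocom2 (x0 := 0) (y0 := 1) (by simp) ha hb (by simp [q2, h6])
    (by simp [q2, g6]) (by simp [cub, h3]) (by simp [cub, g3])
  by_cases hcd : c = d
  · subst hcd
    by_cases c0 : c =0
    · subst c0
      have h6 : a 6 =0 := by simpa using k
      have g6 := c6 h6
      have key : ∀ y, (a 2*y^2+a 5*y)*(b 6*y^2)*(2*b 6*y-(a 2*y^2+a 5*y))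
          - (b 6*y^2)^2*(2*a 2*y+a 5) =0 := by
        intro y
        have := sqcond (a := a) (b := b) (c := 0) (y := y)
          (U := fun t => a 0*t^2+a 1*t*y+a 2*y^2+a 4*t+a 5*y)
          (V := fun t => a 1*t+2*a 2*y+a 5) (by fun_prop) (by fun_prop)
          (fun t => by simp [cub, h3, h6, a7, a8, a9]; ring)
          (fun t => by simp [cuby, h3, h6, a8]; ring) hF e
        simp [cub, cubx, cuby, g3, a7, b7, b8, b9] at this
        linear_combination this
      obtain ⟨-, -, -, -, f4, -, f6, -⟩ := poly8 (c0 := 0) (c1 := 0) (c2 := 0) (c3 := 0)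
        (c4 := b 6*(a 5*(b 6-a 5))) (c5 := -2*b 6*a 2*a 5) (c6 := - b 6*a 2^2) (c7 := 0) (c8 := 0)
        (fun y => by linear_combination key y)
      have h2 : a 2 =0 := by simpa [g6] using f6
      have h5 : a 5 =0 ∨ b 6-a 5 =0 := by simpa [g6] using f4
      refine IIc (H.diag0 (α := 1) (β := 1) (γ := 1) (s := (b 6)⁻¹) one_ne_zero one_ne_zero one_ne_zero (inv_ne_zero g6))
        ⟨?_, ?_, ?_⟩ ⟨?_, ?_, ?_⟩ ?_ ?_ ?_ ?_ ?_ ?_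
      all_goals simp [dg, h2, h3, h6, a7, a8, a9, g3, g6, b7, b8, b9]
      rcases h5 with h5 | h5
      · exact Or.inl h5
      · right; field_simp; linear_combination -h5
    · by_cases h2 : a 2 =0
      · exact NU2d H ha hb h2 h3 g3 c0 hc
      simp [c0] at i j
      have key := LemD (s2 := a 2) (s1 := a 1*c) (s0 := a 0*c^2) (t2 := b 2*c+b 6)
        (t1 := b 1*c^2+b 5*c) (t0 := b 0*c^3+b 4*c^2) (fun y => by
          have := sqcond (a := a) (b := b) (c := c) (y := y)
            (U := fun t => a 0*(c+t)^2+a 1*(c+t)*y+a 2*y^2)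
            (V := fun t => a 1*(c+t)+2*a 2*y) (by fun_prop) (by fun_prop)
            (fun t => by
              simp [cub, h3, a7, a8, a9]
              linear_combination (c+t)^2*i+(c+t)*y*j+y^2*k)
            (fun t => by simp [cuby, h3, a8]; linear_combination (c+t)*j+2*y*k) hF e
          simp [cub, cubx, cuby, g3, a7, b7, b8, b9] at this
          linear_combination this+(a 0*c^2+a 1*c*y+a 2*y^2)*(b 0*c^3+b 1*c^2*y+b 2*c*y^2
            + b 4*c^2+b 5*c*y+b 6*y^2)*(2*c*i+y*j)) h2
      obtain ⟨f2, f1, f0⟩ := key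
      refine H.ncl ![1,0, -c] (by simp) ?_
      intro x y z h
      have h : x = c*z := by simp [lin] at h; linear_combination h
      subst h
      have z1 : cub a (c*z) y z =0 := by
        simp only [cub, h3, a7, a8, a9]
        linear_combination c^2*z^3*i+c*z^2*y*j+z*y^2*k
      have z2 : cub b (c*z) y z =0 := by
        simp only [cub, g3, b7, b8, b9]
        linear_combination z^3*f0+z^2*y*f1+z*y^2*f2
      rw [z1, z2, cub_zero]; simp
  · have h2 : a 2 =0 := by
      have : a 2*(c-d) =0 := by linear_combination k-k'
      simpa [sub_ne_zero.2 hcd] using this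
    by_cases c0 : c =0
    · exact NU2d H ha hb h2 h3 g3 (fun h => hcd (by rw [c0, h])) hd
    · exact NU2d H ha hb h2 h3 g3 c0 hc
lemma NU2A {a b : Fin 10 → ℂ} (H : Bad a b 0) (ha : N2 a) (hb : N2 b) (hJ : ∃ x y, Jf a b x y ≠0) :
    False := by
  obtain ⟨a', b', H', hJ', h3, g3, hN⟩ := comroot H hJ
  exact NU2A' H' (hN ha hb).1 (hN ha hb).2 hJ' h3 g3
lemma Bad.noA {a b : Fin 10 → ℂ} (H : Bad a b 0) (h : ∀ i, a i =0) : False := by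
  obtain ⟨x, y, z, e⟩ := H.E_ne
  apply e
  rw [ExtV_zero]
  simp [KV, cub, cuby, h]
lemma ratio3 {p0 p1 p2 f1 f2 f3 : ℂ} (hp : ¬ (p0 =0 ∧ p1 =0 ∧ p2 =0)) (e1 : p0*f2 = p1*f1)
    (e2 : p0*f3 = p2*f1) (e3 : p1*f3 = p2*f2) : ∃ c, f1 = c*p0 ∧ f2 = c*p1 ∧ f3 = c*p2 := by
  by_cases h0 : p0 =0
  · by_cases h1 : p1 =0
    · have h2 : p2 ≠0 := by tauto
      refine ⟨f3 / p2, ?_, ?_, ?_⟩ <;> field_simp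
      · linear_combination -e2
      · linear_combination -e3
    · refine ⟨f2 / p1, ?_, ?_, ?_⟩ <;> field_simp
      · linear_combination -e1
      · linear_combination e3
  · refine ⟨f1 / p0, ?_, ?_, ?_⟩ <;> field_simp
    · linear_combination e1
    · linear_combination e2
lemma qdep {p0 p1 p2 f0 f1 f2 f3 : ℂ} (hp : ¬ (p0 =0 ∧ p1 =0 ∧ p2 =0))
    (h : ∀ y, (p0+p1*y+p2*y^2)*(3*f0+2*f1*y+f2*y^2) =
      (2*p0+p1*y)*(f0+f1*y+f2*y^2+f3*y^3)) :
    f0 =0 ∧ ∃ c, f1 = c*p0 ∧ f2 = c*p1 ∧ f3 = c*p2 := by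
  obtain ⟨c0, c1, c2, c3, c4, -⟩ := poly8 (c0 := p0*f0) (c1 := 2*p1*f0)
    (c2 := -p0*f2+p1*f1+3*p2*f0) (c3 := 2*p2*f1-2*p0*f3) (c4 := p2*f2-p1*f3)
    (c5 := 0) (c6 := 0) (c7 := 0) (c8 := 0) (fun y => by linear_combination h y)
  have hf : f0 =0 := by
    by_contra hf
    simp [hf] at c0 c1
    subst c0 c1
    simp [hf] at c2
    exact hp ⟨rfl, rfl, c2⟩
  subst hf
  refine ⟨rfl, ratio3 hp ?_ ?_ ?_⟩
  · linear_combination -c2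
  · linear_combination -c3 / 2
  · linear_combination -c4
lemma q2root (a : Fin 10 → ℂ) : ∃ x y, ¬ (x =0 ∧ y =0) ∧ q2 a x y =0 := by
  by_cases h : a 6 =0
  · exact ⟨0,1, by simp, by simp [q2, h]⟩
  · obtain ⟨r, r2, hr⟩ := quadroots (s := a 6) (p := a 5) (q := a 4) h
    refine ⟨1, r, by simp, ?_⟩
    have := hr r
    rw [q2]; linear_combination this
lemma NU2Bm1 {a b : Fin 10 → ℂ} (H : Bad a b 0) (ha : N2 a) (hb : N2 b) (h0 : a 0 =0) (h1 : a 1 =0)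
    (h2 : a 2 =0) (h3 : a 3 =0) {μ : ℂ} (hμ : μ ≠0) (hi : InvL a b 0 ![0, μ,1]) : False := by
  obtain ⟨a7, a8, a9⟩ := id ha
  obtain ⟨b7, b8, b9⟩ := id hb
  have key : ∀ x y, cub b x y (-μ*y) =0 := by
    intro x y
    have := hi x y (-μ*y) (by simp [lin])
    simpa [cub_zero, hμ] using this
  obtain ⟨c0, c1, c2, c3, -⟩ := poly8 (c0 := b 0) (c1 := b 1-μ*b 4) (c2 := b 2-μ*b 5) (c3 := b 3-μ*b 6)
    (c4 := 0) (c5 := 0) (c6 := 0) (c7 := 0) (c8 := 0) (fun y => by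
      have := key 1 y
      simp only [cub, b7, b8, b9] at this; linear_combination this)
  have H' := (lineoff H ha hb (by simp [N3, N2]) (by simp) hi).congr
    (a' := ![-μ*b 4, -μ*(a 4+b 5), -μ*(a 5+b 6), -μ*a 6, a 4, a 5, a 6,0,0,0])
    (b' := ![0, -μ*b 4, -μ*b 5, -μ*b 6, b 4, b 5, b 6,0,0,0]) (c' := 0)
    (by funext i; fin_cases i <;> simp [h0, h1, h2, h3] <;> ring)
    (by
      funext i; fin_cases i <;> simp [c0]
      · linear_combination c1
      · linear_combination c2
      · linear_combination c3) rfl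
  by_cases hJ : ∃ x y, Jf ![-μ*b 4, -μ*(a 4+b 5), -μ*(a 5+b 6), -μ*a 6, a 4, a 5, a 6,0,0,0]
      ![0, -μ*b 4, -μ*b 5, -μ*b 6, b 4, b 5, b 6,0,0,0] x y ≠0
  · exact NU2A H' (by simp [N2]) (by simp [N2]) hJ
  push Not at hJ
  obtain ⟨m01, -, -, m12, m13, m23⟩ := minors (fun t => hJ 1 t)
  simp [hμ] at m01
  simp [hμ, m01] at m12 m13
  simp at m23
  have m23 : (a 5+b 6)*b 6 = a 6*b 5 := by
    apply mul_left_cancel₀ (mul_ne_zero hμ hμ); linear_combination m23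
  by_cases hB : b 5 =0 ∧ b 6 =0
  · obtain ⟨x, y, h⟩ := H.P_ne
    apply h
    rw [hB.1] at c2
    rw [hB.2] at c3
    rw [m01] at c1
    simp only [mul_zero, sub_zero] at c1 c2 c3
    simp [Pf, cub, h0, h1, h2, h3, c0, c1, c2, c3]
  have h4 : a 4+b 5 =0 := by tauto
  refine H.nocom2 (x0 := b 6) (y0 := -b 5) (by simpa [and_comm] using hB) ha hb ?_ ?_ ?_ ?_
  · simp only [q2]; linear_combination b 6^2*h4-b 5*m23
  · simp only [q2, m01]; ring
  · simp [cub, h0, h1, h2, h3]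
  · rw [m01] at c1
    simp only [cub, c0]
    linear_combination b 6^2*(-b 5)*c1+b 6*b 5^2*c2+(-b 5)^3*c3
lemma NU2Bm {a b : Fin 10 → ℂ} (H : Bad a b 0) (ha : N2 a) (hb : N2 b) (h0 : a 0 =0) (h1 : a 1 =0)
    (h2 : a 2 =0) (h3 : a 3 =0) {m : Fin 3 → ℂ} (hm : m 2 =1) (hm0 : m 0 ≠0 ∨ m 1 ≠0)
    (hi : InvL a b 0 m) : False := by
  obtain ⟨a7, a8, a9⟩ := id ha
  by_cases h : m 1 =0
  · have hm0 : m 0 ≠0 := by tauto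
    obtain ⟨c0, c1, c2, -⟩ := poly8 (c0 := a 4) (c1 := a 5) (c2 := a 6)
      (c3 := 0) (c4 := 0) (c5 := 0) (c6 := 0) (c7 := 0) (c8 := 0) (fun y => by
        have := hi 1 y (-m 0) (by simp [lin, h, hm])
        simp only [cub_zero, h] at this
        have : m 0*cub a 1 y (-m 0) =0 := by linear_combination this
        simp [cub, hm0, h0, h1, h2, h3, a7, a8, a9] at this
        linear_combination this)
    refine H.noA fun i => ?_
    fin_cases i <;> simp [*]
  · refine NU2Bm1 (H.shear0 (-m 0 / m 1)) (ha.shr _) ((hb.shr _).sub (ha.shr _) _) ?_ ?_ ?_ ?_ h ?_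
    · simp [shr, h0, h1, h2, h3]
    · simp [shr, h1, h2, h3]
    · simp [shr, h2, h3]
    · simp [shr, h3]
    · intro x y z e
      have e' := hi x (y + -m 0 / m 1*x) z (by
        simp [lin] at e; simp [lin, hm]; field_simp; linear_combination e)
      simp [cub_zero] at e'
      simp [cub_zero, cub_sub, cub_shr]
      have : m 1*(-m 0 / m 1) = -m 0 := by field_simp
      right
      apply mul_left_cancel₀ h
      linear_combination e'-cub a x (y + -m 0 / m 1*x) z*this
lemma NU2dich {a b : Fin 10 → ℂ} (H : Bad a b 0) (ha : N2 a) (hb : N2 b) (h0 : a 0 =0) (h1 : a 1 =0)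
    (h2 : a 2 =0) (h3 : a 3 =0) :
    ((∀ x y, k6 a b x y =0) ∨ (∀ x y, k7 a b x y =0)) ∧
    ((∀ x y, k5 a b x y =0) ∨ ((∀ x y, k6 a b x y =0) ∧ (∀ x y, k7 a b x y =0))) := by
  by_cases h5 : ∀ x y, k5 a b x y =0
  · refine ⟨?_, Or.inl h5⟩
    by_cases h6 : ∀ x y, k6 a b x y =0
    · exact Or.inl h6
    right
    push Not at h6
    obtain ⟨-, F, -, hK, hm⟩ := low6 H ha hb h5 h6
    rcases hm with ⟨m, hm, hm0, hi⟩ | hm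
    · exact (NU2Bm H ha hb h0 h1 h2 h3 hm hm0 hi).elim
    intro x y
    have key : ∀ t, t ≠0 → k7 a b x y+t*KV a b x y 0 =0 := by
      intro t ht
      have := KV_scale ha hb t x y
      rw [hK, hm, h5] at this
      have e : k6 a b (t*x) (t*y) = t^6*k6 a b x y := by
        simp only [k6, q2, q2x, q2y, cub, cubx, cuby]; ring
      rw [e] at this
      apply mul_left_cancel₀ (pow_ne_zero 7 ht); linear_combination -this
    have e1 := key 1 one_ne_zero
    have e2 := key (-1) (by norm_num)
    linear_combination (e1+e2) / 2
  · push Not at h5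
    obtain ⟨-, F, -, hK, hm⟩ := low5 H ha hb h5
    rcases hm with ⟨m, hm, hm0, hi⟩ | hm
    · exact (NU2Bm H ha hb h0 h1 h2 h3 hm hm0 hi).elim
    have := hom5 ha hb (fun x y => by rw [hK, hm, mul_one])
    exact ⟨Or.inl fun x y => (this x y).1, Or.inr ⟨fun x y => (this x y).1, fun x y => (this x y).2.1⟩⟩
lemma nz_q2 {a : Fin 10 → ℂ} (h : ¬ (a 4 =0 ∧ a 5 =0 ∧ a 6 =0)) : ∃ x y, q2 a x y ≠0 := by
  by_contra! hc
  obtain ⟨c0, c1, c2, -⟩ := poly8 (c0 := a 4) (c1 := a 5) (c2 := a 6)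
      (c3 := 0) (c4 := 0) (c5 := 0) (c6 := 0) (c7 := 0) (c8 := 0) (fun y => by
        have := hc 1 y
        simp only [q2] at this; linear_combination this)
  exact h ⟨c0, c1, c2⟩
lemma mul_zero' {f g : ℂ → ℂ → ℂ} (h : ∀ x y, f x y*g x y =0)
    (hf : ∀ x0 y0 u v, Differentiable ℂ fun s : ℂ => f (x0+s*u) (y0+s*v))
    (hg : ∀ x0 y0 u v, Differentiable ℂ fun s : ℂ => g (x0+s*u) (y0+s*v)) :
    (∀ x y, f x y =0) ∨ (∀ x y, g x y =0) := by
  by_contra! hc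
  obtain ⟨x, y, e⟩ := nz_mul hf hg hc.1 hc.2
  exact e (h x y)
lemma NU2Bs {a b : Fin 10 → ℂ} (H : Bad a b 0) (ha : N2 a) (hb : N2 b) (h0 : a 0 =0) (h1 : a 1 =0)
    (h2 : a 2 =0) (h3 : a 3 =0) (g4 : b 4 =0) (g5 : b 5 =0) (g6 : b 6 =0) : False := by
  have hA : ¬ (a 4 =0 ∧ a 5 =0 ∧ a 6 =0) := by
    rintro ⟨e4, e5, e6⟩
    obtain ⟨a7, a8, a9⟩ := id ha
    refine H.noA fun i => ?_
    fin_cases i <;> simp [*]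
  obtain ⟨x0, y0, hxy, e0⟩ := q2root a
  have hq := nz_q2 hA
  have dq : ∀ x0 y0 u v, Differentiable ℂ fun s : ℂ => q2 a (x0+s*u) (y0+s*v) := by
    intros; simp only [q2]; fun_prop
  suffices h : cub b x0 y0 0 =0 by
    exact H.nocom2 hxy ha hb e0 (by simp [q2, g4, g5, g6]) (by simp [cub, h0, h1, h2, h3]) h
  rcases (NU2dich H ha hb h0 h1 h2 h3).1 with h | h
  · have := (mul_zero' (f := fun x y => q2 a x y) (g := fun x y => q2 a x y*cubx b x y 0-q2x a x y*cub b x y 0)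
      (fun x y => by
        have := h x y
        simp only [k6, q2, q2x, q2y, cub, cubx, cuby, h0, h1, h2, h3, g4, g5, g6] at this ⊢
        linear_combination this) dq (by intros; simp only [q2, q2x, cub, cubx]; fun_prop)).resolve_left
          (by push Not; exact hq)
    obtain ⟨f0, c, f1, f2, f3⟩ := qdep (f0 := b 0) (f1 := b 1) (f2 := b 2) (f3 := b 3) hA (fun y => by
      have := this 1 y
      simp only [q2, q2x, cub, cubx] at this; linear_combination this)
    rw [q2] at e0
    simp only [cub, f0, f1, f2, f3]
    linear_combination c*y0*e0
  · have := (mul_zero' (f := fun x y => cub b x y 0) (g := fun x y => q2 a x y*cuby b x y 0-q2y a x y*cub b x y 0)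
      (fun x y => by
        have := h x y
        simp only [k7, q2, q2x, q2y, cub, cubx, cuby, h0, h1, h2, h3, g4, g5, g6] at this ⊢
        linear_combination this) (by intros; simp only [cub]; fun_prop)
          (by intros; simp only [q2, q2y, cub, cuby]; fun_prop))
    rcases this with this | this
    · exact this _ _
    obtain ⟨f0, c, f1, f2, f3⟩ := qdep (p0 := a 6) (p1 := a 5) (p2 := a 4)
      (f0 := b 3) (f1 := b 2) (f2 := b 1) (f3 := b 0) (by tauto) (fun y => by
      have := this y 1
      simp only [q2, q2y, cub, cuby] at this; linear_combination this)
    rw [q2] at e0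
    simp only [cub, f0, f1, f2, f3]
    linear_combination c*x0*e0
lemma k5_fac (a b : Fin 10 → ℂ) (x y : ℂ) : k5 a b x y = (x*q2 b x y-y*q2 a x y) *
    ((q2x a x y*q2y b x y-q2y a x y*q2x b x y) / 2) := by
  simp only [k5, q2, q2x, q2y]; ring
lemma k5_zero {a b : Fin 10 → ℂ} (h : ∀ x y, k5 a b x y =0) :
    (b 4 =0 ∧ b 5 = a 4 ∧ b 6 = a 5 ∧ a 6 =0) ∨
    (a 4*b 5 = a 5*b 4 ∧ a 4*b 6 = a 6*b 4 ∧ a 5*b 6 = a 6*b 5) := by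
  rcases mul_zero' (f := fun x y => x*q2 b x y-y*q2 a x y) (g := fun x y =>
    ((q2x a x y*q2y b x y-q2y a x y*q2x b x y) / 2)) (fun x y => by rw [← k5_fac, h])
    (by intros; simp only [q2]; fun_prop) (by intros; simp only [q2x, q2y]; fun_prop) with h | h
  · left
    obtain ⟨c0, c1, c2, c3, -⟩ := poly8 (c0 := b 4) (c1 := b 5-a 4) (c2 := b 6-a 5)
      (c3 := -a 6) (c4 := 0) (c5 := 0) (c6 := 0) (c7 := 0) (c8 := 0) (fun y => by
        have := h 1 y
        simp only [q2] at this; linear_combination this)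
    exact ⟨c0, by linear_combination c1, by linear_combination c2, by linear_combination -c3⟩
  · right
    obtain ⟨c0, c1, c2, -⟩ := poly8 (c0 := a 4*b 5-a 5*b 4) (c1 := 2*(a 4*b 6-a 6*b 4)) (c2 := a 5*b 6-a 6*b 5)
      (c3 := 0) (c4 := 0) (c5 := 0) (c6 := 0) (c7 := 0) (c8 := 0) (fun y => by
        have := h 1 y
        simp only [q2x, q2y] at this; linear_combination this)
    exact ⟨by linear_combination c0, by linear_combination c1 / 2, by linear_combination c2⟩
lemma NU2B' {a b : Fin 10 → ℂ} (H : Bad a b 0) (ha : N2 a) (hb : N2 b) (h0 : a 0 =0) (h1 : a 1 =0)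
    (h2 : a 2 =0) (h3 : a 3 =0) : False := by
  have hA : ¬ (a 4 =0 ∧ a 5 =0 ∧ a 6 =0) := by
    rintro ⟨e4, e5, e6⟩
    obtain ⟨a7, a8, a9⟩ := id ha
    refine H.noA fun i => ?_
    fin_cases i <;> simp [*]
  by_cases hJ : (a 4*b 5 = a 5*b 4 ∧ a 4*b 6 = a 6*b 4 ∧ a 5*b 6 = a 6*b 5)
  · obtain ⟨t, t1, t2, t3⟩ := ratio3 (f1 := b 4) (f2 := b 5) (f3 := b 6) hA hJ.1 hJ.2.1 hJ.2.2
    refine NU2Bs (H.shear0 t) (ha.shr _) ((hb.shr _).sub (ha.shr _) _) ?_ ?_ ?_ ?_ ?_ ?_ ?_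
    all_goals simp [shr, h0, h1, h2, h3, t1, t2, t3]
    all_goals ring
  have hq := nz_q2 hA
  have dq : ∀ x0 y0 u v, Differentiable ℂ fun s : ℂ => q2 a (x0+s*u) (y0+s*v) := by
    intros; simp only [q2]; fun_prop
  have hg : ∃ x y, cub b x y 0 ≠0 := by
    obtain ⟨x, y, h⟩ := H.P_ne
    refine ⟨x, y, fun h' => h ?_⟩
    rw [Pf, h']; simp [cub, h0, h1, h2, h3]
  obtain ⟨d1, d2⟩ := NU2dich H ha hb h0 h1 h2 h3
  by_cases h7 : ∀ x y, k7 a b x y =0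
  · have := (mul_zero' (f := fun x y => cub b x y 0) (g := fun x y => q2 a x y*cuby b x y 0-q2y a x y*cub b x y 0)
      (fun x y => by
        have := h7 x y
        simp only [k7, q2, q2x, q2y, cub, cubx, cuby, h0, h1, h2, h3] at this ⊢
        linear_combination this) (by intros; simp only [cub]; fun_prop)
          (by intros; simp only [q2, q2y, cub, cuby]; fun_prop)).resolve_left (by push Not; exact hg)
    obtain ⟨f0, κ, f1, f2, f3⟩ := qdep (p0 := a 6) (p1 := a 5) (p2 := a 4)
      (f0 := b 3) (f1 := b 2) (f2 := b 1) (f3 := b 0) (by tauto) (fun y => by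
      have := this y 1
      simp only [q2, q2y, cub, cuby] at this; linear_combination this)
    have hκ : κ ≠0 := by
      rintro rfl
      obtain ⟨x, y, h⟩ := hg
      apply h
      simp [cub, f0, f1, f2, f3]
    have fin : ∀ x y, ¬ (x =0 ∧ y =0) → q2 a x y =0 → q2 b x y ≠0 := by
      intro x y hxy e1 e2
      refine H.nocom2 hxy ha hb e1 e2 (by simp [cub, h0, h1, h2, h3]) ?_
      rw [q2] at e1
      simp only [cub, f0, f1, f2, f3]
      linear_combination κ*x*e1
    by_cases h5 : ∀ x y, k5 a b x y =0
    · obtain ⟨e1, e2, e3, e4⟩ := (k5_zero h5).resolve_right hJ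
      refine fin (a 5) (-a 4) ?_ ?_ ?_
      · rintro ⟨i, j⟩; exact hA ⟨by linear_combination -j, i, e4⟩
      · rw [q2, e4]; ring
      · rw [q2, e1, e2, e3]; ring
    · have h6 := (d2.resolve_left h5).1
      have := (mul_zero' (f := fun x y => q2 a x y) (g := fun x y => q2 a x y^2+x*(q2 a x y*q2y b x y-q2 b x y*q2y a x y))
        (fun x y => by
          have := h6 x y
          apply mul_left_cancel₀ hκ
          simp only [k6, q2, q2x, q2y, cub, cubx, cuby, h0, h1, h2, h3, f0, f1, f2, f3] at this ⊢
          linear_combination this) dq (by intros; simp only [q2, q2y]; fun_prop)).resolve_left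
            (by push Not; exact hq)
      obtain ⟨i4, i3, i2, i1, i0, -⟩ := poly8 (c0 := a 4^2+a 4*b 5-a 5*b 4)
        (c1 := 2*a 4*a 5+2*(a 4*b 6-a 6*b 4))
        (c2 := a 5^2+2*a 4*a 6+a 5*b 6-a 6*b 5)
        (c3 := 2*a 5*a 6) (c4 := a 6^2) (c5 := 0) (c6 := 0) (c7 := 0) (c8 := 0) (fun y => by
          have := this 1 y
          simp only [q2, q2y] at this; linear_combination this)
      have h6 : a 6 =0 := by simpa using i0
      rw [h6] at i3 i2 i1
      by_cases h5 : a 5 =0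
      · have h4 : a 4 ≠0 := by tauto
        refine fin 0 1 (by simp) (by simp [q2, h6]) ?_
        simp [h5, h4] at i3
        simp [q2, i3]
      · refine fin (a 5) (-a 4) (by simp [h5]) (by rw [q2, h6]; ring) ?_
        rw [q2]
        apply mul_left_cancel₀ h5
        linear_combination -a 5^2*i4+a 4^2*i2
  · have h6 := d1.resolve_right h7
    have h5 := d2.resolve_right (fun h => h7 h.2)
    obtain ⟨e1, e2, e3, e4⟩ := (k5_zero h5).resolve_right hJ
    have hl : ∃ x y,2*x*(a 4*x+a 5*y)^2 ≠0 := by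
      by_contra! hc
      obtain ⟨c0, c1, c2, -⟩ := poly8 (c0 := 2*a 4^2) (c1 := 4*a 4*a 5) (c2 := 2*a 5^2)
        (c3 := 0) (c4 := 0) (c5 := 0) (c6 := 0) (c7 := 0) (c8 := 0) (fun y => by
          linear_combination hc 1 y)
      simp at c0 c2
      exact hA ⟨c0, c2, e4⟩
    obtain ⟨x, y, h⟩ := nz_mul (f := fun x y => 2*x*(a 4*x+a 5*y)^2) (g := fun x y => cub b x y 0)
      (by intros; fun_prop) (by intros; simp only [cub]; fun_prop) hl hg
    apply h
    have := h6 x y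
    simp only [k6, q2, q2x, q2y, cub, cubx, cuby, h0, h1, h2, h3, e1, e2, e3, e4] at this ⊢
    linear_combination this
lemma NU2AB {a b : Fin 10 → ℂ} (H : Bad a b 0) (ha : N2 a) (hb : N2 b) : False := by
  by_cases hJ : ∃ x y, Jf a b x y ≠0
  · exact NU2A H ha hb hJ
  push Not at hJ
  rcases depB (fun t => hJ 1 t) with ⟨g0, g1, g2, g3⟩ | ⟨t, ht⟩
  · exact NU2B' H.swap0 hb.sw ha.sw (by simp [sw, g3]) (by simp [sw, g2]) (by simp [sw, g1]) (by simp [sw, g0])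
  · have t0 := ht 0
    have t1 := ht 1
    have t2 := ht 2
    have t3 := ht 3
    have c0 : Fin.castLE (show 4 ≤ 10 by norm_num) 0 =0 := rfl
    have c1 : Fin.castLE (show 4 ≤ 10 by norm_num) 1 =1 := rfl
    have c2 : Fin.castLE (show 4 ≤ 10 by norm_num) 2 =2 := rfl
    have c3 : Fin.castLE (show 4 ≤ 10 by norm_num) 3 =3 := rfl
    rw [c0] at t0
    rw [c1] at t1
    rw [c2] at t2
    rw [c3] at t3
    refine NU2B' (H.swap0.shear0 t).swap0 (((ha.sw.shr t).sub (hb.sw.shr t) t).sw) (hb.sw.shr t).sw ?_ ?_ ?_ ?_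
    · rw [sw]; exact t3
    · rw [sw]; exact t2
    · rw [sw]; exact t1
    · rw [sw]; exact t0
lemma NU2off {a b c : Fin 10 → ℂ} (H : Bad a b c) (ha : N2 a) (hb : N2 b) (hc : N3 c) :
    ∀ x y z, ExtV a b c x y z = ExtV a b c x y 0 := by
  rcases H.dich with ⟨m, hm, hi⟩ | ⟨-, hE⟩
  · exact (NU2AB (lineoff H ha hb hc hm hi) (by simp [N2]) (by simp [N2])).elim
  · exact hE
lemma NU2z {a c : Fin 10 → ℂ} (H : Bad a 0 c) (ha : N2 a) (hc : N3 c)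
    (hq : ¬ (a 4 =0 ∧ a 5 =0 ∧ a 6 =0)) : False := by
  have hE := NU2off H ha (by simp [N2]) hc
  have hN : ∀ x y z, ExtV a 0 c x y z = ExtV a 0 c x y 0-y*(
      z^2*(q2 a x y*(q2 a x y*cubx c x y 0-cub c x y 0*q2x a x y))
      + z*(2*q2 a x y*cub a x y 0*cubx c x y 0-cub c x y 0*(q2 a x y*cubx a x y 0+cub a x y 0*q2x a x y))) := by
    intro x y z
    obtain ⟨h7, h8, h9⟩ := ha
    obtain ⟨k4, k5, k6, k7, k8, k9⟩ := hc
    simp only [ExtV, cub, cubx, cuby, cubz, q2, q2x, h7, h8, h9, k4, k5, k6, k7, k8, k9, Pi.zero_apply]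
    ring
  have hz : ∀ x y, y*(q2 a x y*(q2 a x y*cubx c x y 0-cub c x y 0*q2x a x y)) =0 ∧
      y*(2*q2 a x y*cub a x y 0*cubx c x y 0-cub c x y 0*(q2 a x y*cubx a x y 0+cub a x y 0*q2x a x y)) =0 := by
    intro x y
    have h1 := hN x y 1
    have h2 := hN x y (-1)
    rw [hE x y] at h1 h2
    constructor
    · linear_combination (h1+h2) / 2
    · linear_combination (h1-h2) / 2
  have dq : ∀ x0 y0 u v, Differentiable ℂ fun s : ℂ => q2 a (x0+s*u) (y0+s*v) := by
    intros; simp only [q2]; fun_prop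
  have nq := nz_q2 hq
  have hy : ∀ x y, q2 a x y*y*(q2 a x y*cubx c x y 0-cub c x y 0*q2x a x y) =0 := by
    intro x y; linear_combination (hz x y).1
  have nqy : ∃ x y, q2 a x y*y ≠0 := nz_mul (f := fun x y => q2 a x y) (g := fun x y => y) dq (by intros; fun_prop) nq ⟨0,1, one_ne_zero⟩
  have e2 := (mul_zero' hy (by intros; simp only [q2]; fun_prop)
    (by intros; simp only [q2, q2x, cub, cubx]; fun_prop)).resolve_left (by push Not; exact nqy)
  obtain ⟨c0, s, c1, c2, c3⟩ := qdep (f0 := c 0) (f1 := c 1) (f2 := c 2) (f3 := c 3) hq (fun y => by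
    have := e2 1 y
    simp only [q2, q2x, cub, cubx] at this
    linear_combination this)
  by_cases hs : s =0
  · obtain ⟨k4, k5, k6, k7, k8, k9⟩ := hc
    have : c =0 := by funext i; fin_cases i <;> simp [*]
    obtain ⟨x, y, z, e⟩ := H.E_ne
    apply e
    rw [this, ExtV_zero]
    simp [KV, cub, cubx, cuby]
  have hw : ∀ x y, (q2 a x y*y*y)*(cub a x y 0*q2x a x y-q2 a x y*cubx a x y 0) =0 := by
    intro x y
    apply mul_left_cancel₀ hs
    have := (hz x y).2
    simp only [cubx, cub, c0, c1, c2, c3] at this ⊢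
    simp only [q2, q2x] at this ⊢
    linear_combination this
  have nqyy : ∃ x y, q2 a x y*y*y ≠0 := nz_mul (f := fun x y => q2 a x y*y) (g := fun x y => y)
    (by intros; simp only [q2]; fun_prop) (by intros; fun_prop) nqy ⟨0,1, one_ne_zero⟩
  have e1 := (mul_zero' hw (by intros; simp only [q2]; fun_prop)
    (by intros; simp only [q2, q2x, cub, cubx]; fun_prop)).resolve_left (by push Not; exact nqyy)
  obtain ⟨a0, t, a1, a2, a3⟩ := qdep (f0 := a 0) (f1 := a 1) (f2 := a 2) (f3 := a 3) hq (fun y => by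
    have := e1 1 y
    simp only [q2, q2x, cub, cubx] at this
    linear_combination -this)
  obtain ⟨x, y, hxy, hr⟩ := q2root a
  refine H.nocom hxy fun u z => ?_
  obtain ⟨h7, h8, h9⟩ := ha
  obtain ⟨k4, k5, k6, k7, k8, k9⟩ := hc
  simp only [q2] at hr
  refine ⟨?_, by simp [cub], ?_⟩
  · simp only [cub, h7, h8, h9, a0, a1, a2, a3]
    linear_combination (u^2*z+t*u^3*y)*hr
  · simp only [cub, k4, k5, k6, k7, k8, k9, c0, c1, c2, c3]
    linear_combination (s*u^3*y)*hr
lemma NU2k {a b c : Fin 10 → ℂ} (H : Bad a b c) (ha : N2 a) (hb : N2 b) (hc : N3 c) (x y : ℂ) :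
    k5 a b x y =0 ∧ k6 a b x y =0 := by
  have hE := NU2off H ha hb hc
  obtain ⟨h7, h8, h9⟩ := ha
  obtain ⟨g7, g8, g9⟩ := hb
  obtain ⟨l4, l5, l6, l7, l8, l9⟩ := hc
  have key : ∃ u v w, ∀ z, ExtV a b c x y z = u+v*z+w*z^2+k6 a b x y*z^3+k5 a b x y*z^4 := by
    refine ⟨ExtV a b c x y 0, (KV a b x y 0+cub c x y 0*(cub a x y 0*q2 b x y-cub b x y 0*q2 a x y))
      + (x*q2 b x y-y*q2 a x y)*(cub a x y 0*cubx c x y 0+cub b x y 0*cuby c x y 0)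
      + (x*cub b x y 0-y*cub a x y 0)*(q2 a x y*cubx c x y 0+q2 b x y*cuby c x y 0)
      + cub c x y 0*(y*(cub a x y 0*q2x a x y+q2 a x y*cubx a x y 0+cub b x y 0*q2y a x y+q2 b x y*cuby a x y 0)
        - x*(cub a x y 0*q2x b x y+q2 a x y*cubx b x y 0+cub b x y 0*q2y b x y+q2 b x y*cuby b x y 0)),
      k7 a b x y+(x*q2 b x y-y*q2 a x y)*(q2 a x y*cubx c x y 0+q2 b x y*cuby c x y 0)
      + cub c x y 0*(y*(q2 a x y*q2x a x y+q2 b x y*q2y a x y)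
        - x*(q2 a x y*q2x b x y+q2 b x y*q2y b x y)), fun z => ?_⟩
    simp only [ExtV, KV, k5, k6, k7, cub, cubx, cuby, cubz, q2, q2x, q2y, h7, h8, h9, g7, g8, g9, l4, l5, l6, l7, l8, l9]
    ring
  obtain ⟨u, v, w, h⟩ := key
  obtain ⟨-, -, -, e6, e5, -⟩ := poly8 (c0 := 0) (c1 := v) (c2 := w) (c3 := k6 a b x y) (c4 := k5 a b x y)
    (c5 := 0) (c6 := 0) (c7 := 0) (c8 := 0) (fun z => by
      have h0 := h 0
      rw [← hE x y z, h z] at h0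
      linear_combination h0)
  exact ⟨e5, e6⟩
lemma NU2x {a b c : Fin 10 → ℂ} (H : Bad a b c) (ha : N2 a) (hb : N3 b) (hc : N3 c) : False := by
  by_cases hq : a 4 =0 ∧ a 5 =0 ∧ a 6 =0
  · exact NU3 H ⟨hq.1, hq.2.1, hq.2.2, ha⟩ hb hc
  have dq : ∀ x0 y0 u v, Differentiable ℂ fun s : ℂ => q2 a (x0+s*u) (y0+s*v) := by
    intros; simp only [q2]; fun_prop
  obtain ⟨g4, g5, g6, hb2⟩ := id hb
  have hw : ∀ x y, (q2 a x y *1)*(q2 a x y*cubx b x y 0-cub b x y 0*q2x a x y) =0 := by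
    intro x y
    have := (NU2k H ha hb2 hc x y).2
    simp only [k6, cub, cubx, cuby, q2, q2x, q2y, g4, g5, g6] at this ⊢
    linear_combination this
  have e := (mul_zero' hw (by intros; simp only [q2]; fun_prop)
    (by intros; simp only [q2, q2x, cub, cubx]; fun_prop)).resolve_left (by push Not; simpa using nz_q2 hq)
  obtain ⟨b0, t, b1, b2, b3⟩ := qdep (f0 := b 0) (f1 := b 1) (f2 := b 2) (f3 := b 3) hq (fun y => by
    have := e 1 y
    simp only [q2, q2x, cub, cubx] at this
    linear_combination this)
  obtain ⟨h7, h8, h9⟩ := id ha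
  obtain ⟨g7, g8, g9⟩ := hb2
  obtain ⟨l4, l5, l6, l7, l8, l9⟩ := id hc
  refine NU2z (a := ![a 0-2*t*a 4, a 1-2*t*a 5, a 2-2*t*a 6, a 3, a 4, a 5, a 6,0,0,0])
    (c := ![c 0+t*a 0-t^2*a 4, c 1+t*a 1-t^2*a 5, c 2+t*a 2-t^2*a 6, c 3+t*a 3,0,0,0,0,0,0])
    (H.trans (M := !![1,0,0;0,1,0;-t,0,1]) (s := 1) (q := ![-t*a 4, -t*a 5, -t*a 6,0,0,0]) ?_ one_ne_zero ?_).1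
    (by simp [N2]) (by simp [N3, N2]) (by simpa using hq)
  · simp [Matrix.det_fin_three]
  · intro x y z
    simp [cub, lin, quad, h7, h8, h9, g4, g5, g6, g7, g8, g9, l4, l5, l6, l7, l8, l9, b0, b1, b2, b3]
    refine ⟨?_, ?_, ?_⟩ <;> ring
theorem NU2 {a b c : Fin 10 → ℂ} (H : Bad a b c) (ha : N2 a) (hb : N2 b) (hc : N3 c) : False := by
  rcases k5_zero (fun x y => (NU2k H ha hb hc x y).1) with ⟨e1, e2, e3, e4⟩ | ⟨e1, e2, e3⟩
  · by_cases hl : a 4 =0 ∧ a 5 =0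
    · exact NU3 H ⟨hl.1, hl.2, e4, ha⟩ ⟨e1, by rw [e2, hl.1], by rw [e3, hl.2], hb⟩ hc
    have hw : ∀ x y, (2*(a 4*x+a 5*y)^2)*(x*cub b x y 0-y*cub a x y 0) =0 := by
      intro x y
      have := (NU2k H ha hb hc x y).2
      simp only [k6, cub, cubx, cuby, q2, q2x, q2y, e1, e2, e3, e4] at this ⊢
      linear_combination this
    have e := (mul_zero' hw (by intros; fun_prop)
      (by intros; simp only [cub]; fun_prop)).resolve_left (by
        intro h
        have h0 := h 1 0
        have h1 := h 0 1
        simp at h0 h1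
        exact hl ⟨h0, h1⟩)
    obtain ⟨c0, c1, c2, c3, c4, -⟩ := poly8 (c0 := b 0) (c1 := b 1-a 0) (c2 := b 2-a 1) (c3 := b 3-a 2) (c4 := -a 3)
      (c5 := 0) (c6 := 0) (c7 := 0) (c8 := 0) (fun y => by
        have := e 1 y
        simp only [cub] at this
        linear_combination this)
    obtain ⟨x, y, z, h⟩ := H.E_ne
    apply h
    obtain ⟨h7, h8, h9⟩ := id ha
    obtain ⟨g7, g8, g9⟩ := id hb
    obtain ⟨l4, l5, l6, l7, l8, l9⟩ := id hc
    simp only [ExtV, cub, cubx, cuby, cubz, h7, h8, h9, g7, g8, g9, l4, l5, l6, l7, l8, l9, e1, e2, e3, e4, c0,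
      sub_eq_zero.1 c1, sub_eq_zero.1 c2, sub_eq_zero.1 c3, neg_eq_zero.1 c4]
    ring
  · by_cases hq : b 4 =0 ∧ b 5 =0 ∧ b 6 =0
    · exact NU2x H ha ⟨hq.1, hq.2.1, hq.2.2, hb⟩ hc
    obtain ⟨t, f1, f2, f3⟩ := ratio3 (f1 := a 4) (f2 := a 5) (f3 := a 6) hq
      (by linear_combination -e1) (by linear_combination -e2) (by linear_combination -e3)
    refine NU2x (H.swap.shear t) (hb.sw.shr t) ⟨?_, ?_, ?_, (ha.sw.shr t).sub (hb.sw.shr t) t⟩ (hc.sw.shr t)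
    · simp [shr, sw, f1, f2, f3]; ring
    · simp [shr, sw, f1, f2, f3]; ring
    · simp [shr, sw, f1, f2, f3]
lemma NU2Q {a b : Fin 10 → ℂ} (H : Bad a b 0) (h2 : a 2 =0) (h3 : a 3 =0) (h6 : a 6 =0) (g3 : b 3 =0) :
    False := by
  refine NU2 (a := ![a 0-b 1, a 4-b 5, a 7-b 8, a 9, a 1-b 2, a 5-b 6, a 8,0,0,0])
    (b := ![0, -b 1, -b 5, -b 8,0, -b 2, -b 6,0,0,0]) (c := ![b 0, b 4, b 7, b 9,0,0,0,0,0,0])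
    (H.trans (M := !![1,0,0;0,0,1;0,1,0]) (s := 1) (q := ![-b 1, -b 5, -b 8, -b 2, -b 6,0]) ?_ one_ne_zero ?_).1
    (by simp [N2]) (by simp [N2]) (by simp [N3, N2])
  · simp [Matrix.det_fin_three]
  · intro x y z
    simp [cub, lin, quad, h2, h3, h6, g3]
    refine ⟨?_, ?_, ?_⟩ <;> ring
lemma NUQ0 {a b : Fin 10 → ℂ} (H : Bad a b 0) (h0 : a 0 =0) (g0 : b 0 =0) (g1 : b 1 =0) (g4 : b 4 =0) :
    False :=
  NU2Q H.swap0 (by simp [sw, g1]) (by simp [sw, g0]) (by simp [sw, g4]) (by simp [sw, h0])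
lemma TwoL {a b : Fin 10 → ℂ} (H : Bad a b 0) (h3 : a 3 =0) (g3 : b 3 =0) {c d : ℂ}
    (hc : Gd a b 0 ![1,0, -c]) (hd : Gd a b 0 ![1,0, -d]) {G : (Fin 3 → ℂ) → Prop} {K : ℂ → ℂ → ℂ → ℂ}
    (hK : FactL G K) (e : ∀ x y z, KV a b x y z = (x-c*z)*(x-d*z)*K x y z) : False := by
  have inv : ∀ c, Gd a b 0 ![1,0, -c] → a 0*c^3+a 4*c^2+a 7*c+a 9 =0 ∧
      a 1*c^2+a 5*c+a 8 =0 ∧ a 2*c+a 6 =0 := by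
    intro c h
    obtain ⟨i, j, k, -⟩ := poly8 (c0 := a 0*c^3+a 4*c^2+a 7*c+a 9) (c1 := a 1*c^2+a 5*c+a 8)
      (c2 := a 2*c+a 6) (c3 := 0) (c4 := 0) (c5 := 0) (c6 := 0) (c7 := 0) (c8 := 0) (fun y => by
        have := h.2 c y 1 (by simp [lin])
        simp [cub, h3] at this
        linear_combination this)
    exact ⟨i, j, k⟩
  obtain ⟨i, j, k⟩ := inv c hc
  obtain ⟨i', j', k'⟩ := inv d hd
  have h2 : a 2 =0 := by
    by_contra h2
    have hcd : c = d := by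
      apply mul_left_cancel₀ h2; linear_combination k-k'
    subst hcd
    obtain ⟨t2, t1, t0⟩ := LemD (s2 := a 2) (s1 := 2*a 1*c+a 5) (s0 := 3*a 0*c^2+2*a 4*c+a 7)
      (t2 := b 2*c+b 6) (t1 := b 1*c^2+b 5*c+b 8) (t0 := b 0*c^3+b 4*c^2+b 7*c+b 9)
      (fun y => by
        have := sqcond (a := a) (b := b) (c := c) (y := y)
          (U := fun t => a 0*(3*c^2+3*c*t+t^2)+a 1*y*(2*c+t)+a 2*y^2
            + a 4*(2*c+t)+a 5*y+a 7)
          (V := fun t => a 1*(2*c+t)+2*a 2*y+a 5) (by fun_prop) (by fun_prop)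
          (fun t => by simp only [cub, h3]; linear_combination i+y*j+y^2*k)
          (fun t => by simp only [cuby, h3]; linear_combination j+2*y*k) hK e
        simp only [cub, cubx, cuby, g3, h3] at this
        linear_combination this) h2
    refine H.ncl ![1,0, -c] hc.1 fun x y z h => ?_
    have hx : x = c*z := by simp [lin] at h; linear_combination h
    have ha : cub a x y z =0 := by
      rw [hx]; simp only [cub, h3]
      linear_combination z^3*i+z^2*y*j+z*y^2*k
    have hb : cub b x y z =0 := by
      rw [hx]; simp only [cub, g3]
      linear_combination z^3*t0+z^2*y*t1+z*y^2*t2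
    simp [ha, hb, cub_zero]
  exact NU2Q H h2 h3 (by simpa [h2] using k) g3
lemma FactL.zpow {G : (Fin 3 → ℂ) → Prop} {K : ℂ → ℂ → ℂ → ℂ} (hK : FactL G K) (n : ℕ) :
    FactL (fun _ => True) (fun x y z => z ^ n*K x y z) := by
  obtain ⟨k, l, hk, -, e⟩ := hK
  refine ⟨k, List.replicate n ![0,0,1] ++ l, hk, fun _ _ => trivial, fun x y z => ?_⟩
  have : lin ![0,0,1] x y z = z := by simp [lin]
  simp only [e, List.map_append, List.prod_append, List.map_replicate, List.prod_replicate, this]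
  ring
lemma FD0 {a b : Fin 10 → ℂ} (H : Bad a b 0) (g3 : b 3 =0) (n : ℕ) {K1 : ℂ → ℂ → ℂ → ℂ}
    (hKV : ∀ x y z, KV a b x y z = z ^ n*K1 x y z) (hcont : ∀ x y, Continuous fun z => K1 x y z)
    (hnz : ∃ x y, K1 x y 0 ≠0) {f : ℂ → ℂ} (hf : Continuous f) (h1 : ∀ x, K1 x 1 0 = x*f x)
    (h2 : a 3 =0 → ∃ f2 : ℂ → ℂ, Continuous f2 ∧ ∀ x, K1 x 1 0 = x^2*f2 x) : False := by
  have hF : FactL (fun l => (l 0 ≠0 ∨ l 1 ≠0) ∧ Gd a b 0 l) K1 :=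
    tool2 (G := Gd a b 0) (E := ExtV a b 0) H.lines (fun l h => h.1) (n+1)
      (by intro x y z; rw [ExtV_zero, hKV]; ring) hcont hnz
  have h3 : a 3 =0 := by
    obtain ⟨c, g, -⟩ := hF.pullr Gd_smul (x0 := 0) (y0 := 1) (u := 1) (v := 0) (by norm_num) 0 hf
      (by intro s; simp [h1])
    have := g.2 0 1 0 (by simp [lin])
    simpa [cub] using this
  obtain ⟨f2, hf2, e2⟩ := h2 h3
  obtain ⟨c, g, K2, hK2, e, f', hf', e'⟩ := hF.pullr Gd_smul (x0 := 0) (y0 := 1) (u := 1) (v := 0) (by norm_num) 1 hf2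
      (by intro s; simp [e2])
  obtain ⟨d, g', K3, hK3, e3, -⟩ := hK2.pullr Gd_smul (by norm_num) 0 hf' e'
  refine TwoL H h3 g3 (c := c) (d := d) (by simpa using g) (by simpa using g') (hK3.zpow n) fun x y z => ?_
  rw [hKV, e, e3]; ring
lemma FD1 {a b : Fin 10 → ℂ} (H : Bad a b 0) (g3 : b 3 =0) (n : ℕ) {K1 : ℂ → ℂ → ℂ → ℂ}
    (hKV : ∀ x y z, KV a b x y z = z ^ n*K1 x y z) (hcont : ∀ x y, Continuous fun z => K1 x y z)
    {g W : ℂ → ℂ → ℂ} (hk : ∀ x y, K1 x y 0 = g x y*W x y) {h : ℂ → ℂ} (hw : ∀ x, W x 1 = x*h x)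
    (hh : Continuous h) (hg : Continuous fun x => g x 1) (hnz : ∃ x y, g x y*W x y ≠0)
    (h2 : a 3 =0 → ∃ f2 : ℂ → ℂ, Continuous f2 ∧ ∀ x, g x 1 = x*f2 x) : False := by
  refine FD0 H g3 n hKV hcont (by simpa only [hk] using hnz) (f := fun x => g x 1*h x) (hg.mul hh)
    (fun x => by rw [hk, hw]; ring) (fun e => ?_)
  obtain ⟨f2, hf2, e2⟩ := h2 e
  exact ⟨fun x => f2 x*h x, hf2.mul hh, fun x => by rw [hk, hw, e2]; ring⟩
def xs (t : ℂ) (a : Fin 10 → ℂ) : Fin 10 → ℂ := sw (shr t (sw a))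
lemma cub_xs (t : ℂ) (a : Fin 10 → ℂ) (x y z : ℂ) : cub (xs t a) x y z = cub a (x+t*y) y z := by
  rw [xs, cub_sw, cub_shr, cub_sw]
lemma Bad.xs {a b : Fin 10 → ℂ} (H : Bad a b 0) (t : ℂ) : Bad (xs t a-t • _root_.xs t b) (_root_.xs t b) 0 := by
  refine (H.trans (M := !![1,t,0;0,1,0;0,0,1]) (s := 1) (q := 0) ?_ one_ne_zero ?_).1
  · simp [Matrix.det_fin_three]
  · intro x y z
    simp [cub_xs, cub_sub, lin, quad, cub_zero]
def T0 (b : Fin 10 → ℂ) : Prop := b 0 =0 ∧ b 1 =0 ∧ b 2 =0 ∧ b 3 =0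
lemma T0.xs {b : Fin 10 → ℂ} (h : T0 b) (t : ℂ) : T0 (xs t b) := by
  obtain ⟨h0, h1, h2, h3⟩ := h
  simp [T0, _root_.xs, sw, shr, h0, h1, h2, h3]
lemma T0.g_ne {a b : Fin 10 → ℂ} (H : Bad a b 0) (h : T0 b) : ∃ x y, cub a x y 0 ≠0 := by
  by_contra! hc
  refine H.ncl ![0,0,1] (fun e => by simpa using congrFun e 2) fun x y z e => ?_
  have hz : z =0 := by simpa [lin] using e
  subst hz
  obtain ⟨h0, h1, h2, h3⟩ := h
  have : cub b x y 0 =0 := by simp [cub, h0, h1, h2, h3]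
  simp [hc, this, cub_zero]
def Wf (a b : Fin 10 → ℂ) (x y : ℂ) : ℂ := cub a x y 0*q2x b x y-q2 b x y*cubx a x y 0
lemma KV_T0 {a b : Fin 10 → ℂ} (h : T0 b) : ∃ K1 : ℂ → ℂ → ℂ → ℂ, (∀ x y, Continuous fun z => K1 x y z) ∧
    (∀ x y z, KV a b x y z = z^1*K1 x y z) ∧ ∀ x y, K1 x y 0 = cub a x y 0*Wf a b x y := by
  obtain ⟨h0, h1, h2, h3⟩ := h
  refine ⟨fun x y z => cub a x y z*(cub a x y z*(2*b 4*x+b 5*y+z*b 7)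
      + (q2 b x y+z*(b 7*x+b 8*y)+z^2*b 9)*(z*(b 5*x+2*b 6*y)+z^2*b 8))
      - (q2 b x y+z*(b 7*x+b 8*y)+z^2*b 9)*(cub a x y z*cubx a x y z
      + z*(q2 b x y+z*(b 7*x+b 8*y)+z^2*b 9)*cuby a x y z), ?_, ?_, ?_⟩
  · intro x y; simp only [cub, cubx, cuby]; fun_prop
  · intro x y z
    simp only [KV, cub, cubx, cuby, q2, h0, h1, h2, h3]; ring
  · intro x y
    simp only [Wf, q2x, q2]; ring
lemma DW0 {a b : Fin 10 → ℂ} (H : Bad a b 0) (hb : T0 b) (hW : ∃ x y, Wf a b x y ≠0)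
    (h : a 3*b 5-a 2*b 6 =0) : False := by
  obtain ⟨K1, hc, hK, hk⟩ := KV_T0 (a := a) hb
  have hw : ∀ x, Wf a b x 1 = x*(-a 0*b 4*x^3-2*a 0*b 5*x^2 +
      (a 2*b 4-a 1*b 5-3*a 0*b 6)*x+(2*a 3*b 4-2*a 1*b 6)) := by
    intro x
    simp only [Wf, cub, cubx, q2, q2x]; linear_combination h
  refine FD1 H hb.2.2.2 1 hK hc (g := fun x y => cub a x y 0) hk hw (by fun_prop) (by simp only [cub]; fun_prop) ?_
    (fun h3 => ⟨fun x => a 0*x^2+a 1*x+a 2, by fun_prop, fun x => by simp only [cub, h3]; ring⟩)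
  exact nz_mul (f := fun x y => cub a x y 0) (by intros; simp only [cub]; fun_prop)
      (by intros; simp only [Wf, cub, cubx, q2, q2x]; fun_prop) (T0.g_ne H hb) hW
lemma DW {a b : Fin 10 → ℂ} (H : Bad a b 0) (hb : T0 b) (hW : ∃ x y, Wf a b x y ≠0) : False := by
  by_cases hr : ∃ t, Wf a b t 1 =0
  · obtain ⟨t, ht⟩ := hr
    obtain ⟨h0, h1, h2, h3⟩ := id hb
    refine DW0 (H.xs t) (hb.xs t) ?_ ?_
    · obtain ⟨x, y, e⟩ := hW
      refine ⟨x-t*y, y, fun e' => e ?_⟩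
      rw [← e']
      simp [Wf, cub, cubx, q2, q2x, _root_.xs, sw, shr, h0, h1, h2, h3]; ring
    · simp only [Wf, cub, cubx, q2, q2x] at ht
      simp [_root_.xs, sw, shr, h0, h1, h2, h3]
      linear_combination ht
  push Not at hr
  obtain ⟨c1, c2, c3, c4⟩ := noroot (c0 := a 3*b 5-a 2*b 6) (c1 := 2*a 3*b 4-2*a 1*b 6)
    (c2 := a 2*b 4-a 1*b 5-3*a 0*b 6) (c3 := - 2*a 0*b 5) (c4 := -a 0*b 4) (fun x e => hr x (by
      simp only [Wf, cub, cubx, q2, q2x]; linear_combination e))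
  have n0 : a 3*b 5-a 2*b 6 ≠0 := fun e => hr 0 (by
    simp only [Wf, cub, cubx, q2, q2x]; linear_combination e)
  by_cases h0 : a 0 =0
  · refine NUQ0 H h0 hb.1 hb.2.1 ?_
    by_contra h4
    apply n0
    apply mul_left_cancel₀ h4
    simp only [h0] at c2
    linear_combination b 5*c1 / 2-b 6*c2
  · have h4 : b 4 =0 := by simpa [h0] using c4
    have h5 : b 5 =0 := by simpa [h0] using c3
    have h6 : b 6 =0 := by simpa [h0, h4, h5] using c2
    exact n0 (by rw [h5, h6]; ring)
lemma DK0 {a b : Fin 10 → ℂ} (H : Bad a b 0) (hb : T0 b) {κ : ℂ} (hκ : κ ≠0) (a0 : a 0 =0) (a1 : a 1 = κ*b 4)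
    (a2 : a 2 = κ*b 5) (a3 : a 3 = κ*b 6) (h4 : b 4 ≠0)
    (h : κ*(b 6*b 7-b 8*b 5)+(a 6*b 5-b 6*a 5)-b 6^2 =0) : False := by
  obtain ⟨h0, h1, h2, h3⟩ := id hb
  let U : ℂ → ℂ → ℂ := fun x y => κ*y^2*(q2 b x y*b 7-(b 7*x+b 8*y)*q2x b x y)
    + y*(q2 a x y*q2x b x y-q2 b x y*q2x a x y)-q2 b x y^2
  obtain ⟨K1, hc, hK, hk⟩ : ∃ K1 : ℂ → ℂ → ℂ → ℂ, (∀ x y, Continuous fun z => K1 x y z) ∧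
      (∀ x y z, KV a b x y z = z^2*K1 x y z) ∧ ∀ x y, K1 x y 0 = κ*q2 b x y*U x y := by
    let D : ℂ → ℂ → ℂ → ℂ := fun x y z => q2 a x y+z*(a 7*x+a 8*y)+z^2*a 9
    let B1 : ℂ → ℂ → ℂ → ℂ := fun x y z => b 7*x+b 8*y+z*b 9
    let Dx : ℂ → ℂ → ℂ → ℂ := fun x y z => q2x a x y+z*a 7
    let Dy : ℂ → ℂ → ℂ → ℂ := fun x y z => q2y a x y+z*a 8
    refine ⟨fun x y z =>
      2 * κ*y*q2 b x y*D x y z*q2x b x y+(κ*y*q2 b x y)^2*b 7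
      + z*(D x y z^2*q2x b x y+2 * κ*y*q2 b x y*D x y z*b 7+z*D x y z^2*b 7)
      + (κ*y*q2 b x y+z*D x y z)*(q2 b x y+z*B1 x y z)*(q2y b x y+z*b 8-Dx x y z)
      - κ*y*q2x b x y*(κ*y*q2 b x y*B1 x y z+D x y z*q2 b x y+z*D x y z*B1 x y z)
      - (q2 b x y+z*B1 x y z)^2*(κ*q2 b x y+κ*y*q2y b x y+z*Dy x y z), ?_, ?_, ?_⟩
    · intro x y; simp only [D, B1, Dx, Dy]; fun_prop
    · intro x y z
      simp only [KV, cub, cubx, cuby, q2, q2x, q2y, D, B1, Dx, Dy, h0, h1, h2, h3, a0, a1, a2, a3]; ring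
    · intro x y
      simp only [U, D, B1, Dx, Dy]; ring
  have hw : ∀ x, U x 1 = x*(-b 4^2*x^3-2*b 4*b 5*x^2 +
      (- κ*b 4*b 7+a 5*b 4-a 4*b 5-b 5^2-2*b 4*b 6)*x
      + (-2 * κ*b 8*b 4+2*a 6*b 4-2*b 6*a 4-2*b 5*b 6)) := by
    intro x
    simp only [U, q2, q2x]; linear_combination h
  refine FD1 H h3 2 hK hc (g := fun x y => κ*q2 b x y) hk hw (by fun_prop) (by simp only [q2]; fun_prop)
    ⟨1,0, by simp [U, q2, hκ, h4]⟩
    (fun g3 => ⟨fun x => κ*(b 4*x+b 5), by fun_prop, fun x => ?_⟩)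
  have h6 : b 6 =0 := by simpa [a3, hκ] using g3
  simp only [q2, h6]; ring
lemma DK {a b : Fin 10 → ℂ} (H : Bad a b 0) (hb : T0 b) {κ : ℂ} (hκ : κ ≠0) (a0 : a 0 =0) (a1 : a 1 = κ*b 4)
    (a2 : a 2 = κ*b 5) (a3 : a 3 = κ*b 6) : False := by
  obtain ⟨h0, h1, h2, h3⟩ := id hb
  by_cases h4 : b 4 =0
  · exact NUQ0 H a0 h0 h1 h4
  by_cases hr : ∃ t, κ*(q2 b t 1*b 7-(b 7*t+b 8)*q2x b t 1)
    + (q2 a t 1*q2x b t 1-q2 b t 1*q2x a t 1)-q2 b t 1^2 =0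
  · obtain ⟨t, ht⟩ := hr
    refine DK0 (H.xs t) (hb.xs t) (κ := κ) hκ ?_ ?_ ?_ ?_ ?_ ?_
    · simp [xs, sw, shr, h0, h1, h2, h3, a0, a1, a2, a3]
    · simp [xs, sw, shr, h0, h1, h2, h3, a0, a1, a2, a3]
    · simp [xs, sw, shr, h0, h1, h2, h3, a0, a1, a2, a3]; ring
    · simp [xs, sw, shr, h0, h1, h2, h3, a0, a1, a2, a3]; ring
    · simpa [xs, sw, shr] using h4
    · simp only [q2, q2x] at ht
      simp [xs, sw, shr]
      linear_combination ht
  push Not at hr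
  obtain ⟨-, -, -, c4⟩ := noroot (c0 := κ*(b 6*b 7-b 8*b 5)+(a 6*b 5-b 6*a 5)-b 6^2)
    (c1 := -2 * κ*b 8*b 4+2*a 6*b 4-2*b 6*a 4-2*b 5*b 6)
    (c2 := - κ*b 4*b 7+a 5*b 4-a 4*b 5-b 5^2-2*b 4*b 6)
    (c3 := - 2*b 4*b 5) (c4 := -b 4^2) (fun x e => hr x (by
      simp only [q2, q2x]; linear_combination e))
  simp [h4] at c4
lemma DV0 {a b : Fin 10 → ℂ} (H : Bad a b 0) (hb : T0 b) (b4 : b 4 =0) (b5 : b 5 =0) (b6 : b 6 =0)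
    (n0 : a 0 ≠0) (h78 : ¬ (b 7 =0 ∧ b 8 =0)) (h : a 3*b 7-a 2*b 8 =0) : False := by
  obtain ⟨h0, h1, h2, h3⟩ := id hb
  let V : ℂ → ℂ → ℂ := fun x y => cub a x y 0*b 7-(b 7*x+b 8*y)*cubx a x y 0
  obtain ⟨K1, hc, hK, hk⟩ : ∃ K1 : ℂ → ℂ → ℂ → ℂ, (∀ x y, Continuous fun z => K1 x y z) ∧
      (∀ x y z, KV a b x y z = z^2*K1 x y z) ∧ ∀ x y, K1 x y 0 = cub a x y 0*V x y := by
    refine ⟨fun x y z => cub a x y z*(cub a x y z*b 7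
      + (b 7*x+b 8*y+z*b 9)*(z^2*b 8))
      - (b 7*x+b 8*y+z*b 9)*(cub a x y z*cubx a x y z
      + z^2*(b 7*x+b 8*y+z*b 9)*cuby a x y z), ?_, ?_, ?_⟩
    · intro x y; simp only [cub, cubx, cuby]; fun_prop
    · intro x y z
      simp only [KV, cub, cubx, cuby, h0, h1, h2, h3, b4, b5, b6]; ring
    · intro x y
      simp only [V]; ring
  have hw : ∀ x, V x 1 = x*(-2*a 0*b 7*x^2+(-a 1*b 7-3*a 0*b 8)*x-2*a 1*b 8) := by
    intro x
    simp only [V, cub, cubx]; linear_combination h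
  refine FD1 H h3 2 hK hc (g := fun x y => cub a x y 0) hk hw (by fun_prop) (by simp only [cub]; fun_prop) ?_
    (fun h3 => ⟨fun x => a 0*x^2+a 1*x+a 2, by fun_prop, fun x => by simp only [cub, h3]; ring⟩)
  refine nz_mul (f := fun x y => cub a x y 0) (by intros; simp only [cub]; fun_prop)
    (by intros; simp only [V, cub, cubx]; fun_prop) (T0.g_ne H hb) ?_
  by_contra! hcon
  obtain ⟨c0, c1, -⟩ := poly8 (c0 := -2*a 0*b 7) (c1 := -a 1*b 7-3*a 0*b 8) (c2 := -2*a 1*b 8)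
    (c3 := a 3*b 7-a 2*b 8) (c4 := 0) (c5 := 0) (c6 := 0) (c7 := 0) (c8 := 0) (fun y => by
      have := hcon 1 y
      simp only [V, cub, cubx] at this; linear_combination this)
  have b7 : b 7 =0 := by simpa [n0] using c0
  exact h78 ⟨b7, by simpa [b7, n0] using c1⟩
lemma DV {a b : Fin 10 → ℂ} (H : Bad a b 0) (hb : T0 b) (b4 : b 4 =0) (b5 : b 5 =0) (b6 : b 6 =0)
    (n0 : a 0 ≠0) : b 7 =0 ∧ b 8 =0 := by
  by_contra h78
  obtain ⟨h0, h1, h2, h3⟩ := id hb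
  by_cases hr : ∃ t, cub a t 1 0*b 7-(b 7*t+b 8)*cubx a t 1 0 =0
  · obtain ⟨t, ht⟩ := hr
    refine DV0 (H.xs t) (hb.xs t) ?_ ?_ ?_ ?_ ?_ ?_
    · simp [xs, sw, shr, b4, b5, b6]
    · simp [xs, sw, shr, b4, b5, b6]
    · simp [xs, sw, shr, b4, b5, b6]
    · simpa [xs, sw, shr, h0, h1, h2, h3] using n0
    · rintro ⟨i, j⟩
      simp [xs, sw, shr] at i j
      simp [i] at j
      exact h78 ⟨i, j⟩
    · simp only [cub, cubx] at ht
      simp [xs, sw, shr, h0, h1, h2, h3]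
      linear_combination ht
  push Not at hr
  obtain ⟨c1, c2, c3, -⟩ := noroot (c0 := a 3*b 7-a 2*b 8) (c1 := -2*a 1*b 8)
    (c2 := -a 1*b 7-3*a 0*b 8) (c3 := - 2*a 0*b 7) (c4 := 0) (fun x e => hr x (by
      simp only [cub, cubx]; linear_combination e))
  have b7 : b 7 =0 := by simpa [n0] using c3
  exact h78 ⟨b7, by simpa [b7, n0] using c2⟩
lemma DG0 {a b : Fin 10 → ℂ} (H : Bad a b 0) (hb : T0 b) (b4 : b 4 =0) (b5 : b 5 =0) (b6 : b 6 =0)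
    (b7 : b 7 =0) (b8 : b 8 =0) (n9 : b 9 ≠0) (n0 : a 0 ≠0) (h : a 2 =0) : False := by
  obtain ⟨h0, h1, h2, h3⟩ := id hb
  refine FD0 H h3 3 (K1 := fun x y z => - b 9*(cub a x y z*cubx a x y z+b 9*z^3*cuby a x y z)) ?_ ?_
    ⟨1,0, by simp [cub, cubx, n0, n9]⟩ (f := fun x => -b 9*(cub a x 1 0*(3*a 0*x+2*a 1))) ?_ (fun x => ?_)
    (fun g3 => ⟨fun x => - b 9*((a 0*x^2+a 1*x)*(3*a 0*x+2*a 1)), ?_, fun x => ?_⟩)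
  · intro x y z
    simp only [KV, cub, cubx, cuby, h0, h1, h2, h3, b4, b5, b6, b7, b8]; ring
  · intro x y; simp only [cub, cubx, cuby]; fun_prop
  · simp only [cub]; fun_prop
  · simp only [cub, cubx, h]; ring
  · fun_prop
  · simp only [cub, cubx, h, g3]; ring
lemma DG {a b : Fin 10 → ℂ} (H : Bad a b 0) (hb : T0 b) (b4 : b 4 =0) (b5 : b 5 =0) (b6 : b 6 =0) :
    False := by
  obtain ⟨h0, h1, h2, h3⟩ := id hb
  by_cases n0 : a 0 =0
  · exact NUQ0 H n0 h0 h1 b4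
  obtain ⟨b7, b8⟩ := DV H hb b4 b5 b6 n0
  by_cases n9 : b 9 =0
  · obtain ⟨x, y, z, e⟩ := H.E_ne
    apply e
    rw [ExtV_zero]
    simp [KV, cub, cubx, h0, h1, h2, h3, b4, b5, b6, b7, b8, n9]
  obtain ⟨t, t', ht⟩ := quadroots (s := 3*a 0) (p := 2*a 1) (q := a 2) (by simpa using n0)
  have ht := ht t
  refine DG0 (H.xs t) (hb.xs t) ?_ ?_ ?_ ?_ ?_ ?_ ?_ ?_
  · simp [xs, sw, shr, b4, b5, b6]
  · simp [xs, sw, shr, b4, b5, b6]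
  · simp [xs, sw, shr, b4, b5, b6]
  · simp [xs, sw, shr, b7, b8]
  · simp [xs, sw, shr, b7, b8]
  · simpa [xs, sw, shr] using n9
  · simpa [xs, sw, shr, h0, h1, h2, h3] using n0
  · simp [xs, sw, shr, h0, h1, h2, h3]
    linear_combination ht
theorem Dbl {a b : Fin 10 → ℂ} (H : Bad a b 0) (hb : T0 b) : False := by
  by_cases hW : ∃ x y, Wf a b x y ≠0
  · exact DW H hb hW
  push Not at hW
  by_cases hq : b 4 =0 ∧ b 5 =0 ∧ b 6 =0
  · exact DG H hb hq.1 hq.2.1 hq.2.2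
  obtain ⟨a0, κ, a1, a2, a3⟩ := qdep (f0 := a 0) (f1 := a 1) (f2 := a 2) (f3 := a 3) hq (fun y => by
    have := hW 1 y
    simp only [Wf, q2, q2x, cub, cubx] at this
    linear_combination -this)
  refine DK H hb (κ := κ) ?_ a0 a1 a2 a3
  rintro rfl
  obtain ⟨x, y, e⟩ := T0.g_ne H hb
  apply e
  simp [cub, a0, a1, a2, a3]
theorem Main0 {a b : Fin 10 → ℂ} (H : Bad a b 0) : False := by
  by_cases hJ : ∃ x y, Jf a b x y ≠0
  · obtain ⟨a', b', H', hJ', h3, g3, -⟩ := comroot H hJ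
    obtain ⟨c, d, K, hc, hd, hF, e⟩ := ord2c H' (H'.KV_nz hJ') h3 g3
    exact TwoL H' h3 g3 hc hd hF e
  push Not at hJ
  rcases depB (fun t => hJ 1 t) with h | ⟨t, ht⟩
  · exact Dbl H h
  · exact Dbl (H.swap0.shear0 t) ⟨ht 0, ht 1, ht 2, ht 3⟩
lemma cub_subst (M : Matrix (Fin 3) (Fin 3) ℂ) (a : Fin 10 → ℂ) : ∃ a' : Fin 10 → ℂ,
    ∀ x y z, cub a' x y z = cub a (lin (M 0) x y z) (lin (M 1) x y z) (lin (M 2) x y z) := by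
  obtain ⟨a', h⟩ := exists_Pc (subst3_homog (M := M) (Pc_homog a))
  refine ⟨a', fun x y z => ?_⟩
  have := congrArg (eval ![x, y, z]) h
  rw [eval_subst3, eval_Pc, eval_Pc] at this
  simpa using this.symm
lemma exists_RelV (M : Matrix (Fin 3) (Fin 3) ℂ) (hM : M.det ≠0) (a b c : Fin 10 → ℂ) :
    ∃ a' b' c', RelV M 1 0 a b c a' b' c' := by
  obtain ⟨a1, ha⟩ := cub_subst M a
  obtain ⟨b1, hb⟩ := cub_subst M b
  obtain ⟨c1, hc⟩ := cub_subst M c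
  have e1 := Matrix.mul_nonsing_inv M (isUnit_iff_ne_zero.2 hM)
  have e : ∀ i j, M i 0*M⁻¹ 0 j+M i 1*M⁻¹ 1 j+M i 2*M⁻¹ 2 j
      = (1 : Matrix (Fin 3) (Fin 3) ℂ) i j := by
    intro i j; rw [← e1, Matrix.mul_apply, Fin.sum_univ_three]
  have key : ∀ i x y z, cub (fun j => M⁻¹ i 0*a1 j+M⁻¹ i 1*b1 j+M⁻¹ i 2*c1 j) x y z
      = M⁻¹ i 0*cub a1 x y z+M⁻¹ i 1*cub b1 x y z+M⁻¹ i 2*cub c1 x y z := by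
    intro i x y z; simp only [cub]; ring
  refine ⟨fun j => M⁻¹ 0 0*a1 j+M⁻¹ 0 1*b1 j+M⁻¹ 0 2*c1 j,
    fun j => M⁻¹ 1 0*a1 j+M⁻¹ 1 1*b1 j+M⁻¹ 1 2*c1 j,
    fun j => M⁻¹ 2 0*a1 j+M⁻¹ 2 1*b1 j+M⁻¹ 2 2*c1 j, ?_⟩
  intro x y z
  have hq : quad 0 x y z =0 := by simp [quad]
  rw [key 0, key 1, key 2, hq, ← ha, ← hb, ← hc]
  generalize cub a1 x y z = u
  generalize cub b1 x y z = v
  generalize cub c1 x y z = w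
  have f : ∀ i, (1 : Matrix (Fin 3) (Fin 3) ℂ) i 0*u+(1 : Matrix (Fin 3) (Fin 3) ℂ) i 1*v
      + (1 : Matrix (Fin 3) (Fin 3) ℂ) i 2*w =
      M i 0*(M⁻¹ 0 0*u+M⁻¹ 0 1*v+M⁻¹ 0 2*w) +
      M i 1*(M⁻¹ 1 0*u+M⁻¹ 1 1*v+M⁻¹ 1 2*w) +
      M i 2*(M⁻¹ 2 0*u+M⁻¹ 2 1*v+M⁻¹ 2 2*w) := by
    intro i; rw [← e i 0, ← e i 1, ← e i 2]; ring
  refine ⟨?_, ?_, ?_⟩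
  · rw [← f]; simp
  · rw [← f]; simp
  · rw [← f]; simp
lemma exists_frame {m : Fin 3 → ℂ} (hm : m ≠0) : ∃ M : Matrix (Fin 3) (Fin 3) ℂ,
    M.det ≠0 ∧ pl M m 0 =0 ∧ pl M m 1 =0 ∧ pl M m 2 ≠0 := by
  by_cases h2 : m 2 =0
  · by_cases h1 : m 1 =0
    · have h0 : m 0 ≠0 := by
        intro h0; apply hm; funext i; fin_cases i <;> assumption
      exact ⟨!![0,0,1;1,0,0;0,1,0], by simp [Matrix.det_fin_three], by simp [pl, h1, h2],
        by simp [pl, h1, h2], by simp [pl, h1, h2, h0]⟩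
    · exact ⟨!![1,0,0;-m 0/m 1,0,1;0,1,0], by simp [Matrix.det_fin_three],
        by simp [pl, h2]; field_simp; ring, by simp [pl, h2], by simp [pl, h1, h2]⟩
  · exact ⟨!![1,0,0;0,1,0;-m 0/m 2,-m 1/m 2,1], by simp [Matrix.det_fin_three],
        by simp [pl]; field_simp; ring, by simp [pl]; field_simp; ring, by simp [pl, h2]⟩
theorem Main {a b c : Fin 10 → ℂ} (H : Bad a b c) : False := by
  obtain ⟨m, hm, hi⟩ : ∃ m, m ≠0 ∧ InvL a b c m := by
    obtain ⟨k, l, hk, hl, e⟩ := H.lines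
    cases l with
    | nil => have := e 0 0 0; simp [ExtV] at this; exact absurd this.symm hk
    | cons m l => exact ⟨m, hl m (by simp)⟩
  obtain ⟨M, hM, h0, h1, h2⟩ := exists_frame hm
  obtain ⟨a', b', c', hR⟩ := exists_RelV M hM a b c
  have H' := (H.trans hM one_ne_zero hR).1
  have hi' := hR.inv hi
  have hc : ∀ x y, cub c' x y 0 =0 := by
    intro x y
    have := hi' x y 0 (by simp [lin, h0, h1])
    simpa [h0, h1, h2] using this
  have k1 := hc 1 0
  have k2 := hc 0 1
  have k3 := hc 1 1
  have k4 := hc 1 (-1)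
  simp [cub] at k1 k2 k3 k4
  have c1 : c' 1 =0 := by rw [k1, k2] at k3 k4; linear_combination k3 / 2-k4 / 2
  have c2 : c' 2 =0 := by rw [k1, k2] at k3 k4; linear_combination k3 / 2+k4 / 2
  refine Main0 (a := ![a' 0-c' 4, a' 1-c' 5, a' 2-c' 6, a' 3, a' 4-c' 7, a' 5-c' 8, a' 6,
    a' 7-c' 9, a' 8, a' 9]) (b := ![b' 0, b' 1-c' 4, b' 2-c' 5, b' 3-c' 6, b' 4, b' 5-c' 7,
    b' 6-c' 8, b' 7, b' 8-c' 9, b' 9])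
    (H'.trans (M := !![1,0,0;0,1,0;0,0,1]) (s := 1)
    (q := ![-c' 4, -c' 5, -c' 6, -c' 7, -c' 8, -c' 9]) ?_ one_ne_zero ?_).1
  · simp [Matrix.det_fin_three]
  · intro x y z
    simp [cub, lin, quad, k1, k2, c1, c2]
    refine ⟨by ring, by ring, by ring⟩
lemma exists_row {L : MvPolynomial (Fin 3) ℂ} (h : L.IsHomogeneous 1) :
    ∃ l : Fin 3 → ℂ, L = C (l 0)*X 0+C (l 1)*X 1+C (l 2)*X 2 := by
  have hp : ∀ i, ∃ k, pderiv i L = C k := by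
    intro i
    have := h.pderiv (i := i)
    simp only [Nat.sub_self] at this
    exact ⟨_, (totalDegree_eq_zero_iff_eq_C).1 ((totalDegree_zero_iff_isHomogeneous (p := pderiv i L)).2 this)⟩
  choose l hl using hp
  refine ⟨l, ?_⟩
  have := Euler3 h
  simp only [Zop, hl, Nat.cast_one, one_mul] at this
  rw [← this]; ring
lemma X2_dvd {Q : MvPolynomial (Fin 3) ℂ} (h : ∀ x y, eval ![x, y,0] Q =0) : X 2 ∣ Q := by
  have key : X 2 ∣ Q-subst3 !![1,0,0;0,1,0;0,0,0] Q := by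
    clear h
    induction Q using MvPolynomial.induction_on with
    | C a => simp [subst3_C]
    | add p r hp hr =>
      rw [subst3_add]
      have := dvd_add hp hr
      convert this using 1; ring
    | mul_X p i hp =>
      rw [subst3_mul, subst3_X]
      fin_cases i
      · obtain ⟨u, hu⟩ := hp
        exact ⟨u*X 0, by simp [rowL]; linear_combination X 0*hu⟩
      · obtain ⟨u, hu⟩ := hp
        exact ⟨u*X 1, by simp [rowL]; linear_combination X 1*hu⟩
      · exact ⟨p, by simp [rowL]; ring⟩
  have h0 : subst3 !![1,0,0;0,1,0;0,0,0] Q =0 := by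
    refine MvPolynomial.funext fun v => ?_
    rw [eval_subst3]
    have e : (fun i => lin (!![(1:ℂ),0,0;0,1,0;0,0,0] i) (v 0) (v 1) (v 2)) = ![v 0, v 1,0] := by
      funext i; fin_cases i <;> simp [lin]
    rw [e, h]; simp
  rwa [h0, sub_zero] at key
lemma line_dvd {l : Fin 3 → ℂ} (hl : l ≠0) : ∃ h : MvPolynomial (Fin 3) ℂ, ¬ IsUnit h ∧
    ∀ P : MvPolynomial (Fin 3) ℂ, (∀ v : Fin 3 → ℂ, lin l (v 0) (v 1) (v 2) =0 → eval v P =0) →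
      h ∣ P := by
  obtain ⟨M, hM, h0, h1, h2⟩ := exists_frame hl
  refine ⟨rowL M⁻¹ 2, ?_, ?_⟩
  · intro hu
    have := hu.map (eval (0 : Fin 3 → ℂ))
    simp [rowL] at this
  · intro P hP
    have : X 2 ∣ subst3 M P := by
      refine X2_dvd fun x y => ?_
      rw [eval_subst3]
      apply hP
      rw [← lin_pl]
      simp [lin, h0, h1]
    obtain ⟨u, hu⟩ := this
    refine ⟨subst3 M⁻¹ u, ?_⟩
    have e := congrArg (subst3 M⁻¹) hu
    rw [subst3_comp, Matrix.mul_nonsing_inv _ (isUnit_iff_ne_zero.2 hM), subst3_mul, subst3_X] at e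
    rw [← e]
    refine MvPolynomial.funext fun v => ?_
    rw [eval_subst3]
    congr 2
    funext i; fin_cases i <;> simp [lin, Matrix.one_apply]
lemma mkBad {a b c : Fin 10 → ℂ}
    (hng : ∀ i : Fin 4, ¬ LinConj3 (OmZ (Pc a) (Pc b) (Pc c))
        (OmZ (models10 i).1 (models10 i).2.1 (models10 i).2.2))
    (hf : ∀ h : MvPolynomial (Fin 3) ℂ, (∀ i, h ∣ OmZ (Pc a) (Pc b) (Pc c) i) → IsUnit h)
    (hc : ConvexFol (Pc a) (Pc b) (Pc c)) : Bad a b c := by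
  refine ⟨hng, ?_, ?_⟩
  · intro l hl hS
    obtain ⟨h, hu, hd⟩ := line_dvd hl
    refine hu (hf h fun i => hd _ fun v hv => ?_)
    obtain ⟨s0, s1, s2⟩ := hS _ _ _ hv
    fin_cases i
    · simp [OmZ, eval_Pc]; linear_combination -s0
    · simp [OmZ, eval_Pc]; linear_combination -s1
    · simp [OmZ, eval_Pc]; linear_combination -s2
  · obtain ⟨n, k, L, hk, hL, e⟩ := hc
    choose l hl using fun i => exists_row (hL i).1
    have ev : ∀ i v, eval v (L i) = lin (l i) (v 0) (v 1) (v 2) := by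
      intro i v; rw [hl]; simp [lin]
    refine ⟨k, List.ofFn l, hk, ?_, ?_⟩
    · intro m hm
      rw [List.mem_ofFn] at hm
      obtain ⟨i, rfl⟩ := hm
      refine ⟨?_, ?_⟩
      · intro h0
        apply (hL i).2.1
        rw [hl, h0]; simp
      · intro x y z hxy
        obtain ⟨u, hu⟩ := (hL i).2.2
        have h1 := congrArg (eval ![x, y, z]) hu
        rw [map_mul, ev] at h1
        simp only [Matrix.cons_val] at h1
        rw [hxy, zero_mul, hl] at h1
        simp only [Zop_add, Zop_mul, Zop_C, Zop_X0, Zop_X1, Zop_X2] at h1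
        simp [eval_Pc] at h1
        exact h1
    · intro x y z
      have h1 := congrArg (eval ![x, y, z]) e
      rw [eval_ext, map_mul, map_prod] at h1
      simp only [ev, eval_C, Matrix.cons_val] at h1
      rw [h1, List.map_ofFn, List.prod_ofFn]
      rfl
lemma C3e : (C 3 : MvPolynomial (Fin 3) ℂ) =3 := map_ofNat C 3
lemma C6e : (C 6 : MvPolynomial (Fin 3) ℂ) =6 := map_ofNat C 6
lemma ext0 : extactic (X 0^3) (X 1^3) 0 =
    C (-3)*(X 2*X 0^3*X 1^3*(X 0-X 1)*(X 0+X 1)) := by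
  rw [extactic_eq, Matrix.det_fin_three]
  simp [Zop, pderiv_X, Derivation.leibniz, Derivation.leibniz_pow, C3e]
  ring
lemma ext1 : extactic (X 0^2*(X 0+3*X 1)) (X 1^2*(3*X 0+X 1)) 0 =
    C (-6)*(X 2*X 0^2*X 1^2*(X 0-X 1)*(X 0+X 1)^3) := by
  have e3 : (3 : MvPolynomial (Fin 3) ℂ) = C 3 := C3e.symm
  have e6 : (C (-6) : MvPolynomial (Fin 3) ℂ) = -6 := by rw [map_neg, C6e]
  rw [extactic_eq, Matrix.det_fin_three, e6]
  simp only [Matrix.of_apply, Matrix.cons_val, pow_succ, pow_zero, one_mul, Zop_mul, Zop_add,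
    Zop_X0, Zop_X1, e3, Zop_C]
  rw [← e3]
  simp [Zop]
  ring
lemma ext2 : extactic 0 (X 1^3) (X 0^3) = C (-3)*(X 0^4*X 1^5) := by
  rw [extactic_eq, Matrix.det_fin_three]
  simp [Zop, pderiv_X, Derivation.leibniz, Derivation.leibniz_pow, C3e]
  ring
lemma ext3 : extactic (X 0^3) (X 1^3) (X 2^3) =
    C 3*(X 0*X 1*X 2*(X 0-X 1)*(X 0+X 1)*(X 0-X 2)*(X 0+X 2)
      * (X 1-X 2)*(X 1+X 2))*C (-1) := by
  rw [extactic_eq, Matrix.det_fin_three]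
  simp [Zop, pderiv_X, Derivation.leibniz, Derivation.leibniz_pow, C3e]
  ring
lemma Zop_sub (A B Cz f g : MvPolynomial (Fin 3) ℂ) :
    Zop A B Cz (f-g) = Zop A B Cz f-Zop A B Cz g := by
  simp only [Zop, map_sub]; ring
def GLn (A B D L : MvPolynomial (Fin 3) ℂ) : Prop :=
  L.IsHomogeneous 1 ∧ L ≠0 ∧ LineInvZ A B D L
lemma GLn_X {A B D : MvPolynomial (Fin 3) ℂ} (i : Fin 3) (h : X i ∣ Zop A B D (X i)) :
    GLn A B D (X i) := ⟨isHomogeneous_X _ _, X_ne_zero _, h⟩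
lemma sub_nz {i j : Fin 3} (h : i ≠ j) : (X i-X j : MvPolynomial (Fin 3) ℂ) ≠0 := by
  intro e
  have := congrArg (eval (Pi.single i (1:ℂ))) e
  simp [h.symm] at this
lemma add_nz {i j : Fin 3} (h : i ≠ j) : (X i+X j : MvPolynomial (Fin 3) ℂ) ≠0 := by
  intro e
  have := congrArg (eval (Pi.single i (1:ℂ))) e
  simp [h.symm] at this
lemma GLn_sub {A B D : MvPolynomial (Fin 3) ℂ} {i j : Fin 3} (hij : i ≠ j)
    (h : X i-X j ∣ Zop A B D (X i)-Zop A B D (X j)) :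
    GLn A B D (X i-X j) :=
  ⟨(isHomogeneous_X _ _).sub (isHomogeneous_X _ _), sub_nz hij, by rw [LineInvZ, Zop_sub]; exact h⟩
lemma GLn_add {A B D : MvPolynomial (Fin 3) ℂ} {i j : Fin 3} (hij : i ≠ j)
    (h : X i+X j ∣ Zop A B D (X i)+Zop A B D (X j)) :
    GLn A B D (X i+X j) :=
  ⟨(isHomogeneous_X _ _).add (isHomogeneous_X _ _), add_nz hij, by rw [LineInvZ, Zop_add]; exact h⟩
lemma mkConv {A B D : MvPolynomial (Fin 3) ℂ} (k : ℂ) (hk : k ≠0)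
    (l : List (MvPolynomial (Fin 3) ℂ)) (hl : ∀ L ∈ l, GLn A B D L)
    (e : extactic A B D = C k*l.prod) : ConvexFol A B D := by
  refine ⟨l.length, k, fun i => l.get i, hk, fun i => hl _ (l.get_mem i), ?_⟩
  rw [e, ← List.prod_ofFn, List.ofFn_get]
lemma cube_sub (x y : MvPolynomial (Fin 3) ℂ) : x-y ∣ x^3-y^3 := sub_dvd_pow_sub_pow _ _ _
lemma cube_add (x y : MvPolynomial (Fin 3) ℂ) : x+y ∣ x^3+y^3 :=
  ⟨x^2-x*y+y^2, by ring⟩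
lemma cube_self (x : MvPolynomial (Fin 3) ℂ) : x ∣ x^3 := dvd_pow_self _ (by norm_num)
lemma conv_all (i : Fin 4) : ConvexFol (models10 i).1 (models10 i).2.1 (models10 i).2.2 := by
  fin_cases i
  · refine mkConv (A := X 0^3) (B := X 1^3) (D := 0) (-3) (by norm_num)
      [X 2, X 0, X 0, X 0, X 1, X 1, X 1, X 0-X 1, X 0+X 1] ?_ ?_
    · have h0 : GLn (X 0^3) (X 1^3) 0 (X 0) := GLn_X 0 (by rw [Zop_X0]; exact cube_self _)
      have h1 : GLn (X 0^3) (X 1^3) 0 (X 1) := GLn_X 1 (by rw [Zop_X1]; exact cube_self _)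
      have h2 : GLn (X 0^3) (X 1^3) 0 (X 2) := GLn_X 2 (by rw [Zop_X2]; exact dvd_zero _)
      have h3 : GLn (X 0^3) (X 1^3) 0 (X 0-X 1) :=
        GLn_sub (by decide) (by rw [Zop_X0, Zop_X1]; exact cube_sub _ _)
      have h4 : GLn (X 0^3) (X 1^3) 0 (X 0+X 1) :=
        GLn_add (by decide) (by rw [Zop_X0, Zop_X1]; exact cube_add _ _)
      simp [h0, h1, h2, h3, h4]
    · rw [ext0]; simp; ring
  · refine mkConv (A := X 0^2*(X 0+3*X 1)) (B := X 1^2*(3*X 0+X 1)) (D := 0)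
      (-6) (by norm_num)
      [X 2, X 0, X 0, X 1, X 1, X 0-X 1, X 0+X 1, X 0+X 1, X 0+X 1] ?_ ?_
    · generalize hA : (X 0^2*(X 0+3*X 1) : MvPolynomial (Fin 3) ℂ) = A
      generalize hB : (X 1^2*(3*X 0+X 1) : MvPolynomial (Fin 3) ℂ) = B
      have h0 : GLn A B 0 (X 0) := GLn_X 0 (by
        rw [Zop_X0]; exact ⟨X 0*(X 0+3*X 1), by rw [← hA]; ring⟩)
      have h1 : GLn A B 0 (X 1) := GLn_X 1 (by
        rw [Zop_X1]; exact ⟨X 1*(3*X 0+X 1), by rw [← hB]; ring⟩)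
      have h2 : GLn A B 0 (X 2) := GLn_X 2 (by rw [Zop_X2]; exact dvd_zero _)
      have h3 : GLn A B 0 (X 0-X 1) :=
        GLn_sub (by decide) (by
          rw [Zop_X0, Zop_X1]; exact ⟨X 0^2+4*X 0*X 1+X 1^2, by rw [← hA, ← hB]; ring⟩)
      have h4 : GLn A B 0 (X 0+X 1) :=
        GLn_add (by decide) (by
          rw [Zop_X0, Zop_X1]; exact ⟨(X 0+X 1)^2, by rw [← hA, ← hB]; ring⟩)
      simp [h0, h1, h2, h3, h4]
    · rw [ext1]; simp; ring
  · refine mkConv (A := 0) (B := X 1^3) (D := X 0^3) (-3) (by norm_num)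
      [X 0, X 0, X 0, X 0, X 1, X 1, X 1, X 1, X 1] ?_ ?_
    · have h0 : GLn 0 (X 1^3) (X 0^3) (X 0) := GLn_X 0 (by rw [Zop_X0]; exact dvd_zero _)
      have h1 : GLn 0 (X 1^3) (X 0^3) (X 1) := GLn_X 1 (by rw [Zop_X1]; exact cube_self _)
      simp [h0, h1]
    · rw [ext2]; simp; ring
  · refine mkConv (A := X 0^3) (B := X 1^3) (D := X 2^3) (-3) (by norm_num)
      [X 0, X 1, X 2, X 0-X 1, X 0+X 1, X 0-X 2, X 0+X 2, X 1-X 2, X 1+X 2] ?_ ?_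
    · have h0 : GLn (X 0^3) (X 1^3) (X 2^3) (X 0) := GLn_X 0 (by rw [Zop_X0]; exact cube_self _)
      have h1 : GLn (X 0^3) (X 1^3) (X 2^3) (X 1) := GLn_X 1 (by rw [Zop_X1]; exact cube_self _)
      have h2 : GLn (X 0^3) (X 1^3) (X 2^3) (X 2) := GLn_X 2 (by rw [Zop_X2]; exact cube_self _)
      have h3 : ∀ i j : Fin 3, i ≠ j → GLn (X 0^3) (X 1^3) (X 2^3) (X i-X j) := by
        intro i j h
        have : ∀ i : Fin 3, Zop (X 0^3) (X 1^3) (X 2^3) (X i) = (X i : MvPolynomial (Fin 3) ℂ)^3 := by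
          intro i; fin_cases i <;> simp [Zop_X0, Zop_X1, Zop_X2]
        exact GLn_sub h (by rw [this, this]; exact cube_sub _ _)
      have h4 : ∀ i j : Fin 3, i ≠ j → GLn (X 0^3) (X 1^3) (X 2^3) (X i+X j) := by
        intro i j h
        have : ∀ i : Fin 3, Zop (X 0^3) (X 1^3) (X 2^3) (X i) = (X i : MvPolynomial (Fin 3) ℂ)^3 := by
          intro i; fin_cases i <;> simp [Zop_X0, Zop_X1, Zop_X2]
        exact GLn_add h (by rw [this, this]; exact cube_add _ _)
      simp [h0, h1, h2, h3, h4]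
    · rw [ext3]; simp; ring
lemma subst3_one (f : MvPolynomial (Fin 3) ℂ) : subst3 1 f = f := by
  refine MvPolynomial.funext fun v => ?_
  rw [eval_subst3]
  congr 2
  funext i; fin_cases i <;> simp [lin, Matrix.one_apply]
lemma X_dvd_cancel {i j : Fin 3} (h : i ≠ j) {P : MvPolynomial (Fin 3) ℂ}
    (hd : X i ∣ X j*P) : X i ∣ P := by
  rcases X_dvd_mul_iff.1 hd with h1 | h1
  · exact absurd (X_dvd_X.1 h1) h
  · exact h1
lemma conjExt {A B D A' B' D' : MvPolynomial (Fin 3) ℂ} (hA : A.IsHomogeneous 3)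
    (hB : B.IsHomogeneous 3) (hD : D.IsHomogeneous 3) (hA' : A'.IsHomogeneous 3)
    (hB' : B'.IsHomogeneous 3) (hD' : D'.IsHomogeneous 3)
    (h : LinConj3 (OmZ A B D) (OmZ A' B' D')) :
    ∃ (M : Matrix (Fin 3) (Fin 3) ℂ) (k : ℂ), M.det ≠0 ∧ k ≠0 ∧
      extactic A' B' D' = C k*subst3 M (extactic A B D) := by
  obtain ⟨M, c, hM, hc, e⟩ := h
  have hM' : M.det ≠0 := isUnit_iff_ne_zero.1 hM
  obtain ⟨a, rfl⟩ := exists_Pc hA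
  obtain ⟨b, rfl⟩ := exists_Pc hB
  obtain ⟨d, rfl⟩ := exists_Pc hD
  obtain ⟨a1, b1, d1, hR⟩ := exists_RelV M hM' a b d
  have hP := hR.toP
  have k1 : ∀ i, OmZ (Pc a1) (Pc b1) (Pc d1) i = C (M.det⁻¹*c)*OmZ A' B' D' i := by
    intro i
    have h1 := hP.pb i
    rw [e, map_one, one_mul] at h1
    beta_reduce at h1
    rw [map_mul, mul_assoc, h1, ← mul_assoc, ← map_mul, inv_mul_cancel₀ hM']
    simp
  have ht : M.det⁻¹*c ≠0 := mul_ne_zero (inv_ne_zero hM') hc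
  generalize M.det⁻¹*c = t at k1 ht
  have w0 := k1 0
  have w1 := k1 1
  have w2 := k1 2
  simp only [OmZ, Matrix.cons_val] at w0 w1 w2
  have hx : X 0 ∣ Pc a1-C t*A' := by
    refine X_dvd_cancel (j := 1) (by decide) ⟨Pc b1-C t*B', ?_⟩
    linear_combination w2
  obtain ⟨q, hq⟩ := hx
  have hq1 : Pc b1-C t*B' = X 1*q := by
    refine mul_left_cancel₀ (X_ne_zero (R := ℂ) (0 : Fin 3)) ?_
    linear_combination -w2+X 1*hq
  have hq2 : Pc d1-C t*D' = X 2*q := by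
    refine mul_left_cancel₀ (X_ne_zero (R := ℂ) (0 : Fin 3)) ?_
    linear_combination w1+X 2*hq
  have hP2 : RelP 1 t q A' B' D' (Pc a1) (Pc b1) (Pc d1) := by
    refine ⟨?_, ?_, ?_⟩ <;> rw [Zop_rowL, subst3_one] <;> simp [rowL]
    · linear_combination hq
    · linear_combination hq1
    · linear_combination hq2
  have e1 := hP2.ext hA' hB' hD'
  have e2 := hP.ext (Pc_homog a) (Pc_homog b) (Pc_homog d)
  rw [subst3_one, Matrix.det_one, map_one, one_mul] at e1
  rw [e1, one_pow, map_one, one_mul, ← mul_assoc, ← map_mul] at e2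
  have hk : M.det*t^3 ≠0 := mul_ne_zero hM' (pow_ne_zero _ ht)
  refine ⟨M, (M.det*t^3)⁻¹, hM', inv_ne_zero hk, ?_⟩
  rw [← e2, ← mul_assoc, ← map_mul, inv_mul_cancel₀ hk, map_one, one_mul]
def LP (l : Fin 3 → ℂ) : MvPolynomial (Fin 3) ℂ := C (l 0)*X 0+C (l 1)*X 1+C (l 2)*X 2
def Crs (f g : Fin 3 → ℂ) : Prop :=
  f 0*g 1 = f 1*g 0 ∧ f 0*g 2 = f 2*g 0 ∧ f 1*g 2 = f 2*g 1
lemma LP_dvd {l f : Fin 3 → ℂ} (h : LP l ∣ LP f) : Crs f l := by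
  obtain ⟨u, hu⟩ := h
  have h1 := congrArg (eval ![l 1, -l 0,0]) hu
  have h2 := congrArg (eval ![l 2,0, -l 0]) hu
  have h3 := congrArg (eval ![0, l 2, -l 1]) hu
  simp [LP] at h1 h2 h3
  refine ⟨?_, ?_, ?_⟩
  · rw [mul_comm (l 0) (l 1), add_neg_cancel, zero_mul] at h1; linear_combination h1
  · rw [mul_comm (l 0) (l 2), add_neg_cancel, zero_mul] at h2; linear_combination h2
  · rw [mul_comm (l 1) (l 2), add_neg_cancel, zero_mul] at h3; linear_combination h3
lemma Crs_trans {l f g : Fin 3 → ℂ} (hl : l ≠0) (h1 : Crs f l) (h2 : Crs g l) : Crs f g := by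
  obtain ⟨a1, a2, a3⟩ := h1
  obtain ⟨b1, b2, b3⟩ := h2
  have : l 0 ≠0 ∨ l 1 ≠0 ∨ l 2 ≠0 := by
    by_contra hh
    push Not at hh
    apply hl; funext i; fin_cases i
    · exact hh.1
    · exact hh.2.1
    · exact hh.2.2
  rcases this with h | h | h <;> refine ⟨?_, ?_, ?_⟩ <;> refine mul_left_cancel₀ h ?_ <;> grind
lemma LP_nz {l : Fin 3 → ℂ} (hl : l ≠0) : LP l ≠0 := by
  intro h
  apply hl; apply lin_inj
  intro x y z
  have := congrArg (eval ![x, y, z]) h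
  simpa [LP, lin] using this
lemma LP_homog (l : Fin 3 → ℂ) : (LP l).IsHomogeneous 1 := by
  unfold LP
  exact ((IsHomogeneous.C_mul (isHomogeneous_X _ _) _).add
    (IsHomogeneous.C_mul (isHomogeneous_X _ _) _)).add
    (IsHomogeneous.C_mul (isHomogeneous_X _ _) _)
lemma LP_prime {l : Fin 3 → ℂ} (hl : l ≠0) : Prime (LP l) := by
  obtain ⟨M, hM, h0, h1, h2⟩ := exists_frame hl
  have key : ∀ P, LP l ∣ P ↔ X 2 ∣ subst3 M P := by
    have e : subst3 M (LP l) = C (pl M l 2)*X 2 := by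
      refine MvPolynomial.funext fun v => ?_
      rw [eval_subst3]
      have := lin_pl M l (v 0) (v 1) (v 2)
      simp only [LP, map_add, map_mul, eval_C, eval_X]
      rw [lin, lin, h0, h1] at this
      linear_combination -this
    have e' : subst3 M⁻¹ (X 2) = C (pl M l 2)⁻¹*LP l := by
      have := congrArg (subst3 M⁻¹) e
      rw [subst3_comp, Matrix.mul_nonsing_inv _ (isUnit_iff_ne_zero.2 hM), subst3_one, subst3_mul,
        subst3_C] at this
      rw [this, ← mul_assoc, ← map_mul, inv_mul_cancel₀ h2]; simp
    intro P
    constructor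
    · rintro ⟨u, rfl⟩
      rw [subst3_mul, e]
      exact ⟨C (pl M l 2)*subst3 M u, by ring⟩
    · rintro ⟨u, hu⟩
      have := congrArg (subst3 M⁻¹) hu
      rw [subst3_comp, Matrix.mul_nonsing_inv _ (isUnit_iff_ne_zero.2 hM), subst3_one, subst3_mul,
        e'] at this
      exact ⟨C (pl M l 2)⁻¹*subst3 M⁻¹ u, by rw [this]; ring⟩
  refine ⟨LP_nz hl, ?_, ?_⟩
  · intro hu
    have := hu.map (eval (0 : Fin 3 → ℂ))
    simp [LP] at this
  · intro P Q h
    rw [key, subst3_mul, X_dvd_mul_iff] at h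
    rw [key, key]; exact h
def LL (t : List ((Fin 3 → ℂ) × ℕ)) : MvPolynomial (Fin 3) ℂ :=
  (t.map (fun p => LP p.1 ^ p.2)).prod
lemma LP_ndvd {l : Fin 3 → ℂ} (hl : l ≠0) (t : List ((Fin 3 → ℂ) × ℕ))
    (h : ∀ p ∈ t, ¬ LP l ∣ LP p.1) : ¬ LP l ∣ LL t := by
  induction t with
  | nil => exact fun hd => (LP_prime hl).not_unit (isUnit_of_dvd_one (by simpa [LL] using hd))
  | cons p t ih =>
    intro hd
    have e : LL (p :: t) = LP p.1 ^ p.2*LL t := by simp [LL]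
    rw [e] at hd
    rcases (LP_prime hl).dvd_or_dvd hd with h1 | h1
    · exact h p (by simp) ((LP_prime hl).dvd_of_dvd_pow h1)
    · exact ih (fun r hr => h r (by simp [hr])) h1
lemma LP_mult {l : Fin 3 → ℂ} (hl : l ≠0) {k : ℕ} (hk : k ≠0) (t : List ((Fin 3 → ℂ) × ℕ))
    (ht : ∀ p ∈ t, p.1 ≠0 ∧ p.2 < k) (hp : t.Pairwise (fun p r => ¬ Crs p.1 r.1)) :
    ¬ LP l ^ k ∣ LL t := by
  induction t with
  | nil =>
    exact fun hd => LP_ndvd hl [] (by simp) ((dvd_pow_self _ hk).trans hd)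
  | cons p t ih =>
    intro hd
    have e : LL (p :: t) = LP p.1 ^ p.2*LL t := by simp [LL]
    rw [e] at hd
    rw [List.pairwise_cons] at hp
    by_cases h1 : LP l ∣ LP p.1
    · have h2 : ¬ LP l ∣ LL t := by
        refine LP_ndvd hl t fun r hr h3 => ?_
        exact hp.1 r hr (Crs_trans hl (LP_dvd h1) (LP_dvd h3))
      have h3 := (LP_prime hl).pow_dvd_of_dvd_mul_right _ h2 hd
      have hpz := LP_nz (ht p (by simp)).1
      have h4 := totalDegree_le_of_dvd_of_isDomain h3 (pow_ne_zero _ hpz)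
      rw [((LP_homog l).pow k).totalDegree (pow_ne_zero _ (LP_nz hl)),
        ((LP_homog p.1).pow p.2).totalDegree (pow_ne_zero _ hpz)] at h4
      have := (ht p (by simp)).2
      omega
    · have h2 : ¬ LP l ∣ LP p.1 ^ p.2 := fun h => h1 ((LP_prime hl).dvd_of_dvd_pow h)
      have h3 := (LP_prime hl).pow_dvd_of_dvd_mul_left _ h2 hd
      exact ih (fun r hr => ht r (by simp [hr])) hp.2 h3
def ERel (E E' : MvPolynomial (Fin 3) ℂ) : Prop :=
  ∃ (M : Matrix (Fin 3) (Fin 3) ℂ) (k : ℂ), M.det ≠0 ∧ k ≠0 ∧ E' = C k*subst3 M E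
lemma ERel.symm {E E' : MvPolynomial (Fin 3) ℂ} (h : ERel E E') : ERel E' E := by
  obtain ⟨M, k, hM, hk, rfl⟩ := h
  refine ⟨M⁻¹, k⁻¹, ?_, inv_ne_zero hk, ?_⟩
  · have := Matrix.isUnit_nonsing_inv_det M (isUnit_iff_ne_zero.2 hM)
    exact isUnit_iff_ne_zero.1 this
  · rw [subst3_mul, subst3_C, subst3_comp, Matrix.mul_nonsing_inv _ (isUnit_iff_ne_zero.2 hM),
      subst3_one, ← mul_assoc, ← map_mul, inv_mul_cancel₀ hk]
    simp
lemma row_nz {M : Matrix (Fin 3) (Fin 3) ℂ} (hM : M.det ≠0) (i : Fin 3) : M i ≠0 := by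
  intro h
  exact hM (Matrix.det_eq_zero_of_row_eq_zero i (fun j => congrFun h j))
lemma subst3_pow (M : Matrix (Fin 3) (Fin 3) ℂ) (f : MvPolynomial (Fin 3) ℂ) (n : ℕ) :
    subst3 M (f ^ n) = subst3 M f ^ n := by simp [subst3]
lemma row_dvd {E' F : MvPolynomial (Fin 3) ℂ} {M : Matrix (Fin 3) (Fin 3) ℂ} {k k0 : ℂ}
    (hk0 : k0 ≠0) (e : C k0*F = C k*subst3 M E') {n : ℕ} {i : Fin 3}
    (hd : X i ^ n ∣ E') : LP (M i) ^ n ∣ F := by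
  obtain ⟨u, rfl⟩ := hd
  rw [subst3_mul, subst3_pow, subst3_X] at e
  refine ⟨C (k0⁻¹*k)*subst3 M u, ?_⟩
  calc F = C k0⁻¹*(C k0*F) := by
        rw [← mul_assoc, ← map_mul, inv_mul_cancel₀ hk0]; simp
    _ = _ := by
        rw [e, map_mul]
        show _ = rowL M i ^ n * _
        ring
lemma noRel {E' : MvPolynomial (Fin 3) ℂ} {k0 : ℂ} {t : List ((Fin 3 → ℂ) × ℕ)} {n : ℕ}
    (hk0 : k0 ≠0) (hd : X 0 ^ n ∣ E') (hn : n ≠0) (ht : ∀ p ∈ t, p.1 ≠0 ∧ p.2 < n)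
    (hp : t.Pairwise (fun p r => ¬ Crs p.1 r.1)) : ¬ ERel E' (C k0*LL t) := by
  rintro ⟨M, k, hM, hk, e⟩
  exact LP_mult (row_nz hM 0) hn t ht hp (row_dvd hk0 e hd)
def t0 : List ((Fin 3 → ℂ) × ℕ) :=
  [(![0,0,1],1), (![1,0,0],3), (![0,1,0],3), (![1,-1,0],1), (![1,1,0],1)]
def t1 : List ((Fin 3 → ℂ) × ℕ) :=
  [(![0,0,1],1), (![1,0,0],2), (![0,1,0],2), (![1,-1,0],1)]
def t3 : List ((Fin 3 → ℂ) × ℕ) :=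
  [(![1,0,0],1), (![0,1,0],1), (![0,0,1],1), (![1,-1,0],1), (![1,1,0],1),
    (![1,0,-1],1), (![1,0,1],1), (![0,1,-1],1), (![0,1,1],1)]
def t1' : List ((Fin 3 → ℂ) × ℕ) := (![1,1,0],3) :: t1
lemma pw0 : t0.Pairwise (fun p r => ¬ Crs p.1 r.1) := by
  norm_num [t0, Crs]
  simp; try norm_num
lemma pw1 : t1'.Pairwise (fun p r => ¬ Crs p.1 r.1) := by
  norm_num [t1', t1, Crs]
  simp; try norm_num
lemma pw3 : t3.Pairwise (fun p r => ¬ Crs p.1 r.1) := by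
  norm_num [t3, Crs]
  simp; try norm_num
def EE (i : Fin 4) : MvPolynomial (Fin 3) ℂ :=
  extactic (models10 i).1 (models10 i).2.1 (models10 i).2.2
lemma EE0 : EE 0 = C (-3)*LL t0 := by
  show extactic (X 0^3) (X 1^3) 0 = _
  rw [ext0]; simp [LL, t0, LP]; ring
lemma EE1 : EE 1 = C (-6)*LL t1' := by
  show extactic (X 0^2*(X 0+3*X 1)) (X 1^2*(3*X 0+X 1)) 0 = _
  rw [ext1]; simp [LL, t1', t1, LP]; ring
lemma EE3 : EE 3 = C (-3)*LL t3 := by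
  show extactic (X 0^3) (X 1^3) (X 2^3) = _
  rw [ext3]; simp [LL, t3, LP]; ring
lemma D2 : X 0^4 ∣ EE 2 := by
  show _ ∣ extactic 0 (X 1^3) (X 0^3)
  rw [ext2]; exact ⟨C (-3)*X 1^5, by ring⟩
lemma D1 : X 0^2 ∣ EE 1 := by
  show _ ∣ extactic (X 0^2*(X 0+3*X 1)) (X 1^2*(3*X 0+X 1)) 0
  rw [ext1]; exact ⟨C (-6)*(X 2*X 1^2*(X 0-X 1)*(X 0+X 1)^3), by ring⟩
lemma D0 : X 0^3 ∣ EE 0 := by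
  show _ ∣ extactic (X 0^3) (X 1^3) 0
  rw [ext0]; exact ⟨C (-3)*(X 2*X 1^3*(X 0-X 1)*(X 0+X 1)), by ring⟩
lemma D0' : X 1^3 ∣ EE 0 := by
  show _ ∣ extactic (X 0^3) (X 1^3) 0
  rw [ext0]; exact ⟨C (-3)*(X 2*X 0^3*(X 0-X 1)*(X 0+X 1)), by ring⟩
lemma n20 : ¬ ERel (EE 2) (EE 0) := by
  rw [EE0]
  exact noRel (by norm_num) D2 (by norm_num) (by norm_num [t0]) pw0
lemma n21 : ¬ ERel (EE 2) (EE 1) := by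
  rw [EE1]
  exact noRel (by norm_num) D2 (by norm_num) (by norm_num [t1', t1]) pw1
lemma n23 : ¬ ERel (EE 2) (EE 3) := by
  rw [EE3]
  exact noRel (by norm_num) D2 (by norm_num) (by norm_num [t3]) pw3
lemma n13 : ¬ ERel (EE 1) (EE 3) := by
  rw [EE3]
  exact noRel (by norm_num) D1 (by norm_num) (by norm_num [t3]) pw3
lemma n03 : ¬ ERel (EE 0) (EE 3) := by
  rw [EE3]
  exact noRel (by norm_num) D0 (by norm_num) (by norm_num [t3]) pw3
lemma n01 : ¬ ERel (EE 0) (EE 1) := by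
  rw [EE1]
  rintro ⟨M, k, hM, hk, e⟩
  have hk0 : (-6 : ℂ) ≠0 := by norm_num
  have key : ∀ i, LP (M i)^3 ∣ LL t1' → Crs ![1,1,0] (M i) := by
    intro i hd
    apply LP_dvd
    by_contra h1
    have e1 : LL t1' = LP ![1,1,0] ^3*LL t1 := by simp [LL, t1']
    rw [e1] at hd
    have hpr := LP_prime (row_nz hM i)
    have h2 : ¬ LP (M i) ∣ LP ![1,1,0] ^3 := fun h => h1 (hpr.dvd_of_dvd_pow h)
    refine LP_mult (row_nz hM i) (k := 3) (by norm_num) t1 (by norm_num [t1]) ?_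
      (hpr.pow_dvd_of_dvd_mul_left _ h2 hd)
    have := pw1
    rw [t1', List.pairwise_cons] at this
    exact this.2
  obtain ⟨a1, a2, a3⟩ := key 0 (row_dvd hk0 e D0)
  obtain ⟨b1, b2, b3⟩ := key 1 (row_dvd hk0 e D0')
  simp at a1 a2 a3 b1 b2 b3
  apply hM
  rw [Matrix.det_fin_three, a1, a2, b1, b2]
  ring
lemma models_homog (i : Fin 4) : (models10 i).1.IsHomogeneous 3 ∧ (models10 i).2.1.IsHomogeneous 3 ∧
    (models10 i).2.2.IsHomogeneous 3 := by
  have hp : ∀ i : Fin 3, ((X i : MvPolynomial (Fin 3) ℂ)^3).IsHomogeneous 3 :=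
    fun i => (isHomogeneous_X ℂ i).pow 3
  have hz : (0 : MvPolynomial (Fin 3) ℂ).IsHomogeneous 3 := isHomogeneous_zero _ _ _
  have h1 : (X 0^2*(X 0+3*X 1) : MvPolynomial (Fin 3) ℂ) = Pc ![1,3,0,0,0,0,0,0,0,0] := by
    simp [Pc, C3e]; ring
  have h2 : (X 1^2*(3*X 0+X 1) : MvPolynomial (Fin 3) ℂ) = Pc ![0,0,3,1,0,0,0,0,0,0] := by
    simp [Pc, C3e]; ring
  have h3 : (X 0^2*(X 0+3*X 1) : MvPolynomial (Fin 3) ℂ).IsHomogeneous 3 := by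
    rw [h1]; exact Pc_homog _
  have h4 : (X 1^2*(3*X 0+X 1) : MvPolynomial (Fin 3) ℂ).IsHomogeneous 3 := by
    rw [h2]; exact Pc_homog _
  fin_cases i
  · exact ⟨hp 0, hp 1, hz⟩
  · exact ⟨h3, h4, hz⟩
  · exact ⟨hz, hp 1, hp 0⟩
  · exact ⟨hp 0, hp 1, hp 2⟩
lemma nERel {T : Type} (R : T → T → Prop) (hs : ∀ x y, R x y → R y x) (F : Fin 4 → T)
    (h01 : ¬ R (F 0) (F 1)) (h20 : ¬ R (F 2) (F 0)) (h21 : ¬ R (F 2) (F 1))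
    (h23 : ¬ R (F 2) (F 3)) (h13 : ¬ R (F 1) (F 3)) (h03 : ¬ R (F 0) (F 3))
    (i j : Fin 4) (hij : i ≠ j) (hE : R (F i) (F j)) : False := by
  have hS := hs _ _ hE
  have hc : ∀ i : Fin 4, i =0 ∨ i =1 ∨ i =2 ∨ i =3 := by decide
  rcases hc i with rfl | rfl | rfl | rfl <;> rcases hc j with rfl | rfl | rfl | rfl <;>
  first
  | exact absurd rfl hij
  | contradiction
lemma nonconj (i j : Fin 4) (hij : i ≠ j) :
    ¬ LinConj3 (OmZ (models10 i).1 (models10 i).2.1 (models10 i).2.2)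
        (OmZ (models10 j).1 (models10 j).2.1 (models10 j).2.2) := by
  intro h
  obtain ⟨p1, p2, p3⟩ := models_homog i
  obtain ⟨r1, r2, r3⟩ := models_homog j
  exact nERel ERel (fun _ _ h => h.symm) EE n01 n20 n21 n23 n13 n03 i j hij (conjExt p1 p2 p3 r1 r2 r3 h)
/-- **Classification of convex degree-3 foliations of `ℙ²(ℂ)`.**
Up to an automorphism of `ℙ²(ℂ)` there are exactly four convex degree-3 foliations,
namely `H₁`, `H₃`, `F₁` and `F₃` (the Fermat foliation): each of the four model
foliations is convex, they are pairwise not linearly conjugate, and every convex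
degree-3 foliation is linearly conjugate to one of them. -/
theorem stmt_10 :
    (∀ i : Fin 4,
      ConvexFol (models10 i).1 (models10 i).2.1 (models10 i).2.2) ∧
    (∀ i j : Fin 4, i ≠ j →
      ¬ LinConj3 (OmZ (models10 i).1 (models10 i).2.1 (models10 i).2.2)
        (OmZ (models10 j).1 (models10 j).2.1 (models10 j).2.2)) ∧
    (∀ A B Cz : MvPolynomial (Fin 3) ℂ,
      A.IsHomogeneous 3 → B.IsHomogeneous 3 → Cz.IsHomogeneous 3 →
      (∀ h : MvPolynomial (Fin 3) ℂ, h ∣ A → h ∣ B → h ∣ Cz → IsUnit h) →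
      IsFolDeg 3 (OmZ A B Cz) → ConvexFol A B Cz →
      ∃ i : Fin 4,
        LinConj3 (OmZ A B Cz)
          (OmZ (models10 i).1 (models10 i).2.1 (models10 i).2.2)) := by
  refine ⟨conv_all, nonconj, ?_⟩
  intro A B D hA hB hD _ hf hc
  obtain ⟨a, rfl⟩ := exists_Pc hA
  obtain ⟨b, rfl⟩ := exists_Pc hB
  obtain ⟨d, rfl⟩ := exists_Pc hD
  by_contra hn
  push Not at hn
  exact Main (mkBad hn hf.2.2.2 hc)
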